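/- arXiv:1911.06926 — 3 statements merged into one kernel-verified Lean document; each statement's English description precedes it below -/
import Mathlib

section
/- Let $D\in C^1(I)$ with $D\geq d>0$ and $G\in C^3(I)$ a double-well potential with equal wells at $\alpha<\beta$ (i.e. $G(\alpha)=G(\beta)=G'(\alpha)=G'(\beta)=0$, $G''(\alpha),G''(\beta)>0$, $G>0$ elsewhere on $I$). Set $\lambda=\min\{G''(\alpha)/D^2(\alpha),\,G''(\beta)/D^2(\beta)\}$, $\gamma_0=\int_\alpha^\beta\sqrt{2G(s)}D(s)\,ds$. Let $v:[a,b]\to\{\alpha,\beta\}$ be piecewise constant with $N$ jumps at $h_1<\dots<h_N$, each jump separated from the others and from $a,b$ by at least $r>0$, and let $A\in(0,r\sqrt{2\lambda})$. Then there exist $\varepsilon_0,C,\delta>0$, depending only on $G$, $D$, $v$, $A$, such that for every $u\in H^1(a,b)$ with values in a fixed compact subinterval of $I$ and $\|u-v\|_{L^1}\leq\delta$, and every $\varepsilon\in(0,\varepsilon_0)$, one has $E_\varepsilon[u]\geq N\gamma_0-C\exp(-A/\varepsilon)$, where $E_\varepsilon[u]=\int_a^b\{\frac{\varepsilon}{2}[D(u)u_x]^2+\frac{G(u)}{\varepsilon}\}dx$.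 -/
open MeasureTheory Set

/-- The Ginzburg-Landau energy density along `u`, where `u'` is the derivative of `u`. -/
noncomputable def glDensity (D G : ℝ → ℝ) (ε : ℝ) (u u' : ℝ → ℝ) (x : ℝ) : ℝ :=
  ε / 2 * (D (u x) * u' x) ^ 2 + G (u x) / ε

/-- `u` is differentiable on `[p, q]` with derivative `u'`, takes values in `I`, and has finite
Ginzburg-Landau energy. -/
structure FiniteEnergyOn (I : Set ℝ) (D G : ℝ → ℝ) (ε : ℝ) (u u' : ℝ → ℝ) (p q : ℝ) : Prop where
  hasDerivAt : ∀ x ∈ Icc p q, HasDerivAt u (u' x) x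
  mem : ∀ x ∈ Icc p q, u x ∈ I
  integrableOn : IntegrableOn (glDensity D G ε u u') (Icc p q)

/-- On the `ρ`-neighbourhood of the well `w`, the distance `|Ψ - Ψ w|` is controlled by `G / μ`;
on the `η`-neighbourhood it is at most `1` and at most half of its values at `w ± ρ`. -/
def IsWellNbhd (G Ψ : ℝ → ℝ) (w μ ρ η : ℝ) : Prop :=
  0 < η ∧ η < ρ ∧ (∀ s, |s - w| ≤ ρ → μ * |Ψ s - Ψ w| ≤ G s) ∧
    ∀ s, |s - w| ≤ η → |Ψ s - Ψ w| ≤ 1 ∧ ∀ t, |t - w| = ρ → 2 * |Ψ s - Ψ w| ≤ |Ψ t - Ψ w|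

theorem hasDerivAt_tanh (x : ℝ) : HasDerivAt Real.tanh (1 - Real.tanh x ^ 2) x := by
  have h := (Real.hasDerivAt_sinh x).div (Real.hasDerivAt_cosh x) (Real.cosh_pos x).ne'
  have e : Real.tanh = fun x => Real.sinh x / Real.cosh x := by
    funext y; exact Real.tanh_eq_sinh_div_cosh y
  rw [e]
  refine h.congr_deriv ?_
  have := (Real.cosh_pos x).ne'
  field_simp

theorem one_sub_two_mul_exp_le_tanh (y : ℝ) : 1 - 2 * Real.exp (-(2 * y)) ≤ Real.tanh y := by
  rw [Real.tanh_eq_sinh_div_cosh, le_div_iff₀ (Real.cosh_pos y), Real.sinh_eq, Real.cosh_eq]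
  have e : Real.exp (-(2 * y)) = Real.exp (-y) ^ 2 := by
    rw [← Real.exp_nat_mul]; congr 1; push_cast; ring
  have e1 : Real.exp y * Real.exp (-y) = 1 := by rw [← Real.exp_add]; simp
  rw [e]
  have hb := Real.exp_pos (-y)
  have e2 : Real.exp y * Real.exp (-y) ^ 2 = Real.exp (-y) := by rw [sq, ← mul_assoc, e1, one_mul]
  nlinarith [pow_pos hb 3]

theorem le_of_hasDerivAt_nonneg {f f' : ℝ → ℝ} {p q : ℝ} (hpq : p ≤ q)
    (hf : ∀ t ∈ Icc p q, HasDerivAt f (f' t) t) (hf' : ∀ t ∈ Icc p q, 0 ≤ f' t) : f p ≤ f q :=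
  monotoneOn_of_hasDerivWithinAt_nonneg (convex_Icc p q)
    (fun t ht => (hf t ht).continuousAt.continuousWithinAt)
    (fun t ht => (hf t (interior_subset ht)).hasDerivWithinAt)
    (fun t ht => hf' t (interior_subset ht)) (left_mem_Icc.2 hpq) (right_mem_Icc.2 hpq) hpq

theorem le_of_hasDerivAt_nonpos {f f' : ℝ → ℝ} {p q : ℝ} (hpq : p ≤ q)
    (hf : ∀ t ∈ Icc p q, HasDerivAt f (f' t) t) (hf' : ∀ t ∈ Icc p q, f' t ≤ 0) : f q ≤ f p :=
  antitoneOn_of_hasDerivWithinAt_nonpos (convex_Icc p q)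
    (fun t ht => (hf t ht).continuousAt.continuousWithinAt)
    (fun t ht => (hf t (interior_subset ht)).hasDerivWithinAt)
    (fun t ht => hf' t (interior_subset ht)) (left_mem_Icc.2 hpq) (right_mem_Icc.2 hpq) hpq

/-- A function vanishing at `w` whose derivative has the sign of `s - w` is nonnegative. -/
theorem nonneg_of_hasDerivAt_sign {f f' : ℝ → ℝ} {w ρ : ℝ} (hw : f w = 0)
    (hf : ∀ t, |t - w| ≤ ρ → HasDerivAt f (f' t) t)
    (hpos : ∀ t, |t - w| ≤ ρ → w ≤ t → 0 ≤ f' t)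
    (hneg : ∀ t, |t - w| ≤ ρ → t ≤ w → f' t ≤ 0) {s : ℝ} (hs : |s - w| ≤ ρ) : 0 ≤ f s := by
  rw [← hw]
  have hs' := abs_le.1 hs
  rcases le_total w s with h | h
  · have key : ∀ t ∈ Icc w s, |t - w| ≤ ρ := fun t ht =>
      abs_le.2 ⟨by linarith [ht.1], by linarith [ht.2]⟩
    exact le_of_hasDerivAt_nonneg h (fun t ht => hf t (key t ht))
      (fun t ht => hpos t (key t ht) ht.1)
  · have key : ∀ t ∈ Icc s w, |t - w| ≤ ρ := fun t ht =>
      abs_le.2 ⟨by linarith [ht.1], by linarith [ht.2]⟩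
    exact le_of_hasDerivAt_nonpos h (fun t ht => hf t (key t ht))
      (fun t ht => hneg t (key t ht) ht.2)

theorem exists_isWellNbhd {I : Set ℝ} (hI : IsOpen I) {D G Ψ : ℝ → ℝ} {w μ : ℝ} (hw : w ∈ I)
    (hD : ∀ s ∈ I, 0 < D s) (hDc : ContinuousOn D I)
    (hG1 : ∀ s ∈ I, HasDerivAt G (deriv G s) s)
    (hG2 : ∀ s ∈ I, HasDerivAt (deriv G) (deriv (deriv G) s) s)
    (hG2c : ContinuousOn (deriv (deriv G)) I) (hGw : G w = 0) (hG'w : deriv G w = 0)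
    (hμ : 0 < μ) (hμw : (μ * D w) ^ 2 < deriv (deriv G) w)
    (hΨ : ∀ s ∈ I, HasDerivAt Ψ (Real.sqrt (2 * G s) * D s) s) :
    ∃ ρ η, IsWellNbhd G Ψ w μ ρ η := by
  obtain ⟨q, hq1, hq2⟩ := exists_between hμw
  have hq0 : 0 < q := lt_of_le_of_lt (sq_nonneg _) hq1
  have hIw : I ∈ nhds w := hI.mem_nhds hw
  have ev1 : ∀ᶠ s in nhds w, (μ * D s) ^ 2 < q :=
    (((hDc.continuousAt hIw).const_mul μ).pow 2).eventually_lt continuousAt_const hq1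
  have ev2 : ∀ᶠ s in nhds w, q < deriv (deriv G) s :=
    continuousAt_const.eventually_lt (hG2c.continuousAt hIw) hq2
  obtain ⟨ρ, hρ, hball⟩ := Metric.nhds_basis_closedBall.eventually_iff.1
    ((ev1.and ev2).and hIw)
  have hb : ∀ s, |s - w| ≤ ρ → ((μ * D s) ^ 2 < q ∧ q < deriv (deriv G) s) ∧ s ∈ I :=
    fun s hs => hball (by rwa [Metric.mem_closedBall, Real.dist_eq])
  have hlin : ∀ s, HasDerivAt (fun t => q * (t - w)) q s := fun s => by
    simpa using ((hasDerivAt_id s).sub_const w).const_mul q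
  have hder : ∀ s, |s - w| ≤ ρ →
      HasDerivAt (fun t => deriv G t - q * (t - w)) (deriv (deriv G) s - q) s :=
    fun s hs => (hG2 s (hb s hs).2).sub (hlin s)
  have hG'pos : ∀ s, |s - w| ≤ ρ → w ≤ s → q * (s - w) ≤ deriv G s := by
    intro s hs hws
    have key : ∀ t ∈ Icc w s, |t - w| ≤ ρ := fun t ht =>
      abs_le.2 ⟨by linarith [ht.1], by linarith [ht.2, (abs_le.1 hs).2]⟩
    have := le_of_hasDerivAt_nonneg hws (fun t ht => hder t (key t ht))
      (fun t ht => by linarith [(hb t (key t ht)).1.2])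
    simp only [hG'w, sub_self, mul_zero] at this
    linarith
  have hG'neg : ∀ s, |s - w| ≤ ρ → s ≤ w → deriv G s ≤ q * (s - w) := by
    intro s hs hws
    have key : ∀ t ∈ Icc s w, |t - w| ≤ ρ := fun t ht =>
      abs_le.2 ⟨by linarith [ht.1, (abs_le.1 hs).1], by linarith [ht.2]⟩
    have := le_of_hasDerivAt_nonneg hws (fun t ht => hder t (key t ht))
      (fun t ht => by linarith [(hb t (key t ht)).1.2])
    simp only [hG'w, sub_self, mul_zero] at this
    linarith
  have hGquad : ∀ s, |s - w| ≤ ρ → q / 2 * (s - w) ^ 2 ≤ G s := by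
    intro s hs
    have := nonneg_of_hasDerivAt_sign (f := fun t => G t - q / 2 * (t - w) ^ 2)
      (f' := fun t => deriv G t - q * (t - w)) (w := w) (ρ := ρ) (by simp [hGw])
      (fun t ht => by
        have h2 := (((hasDerivAt_id t).sub_const w).pow 2).const_mul (q / 2)
        refine ((hG1 t (hb t ht).2).sub h2).congr_deriv ?_
        simp; ring)
      (fun t ht h => by linarith [hG'pos t ht h]) (fun t ht h => by linarith [hG'neg t ht h]) hs
    linarith
  have hGsq : ∀ s, |s - w| ≤ ρ → 2 * q * G s ≤ deriv G s ^ 2 := by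
    intro s hs
    have := nonneg_of_hasDerivAt_sign (f := fun t => deriv G t ^ 2 - 2 * q * G t)
      (f' := fun t => 2 * deriv G t * (deriv (deriv G) t - q)) (w := w) (ρ := ρ)
      (by simp [hGw, hG'w])
      (fun t ht => by
        have h2 := (hG2 t (hb t ht).2).pow 2
        refine (h2.sub ((hG1 t (hb t ht).2).const_mul (2 * q))).congr_deriv ?_
        simp; ring)
      (fun t ht h => by
        have h1 := hG'pos t ht h
        have h2 : 0 ≤ q * (t - w) := mul_nonneg hq0.le (by linarith)
        exact mul_nonneg (by linarith) (by linarith [(hb t ht).1.2]))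
      (fun t ht h => by
        have h1 := hG'neg t ht h
        have h2 : q * (t - w) ≤ 0 := mul_nonpos_of_nonneg_of_nonpos hq0.le (by linarith)
        exact mul_nonpos_of_nonpos_of_nonneg (by linarith) (by linarith [(hb t ht).1.2])) hs
    linarith
  have hG0 : ∀ s, |s - w| ≤ ρ → 0 ≤ G s := fun s hs =>
    le_trans (by positivity) (hGquad s hs)
  have hslope : ∀ s, |s - w| ≤ ρ → μ * (Real.sqrt (2 * G s) * D s) ≤ |deriv G s| := by
    intro s hs
    have h1 : (μ * (Real.sqrt (2 * G s) * D s)) ^ 2 ≤ deriv G s ^ 2 := by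
      have h2 : (μ * (Real.sqrt (2 * G s) * D s)) ^ 2 = (μ * D s) ^ 2 * (2 * G s) := by
        rw [← Real.sq_sqrt (show 0 ≤ 2 * G s by linarith [hG0 s hs])]
        simp only [Real.sqrt_sq (Real.sqrt_nonneg _)]
        ring
      rw [h2]
      nlinarith [hGsq s hs, hG0 s hs, (hb s hs).1.1]
    exact (le_abs_self _).trans (sq_le_sq.1 h1)
  have hΨ' : ∀ s, |s - w| ≤ ρ → 0 ≤ Real.sqrt (2 * G s) * D s := fun s hs =>
    mul_nonneg (Real.sqrt_nonneg _) (hD s (hb s hs).2).le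
  have hside : ∀ σ : ℝ, |σ| ≤ 1 → ∀ s, |s - w| ≤ ρ → 0 ≤ G s - σ * (μ * (Ψ s - Ψ w)) := by
    intro σ hσ s hs
    have hσ' := abs_le.1 hσ
    refine nonneg_of_hasDerivAt_sign (f := fun t => G t - σ * (μ * (Ψ t - Ψ w)))
      (f' := fun t => deriv G t - σ * (μ * (Real.sqrt (2 * G t) * D t))) (w := w) (ρ := ρ)
      (by simp [hGw])
      (fun t ht => (hG1 t (hb t ht).2).sub
        ((((hΨ t (hb t ht).2).sub_const (Ψ w)).const_mul μ).const_mul σ))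
      (fun t ht h => ?_) (fun t ht h => ?_) hs
    · have h1 := hG'pos t ht h
      have h2 : 0 ≤ q * (t - w) := mul_nonneg hq0.le (by linarith)
      have h3 := hslope t ht
      rw [abs_of_nonneg (by linarith)] at h3
      have h4 := mul_nonneg hμ.le (hΨ' t ht)
      nlinarith
    · have h1 := hG'neg t ht h
      have h2 : q * (t - w) ≤ 0 := mul_nonpos_of_nonneg_of_nonpos hq0.le (by linarith)
      have h3 := hslope t ht
      rw [abs_of_nonpos (by linarith)] at h3
      have h4 := mul_nonneg hμ.le (hΨ' t ht)
      nlinarith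
  have hΨpos : ∀ s, |s - w| ≤ ρ → s ≠ w → 0 < Real.sqrt (2 * G s) * D s := by
    intro s hs hsw
    have : 0 < (s - w) ^ 2 := by
      have := sub_ne_zero.2 hsw
      positivity
    have : 0 < G s := lt_of_lt_of_le (by positivity) (hGquad s hs)
    have := hD s (hb s hs).2
    positivity
  have hmono : ∀ p q, p < q → (∀ t ∈ Icc p q, |t - w| ≤ ρ) → (∀ t ∈ Ioo p q, t ≠ w) →
      Ψ p < Ψ q := by
    intro p q hpq hnear hne
    refine strictMonoOn_of_hasDerivWithinAt_pos (convex_Icc p q)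
      (f' := fun t => Real.sqrt (2 * G t) * D t)
      (fun t ht => (hΨ t (hb t (hnear t ht)).2).continuousAt.continuousWithinAt)
      (fun t ht => (hΨ t (hb t (hnear t (interior_subset ht))).2).hasDerivWithinAt)
      (fun t ht => ?_) (left_mem_Icc.2 hpq.le) (right_mem_Icc.2 hpq.le) hpq
    rw [interior_Icc] at ht
    exact hΨpos t (hnear t (Ioo_subset_Icc_self ht)) (hne t ht)
  have hright : Ψ w < Ψ (w + ρ) := hmono w (w + ρ) (by linarith)
    (fun t ht => abs_le.2 ⟨by linarith [ht.1], by linarith [ht.2]⟩) (fun t ht => ht.1.ne')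
  have hleft : Ψ (w - ρ) < Ψ w := hmono (w - ρ) w (by linarith)
    (fun t ht => abs_le.2 ⟨by linarith [ht.1], by linarith [ht.2]⟩) (fun t ht => ht.2.ne)
  have ev3 : ∀ᶠ s in nhds w, |Ψ s - Ψ w| <
      min 1 (min ((Ψ (w + ρ) - Ψ w) / 2) ((Ψ w - Ψ (w - ρ)) / 2)) := by
    have hc : ContinuousAt (fun s => |Ψ s - Ψ w|) w :=
      ((hΨ w hw).continuousAt.sub continuousAt_const).abs
    refine hc.eventually_lt continuousAt_const ?_
    simp only [sub_self, abs_zero]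
    refine lt_min one_pos (lt_min ?_ ?_) <;> linarith
  obtain ⟨η, hη, hηball⟩ := Metric.nhds_basis_closedBall.eventually_iff.1 ev3
  refine ⟨ρ, min η (ρ / 2), lt_min hη (by linarith),
    (min_le_right _ _).trans_lt (by linarith), fun s hs => ?_, fun s hs => ?_⟩
  · have h1 := hside 1 (by simp) s hs
    have h2 := hside (-1) (by simp) s hs
    rcases abs_cases (Ψ s - Ψ w) with h | h <;> rw [h.1] <;> linarith
  · have h1 := hηball (show s ∈ Metric.closedBall w η by
      rw [Metric.mem_closedBall, Real.dist_eq]; exact hs.trans (min_le_left _ _))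
    simp only [lt_min_iff] at h1
    refine ⟨h1.1.le, fun t ht => ?_⟩
    rcases (abs_eq hρ.le).1 ht with h | h
    · rw [show t = w + ρ by linarith, abs_of_pos (show 0 < Ψ (w + ρ) - Ψ w by linarith)]
      linarith [h1.2.1]
    · rw [show t = w - ρ by linarith, abs_of_neg (show Ψ (w - ρ) - Ψ w < 0 by linarith)]
      linarith [h1.2.2]

theorem FiniteEnergyOn.mono {I : Set ℝ} {D G : ℝ → ℝ} {ε : ℝ} {u u' : ℝ → ℝ} {p q p' q' : ℝ}
    (hu : FiniteEnergyOn I D G ε u u' p q) (hp : p ≤ p') (hq : q' ≤ q) :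
    FiniteEnergyOn I D G ε u u' p' q' :=
  ⟨fun x hx => hu.1 x (Icc_subset_Icc hp hq hx), fun x hx => hu.2 x (Icc_subset_Icc hp hq hx),
    hu.3.mono_set (Icc_subset_Icc hp hq)⟩

theorem FiniteEnergyOn.continuousOn {I : Set ℝ} {D G : ℝ → ℝ} {ε : ℝ} {u u' : ℝ → ℝ} {p q : ℝ}
    (hu : FiniteEnergyOn I D G ε u u' p q) : ContinuousOn u (Icc p q) :=
  fun x hx => (hu.hasDerivAt x hx).continuousAt.continuousWithinAt

theorem FiniteEnergyOn.intervalIntegrable {I : Set ℝ} {D G : ℝ → ℝ} {ε : ℝ} {u u' : ℝ → ℝ}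
    {p q : ℝ} (hu : FiniteEnergyOn I D G ε u u' p q) (hpq : p ≤ q) :
    IntervalIntegrable (glDensity D G ε u u') volume p q :=
  (intervalIntegrable_iff_integrableOn_Icc_of_le hpq).2 hu.integrableOn

theorem FiniteEnergyOn.glDensity_nonneg {I : Set ℝ} {D G : ℝ → ℝ} {ε : ℝ} {u u' : ℝ → ℝ}
    {p q : ℝ} (hu : FiniteEnergyOn I D G ε u u' p q) (hG : ∀ s ∈ I, 0 ≤ G s) (hε : 0 < ε) :
    ∀ x ∈ Icc p q, 0 ≤ glDensity D G ε u u' x := fun x hx => by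
  have := hG _ (hu.mem x hx)
  unfold glDensity
  positivity

theorem FiniteEnergyOn.integral_mono {I : Set ℝ} {D G : ℝ → ℝ} {ε : ℝ} {u u' : ℝ → ℝ}
    {p q p' q' : ℝ} (hu : FiniteEnergyOn I D G ε u u' p q) (hG : ∀ s ∈ I, 0 ≤ G s) (hε : 0 < ε)
    (hp : p ≤ p') (hpq : p' ≤ q') (hq : q' ≤ q) :
    ∫ x in p'..q', glDensity D G ε u u' x ≤ ∫ x in p..q, glDensity D G ε u u' x :=
  intervalIntegral.integral_mono_interval hp hpq hq
    ((ae_restrict_iff' measurableSet_Ioc).2 (Filter.Eventually.of_forall fun x hx =>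
      hu.glDensity_nonneg hG hε x (Ioc_subset_Icc_self hx)))
    (hu.intervalIntegrable (hp.trans (hpq.trans hq)))

/-- Calibration inequality with the time-dependent multiplier `c`. -/
theorem FiniteEnergyOn.calibration {I : Set ℝ} {D G Ψ : ℝ → ℝ} {ε : ℝ} {u u' : ℝ → ℝ} {p q : ℝ}
    (hu : FiniteEnergyOn I D G ε u u' p q) (hpq : p ≤ q) (hε : 0 < ε)
    (hG : ∀ s ∈ I, 0 ≤ G s) (hΨ : ∀ s ∈ I, HasDerivAt Ψ (Real.sqrt (2 * G s) * D s) s)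
    {c c' : ℝ → ℝ} (k : ℝ) (hc : ∀ x, HasDerivAt c (c' x) x)
    (hcG : ∀ x ∈ Icc p q, c' x * (Ψ (u x) - k) ≤ (1 - c x ^ 2) * (G (u x) / ε)) :
    c q * (Ψ (u q) - k) - c p * (Ψ (u p) - k) ≤ ∫ x in p..q, glDensity D G ε u u' x := by
  have hder : ∀ x ∈ Icc p q, HasDerivAt (fun x => c x * (Ψ (u x) - k))
      (c' x * (Ψ (u x) - k) + c x * (Real.sqrt (2 * G (u x)) * D (u x) * u' x)) x := fun x hx =>
    (hc x).mul (((hΨ _ (hu.mem x hx)).comp x (hu.hasDerivAt x hx)).sub_const k)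
  refine intervalIntegral.sub_le_integral_of_hasDeriv_right_of_le hpq
    (fun x hx => (hder x hx).continuousAt.continuousWithinAt)
    (fun x hx => (hder x (Ioo_subset_Icc_self hx)).hasDerivWithinAt) hu.integrableOn
    (fun x hx => ?_)
  have hx' := Ioo_subset_Icc_self hx
  have h1 := hcG x hx'
  have hS := Real.sq_sqrt (show 0 ≤ 2 * G (u x) by linarith [hG _ (hu.mem x hx')])
  set S := Real.sqrt (2 * G (u x))
  have hGS : G (u x) = S ^ 2 / 2 := by linarith
  unfold glDensity
  have h2 : 0 ≤ (ε * (D (u x) * u' x) - c x * S) ^ 2 / (2 * ε) := by positivity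
  have h3 : (ε * (D (u x) * u' x) - c x * S) ^ 2 / (2 * ε) =
      ε / 2 * (D (u x) * u' x) ^ 2 - c x * (S * D (u x) * u' x) + c x ^ 2 * (G (u x) / ε) := by
    rw [hGS]
    field_simp
    ring
  linarith

theorem FiniteEnergyOn.abs_sub_le_integral {I : Set ℝ} {D G Ψ : ℝ → ℝ} {ε : ℝ} {u u' : ℝ → ℝ}
    {p q : ℝ} (hu : FiniteEnergyOn I D G ε u u' p q) (hε : 0 < ε)
    (hG : ∀ s ∈ I, 0 ≤ G s) (hΨ : ∀ s ∈ I, HasDerivAt Ψ (Real.sqrt (2 * G s) * D s) s)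
    {x y : ℝ} (hx : x ∈ Icc p q) (hy : y ∈ Icc p q) :
    |Ψ (u y) - Ψ (u x)| ≤ ∫ x in p..q, glDensity D G ε u u' x := by
  wlog hxy : x ≤ y generalizing x y
  · rw [abs_sub_comm]
    exact this hy hx (le_of_not_ge hxy)
  refine le_trans ?_ (hu.integral_mono hG hε hx.1 hxy hy.2)
  have hu' := hu.mono hx.1 hy.2
  have h1 := hu'.calibration hxy hε hG hΨ 0 (fun x => hasDerivAt_const x (1 : ℝ)) (by simp)
  have h2 := hu'.calibration hxy hε hG hΨ 0 (fun x => hasDerivAt_const x (-1 : ℝ)) (by simp)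
  exact abs_le.2 ⟨by linarith, by linarith⟩

/-- If `u` is near the well `w` at one end of `[p, q]`, its energy on `[p, q]` is at least the cost
of reaching `w`, up to an exponentially small error. -/
theorem FiniteEnergyOn.tail_le_integral {I : Set ℝ} {D G Ψ : ℝ → ℝ} {ε : ℝ} {u u' : ℝ → ℝ}
    {p q : ℝ} (hu : FiniteEnergyOn I D G ε u u' p q) (hpq : p ≤ q) (hε : 0 < ε)
    (hG : ∀ s ∈ I, 0 ≤ G s) (hΨ : ∀ s ∈ I, HasDerivAt Ψ (Real.sqrt (2 * G s) * D s) s)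
    {w μ ρ η : ℝ} (hμ : 0 < μ) (hW : IsWellNbhd G Ψ w μ ρ η) {x z : ℝ}
    (hxz : x = p ∧ z = q ∨ x = q ∧ z = p) (hx : |u x - w| ≤ η) :
    |Ψ (u x) - Ψ w| - 2 * Real.exp (-(2 * (μ * (q - p) / ε))) ≤
      ∫ x in p..q, glDensity D G ε u u' x := by
  obtain ⟨-, hηρ, hWG, hWη⟩ := hW
  obtain ⟨hone, hfar⟩ := hWη _ hx
  have hxmem : x ∈ Icc p q := by
    rcases hxz with h | h <;> rw [h.1] <;> simp [hpq]
  have hexp := Real.exp_pos (-(2 * (μ * (q - p) / ε)))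
  by_cases hexit : ∃ y ∈ Icc p q, |u y - w| = ρ
  · obtain ⟨y, hy, hyρ⟩ := hexit
    have h1 := hu.abs_sub_le_integral hε hG hΨ hxmem hy
    have h2 := hfar _ hyρ
    have h3 := abs_sub_le (Ψ (u y)) (Ψ (u x)) (Ψ w)
    linarith
  · have hnear : ∀ y ∈ Icc p q, |u y - w| ≤ ρ := by
      intro y hy
      by_contra! hlt
      have hcont : ContinuousOn (fun y => |u y - w|) (Icc p q) :=
        (hu.continuousOn.sub continuousOn_const).abs
      obtain ⟨t, ht, htρ⟩ := isPreconnected_Icc.intermediate_value hxmem hy hcont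
        ⟨hx.trans hηρ.le, hlt.le⟩
      exact hexit ⟨t, ht, htρ⟩
    obtain ⟨σ, hσ, hστ⟩ : ∃ σ : ℝ, |σ| = 1 ∧ σ * (Ψ (u x) - Ψ w) = |Ψ (u x) - Ψ w| := by
      rcases abs_cases (Ψ (u x) - Ψ w) with h | h
      · exact ⟨1, by simp, by rw [h.1, one_mul]⟩
      · exact ⟨-1, by simp, by rw [h.1]; ring⟩
    have hσ2 : σ ^ 2 = 1 := by rw [← sq_abs, hσ, one_pow]
    have hc : ∀ y, HasDerivAt (fun y => σ * Real.tanh (μ * (y - z) / ε))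
        (σ * ((1 - Real.tanh (μ * (y - z) / ε) ^ 2) * (μ / ε))) y := fun y => by
      have h1 : HasDerivAt (fun y => μ * (y - z) / ε) (μ / ε) y := by
        simpa using (((hasDerivAt_id y).sub_const z).const_mul μ).div_const ε
      exact ((hasDerivAt_tanh _).comp y h1).const_mul σ
    have key := hu.calibration hpq hε hG hΨ (Ψ w) hc (fun y hy => by
      have h1 := hWG _ (hnear y hy)
      have h2 : σ * (Ψ (u y) - Ψ w) ≤ |Ψ (u y) - Ψ w| := by
        refine (le_abs_self _).trans ?_
        rw [abs_mul, hσ, one_mul]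
      have h3 : 0 ≤ 1 - Real.tanh (μ * (y - z) / ε) ^ 2 := by
        have := Real.tanh_sq_lt_one (μ * (y - z) / ε)
        linarith
      rw [mul_pow, hσ2, one_mul]
      have h4 : μ * (σ * (Ψ (u y) - Ψ w)) / ε ≤ G (u y) / ε := by
        gcongr
        exact (mul_le_mul_of_nonneg_left h2 hμ.le).trans h1
      calc _ = (1 - Real.tanh (μ * (y - z) / ε) ^ 2) * (μ * (σ * (Ψ (u y) - Ψ w)) / ε) := by ring
        _ ≤ _ := mul_le_mul_of_nonneg_left h4 h3)
    have htanh := one_sub_two_mul_exp_le_tanh (μ * (q - p) / ε)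
    have hend : Real.tanh (μ * (q - p) / ε) * |Ψ (u x) - Ψ w| ≤
        ∫ x in p..q, glDensity D G ε u u' x := by
      refine le_of_eq_of_le ?_ key
      rw [← hστ]
      rcases hxz with ⟨rfl, rfl⟩ | ⟨rfl, rfl⟩
      · rw [show μ * (x - z) / ε = -(μ * (z - x) / ε) by ring, Real.tanh_neg]
        simp only [sub_self, mul_zero, zero_div, Real.tanh_zero]
        ring
      · simp only [sub_self, mul_zero, zero_div, Real.tanh_zero]
        ring
    have := abs_nonneg (Ψ (u x) - Ψ w)
    nlinarith

/-- The energy of a path passing near the well `w₁` and then near the well `w₂` is at least the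
transition cost, up to an exponentially small error. -/
theorem FiniteEnergyOn.transition_le_integral {I : Set ℝ} {D G Ψ : ℝ → ℝ} {ε : ℝ}
    {u u' : ℝ → ℝ} {p q : ℝ} (hu : FiniteEnergyOn I D G ε u u' p q) (hε : 0 < ε)
    (hG : ∀ s ∈ I, 0 ≤ G s) (hΨ : ∀ s ∈ I, HasDerivAt Ψ (Real.sqrt (2 * G s) * D s) s)
    {w₁ w₂ μ ρ₁ η₁ ρ₂ η₂ A : ℝ} (hμ : 0 < μ) (hW₁ : IsWellNbhd G Ψ w₁ μ ρ₁ η₁)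
    (hW₂ : IsWellNbhd G Ψ w₂ μ ρ₂ η₂) {x y : ℝ} (hpx : p ≤ x) (hxy : x ≤ y) (hyq : y ≤ q)
    (hx : |u x - w₁| ≤ η₁) (hy : |u y - w₂| ≤ η₂) (hAx : A ≤ 2 * (μ * (x - p)))
    (hAy : A ≤ 2 * (μ * (q - y))) :
    |Ψ w₂ - Ψ w₁| - 4 * Real.exp (-A / ε) ≤ ∫ x in p..q, glDensity D G ε u u' x := by
  have hu₁ := hu.mono le_rfl (hxy.trans hyq)
  have hu₂ := hu.mono hpx hyq
  have hu₃ := hu.mono (hpx.trans hxy) le_rfl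
  have h1 := hu₁.tail_le_integral hpx hε hG hΨ hμ hW₁ (Or.inr ⟨rfl, rfl⟩) hx
  have h2 := hu₂.abs_sub_le_integral hε hG hΨ (left_mem_Icc.2 hxy) (right_mem_Icc.2 hxy)
  have h3 := hu₃.tail_le_integral hyq hε hG hΨ hμ hW₂ (Or.inl ⟨rfl, rfl⟩) hy
  have hexp : ∀ l, A ≤ 2 * (μ * l) → Real.exp (-(2 * (μ * l / ε))) ≤ Real.exp (-A / ε) := by
    intro l hl
    rw [Real.exp_le_exp, show -(2 * (μ * l / ε)) = -(2 * (μ * l)) / ε by ring]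
    gcongr
  have h4 := hexp _ hAx
  have h5 := hexp _ hAy
  have hsplit : ∫ t in p..q, glDensity D G ε u u' t =
      (∫ t in p..x, glDensity D G ε u u' t) + (∫ t in x..y, glDensity D G ε u u' t) +
        ∫ t in y..q, glDensity D G ε u u' t := by
    rw [intervalIntegral.integral_add_adjacent_intervals (hu₁.intervalIntegrable hpx)
      (hu₂.intervalIntegrable hxy), intervalIntegral.integral_add_adjacent_intervals
      ((hu₁.intervalIntegrable hpx).trans (hu₂.intervalIntegrable hxy))
      (hu₃.intervalIntegrable hyq)]
  have h6 := abs_sub_le (Ψ w₂) (Ψ (u y)) (Ψ w₁)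
  have h7 := abs_sub_le (Ψ (u y)) (Ψ (u x)) (Ψ w₁)
  rw [abs_sub_comm (Ψ w₂) (Ψ (u y))] at h6
  rw [hsplit]
  linarith

/-- A bounded function which is locally constant off a finite set is integrable. -/
theorem intervalIntegrable_of_piecewise_const {a b : ℝ} (hab : a ≤ b) {F : Set ℝ} (hF : F.Finite)
    {v : ℝ → ℝ} {α β : ℝ} (hval : ∀ x ∈ Icc a b, v x = α ∨ v x = β)
    (hconst : ∀ x ∈ Icc a b, ∀ y ∈ Icc a b, x ≤ y → (∀ z ∈ F, ¬(x ≤ z ∧ z ≤ y)) → v x = v y) :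
    IntervalIntegrable v volume a b := by
  have hUo : IsOpen (Ioo a b \ F) := isOpen_Ioo.sdiff hF.isClosed
  have hcont : ContinuousOn v (Ioo a b \ F) := by
    intro x hx
    obtain ⟨e, he, hball⟩ := Metric.isOpen_iff.1 hUo x hx
    have hev : v =ᶠ[nhds x] fun _ => v x := by
      filter_upwards [Metric.ball_mem_nhds x he] with y hy
      have hconn : OrdConnected (Metric.ball x e) := by
        rw [Real.ball_eq_Ioo]; exact ordConnected_Ioo
      have hxb := Metric.mem_ball_self (x := x) he
      have hIcc : ∀ z ∈ Metric.ball x e, z ∈ Icc a b := fun z hz =>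
        Ioo_subset_Icc_self (hball hz).1
      rcases le_total x y with hxy | hxy
      · exact (hconst x (hIcc x hxb) y (hIcc y hy) hxy
          fun z hz h => (hball (hconn.out hxb hy h)).2 hz).symm
      · exact hconst y (hIcc y hy) x (hIcc x hxb) hxy
          fun z hz h => (hball (hconn.out hy hxb h)).2 hz
    exact (continuousAt_const.congr hev.symm).continuousWithinAt
  have hset : (Ioo a b \ F : Set ℝ) =ᵐ[volume] Icc a b :=
    (sdiff_null_ae_eq_self (hF.measure_zero volume)).trans Ioo_ae_eq_Icc
  rw [intervalIntegrable_iff_integrableOn_Icc_of_le hab]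
  have hmeas : AEStronglyMeasurable v (volume.restrict (Icc a b)) := by
    rw [← Measure.restrict_congr_set hset]
    exact hcont.aestronglyMeasurable hUo.measurableSet
  refine Integrable.of_bound hmeas (|α| + |β|) ?_
  refine (ae_restrict_iff' measurableSet_Icc).2 (Filter.Eventually.of_forall fun x hx => ?_)
  rw [Real.norm_eq_abs]
  rcases hval x hx with h | h <;> rw [h] <;> linarith [abs_nonneg α, abs_nonneg β]

theorem exists_abs_sub_le_of_integral_lt {a b p q η w : ℝ} {u v : ℝ → ℝ}
    (hint : IntervalIntegrable (fun x => |u x - v x|) volume a b) (hap : a ≤ p) (hpq : p ≤ q)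
    (hqb : q ≤ b) (hv : ∀ x ∈ Ioo p q, v x = w)
    (hlt : ∫ x in a..b, |u x - v x| < η * (q - p)) : ∃ x ∈ Ioo p q, |u x - w| ≤ η := by
  by_contra! hne
  have h1 : ∫ x in p..q, |u x - v x| ≤ ∫ x in a..b, |u x - v x| :=
    intervalIntegral.integral_mono_interval hap hpq hqb
      (Filter.Eventually.of_forall fun x => abs_nonneg _) hint
  have h2 : ∫ _ in p..q, η ≤ ∫ x in p..q, |u x - v x| :=
    intervalIntegral.integral_mono_on_of_le_Ioo hpq intervalIntegrable_const
      (hint.mono_set (by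
        rw [uIcc_of_le hpq, uIcc_of_le (hap.trans (hpq.trans hqb))]
        exact Icc_subset_Icc hap hqb))
      (fun x hx => by rw [hv x hx]; exact (hne x hx).le)
  rw [intervalIntegral.integral_const, smul_eq_mul] at h2
  linarith

theorem sum_integral_le_integral {ι : Type*} [Fintype ι] {f : ℝ → ℝ} {a b : ℝ} (hab : a ≤ b)
    (hf : IntervalIntegrable f volume a b) (hf0 : ∀ x ∈ Icc a b, 0 ≤ f x) {p q : ι → ℝ}
    (hap : ∀ i, a ≤ p i) (hpq : ∀ i, p i ≤ q i) (hqb : ∀ i, q i ≤ b)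
    (hdisj : Pairwise (Function.onFun Disjoint fun i => Ioc (p i) (q i))) :
    ∑ i, ∫ x in p i..q i, f x ≤ ∫ x in a..b, f x := by
  have hsub : ∀ i, Ioc (p i) (q i) ⊆ Ioc a b := fun i => Ioc_subset_Ioc (hap i) (hqb i)
  simp only [intervalIntegral.integral_of_le hab, intervalIntegral.integral_of_le (hpq _)]
  rw [← integral_iUnion_fintype (fun i => measurableSet_Ioc) hdisj
    (fun i => hf.1.mono_set (hsub i))]
  exact setIntegral_mono_set hf.1
    ((ae_restrict_iff' measurableSet_Ioc).2 (Filter.Eventually.of_forall fun x hx =>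
      hf0 x (Ioc_subset_Icc_self hx))) (iUnion_subset hsub).eventuallyLE



/-- Sharp lower bound for the generalized Ginzburg-Landau energy near an
`N`-transition layer configuration: `E_ε[u] ≥ N γ₀ - C exp(-A/ε)`. -/
theorem stmt7
    (I : Set ℝ) (hIopen : IsOpen I) (hIconn : I.OrdConnected)
    (D G : ℝ → ℝ) (d α β : ℝ) (hαβ : α < β) (hsub : Set.Icc α β ⊆ I)
    (hD : ContDiffOn ℝ 1 D I) (hd : 0 < d) (hDd : ∀ s ∈ I, d ≤ D s)
    (hGreg : ContDiffOn ℝ 3 G I)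
    (hGα : G α = 0) (hGβ : G β = 0)
    (hG'α : deriv G α = 0) (hG'β : deriv G β = 0)
    (hG''α : 0 < deriv (deriv G) α) (hG''β : 0 < deriv (deriv G) β)
    (hGpos : ∀ s ∈ I, s ≠ α → s ≠ β → 0 < G s)
    (lam γ₀ : ℝ)
    (hlam : lam = min (deriv (deriv G) α / (D α) ^ 2) (deriv (deriv G) β / (D β) ^ 2))
    (hγ₀ : γ₀ = ∫ s in α..β, Real.sqrt (2 * G s) * D s)
    (a b r : ℝ) (hab : a < b) (hr : 0 < r)
    (N : ℕ) (h : Fin N → ℝ) (hmono : StrictMono h)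
    (hsep : ∀ i j : Fin N, i < j → h i + r < h j - r)
    (hha : ∀ i, a ≤ h i - r) (hhb : ∀ i, h i + r ≤ b)
    (v : ℝ → ℝ)
    (hvval : ∀ x ∈ Set.Icc a b, v x = α ∨ v x = β)
    (hvconst : ∀ x ∈ Set.Icc a b, ∀ y ∈ Set.Icc a b, x ≤ y →
      (∀ i, ¬(x ≤ h i ∧ h i ≤ y)) → v x = v y)
    (hvjump : ∀ i, v (h i - r) ≠ v (h i + r))
    (A : ℝ) (hA : 0 < A) (hAr : A < r * Real.sqrt (2 * lam))
    (M₁ M₂ : ℝ) (hM : M₁ ≤ M₂) (hMsub : Set.Icc M₁ M₂ ⊆ I) :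
    ∃ ε₀ > (0:ℝ), ∃ C > (0:ℝ), ∃ δ > (0:ℝ), ∀ u u' : ℝ → ℝ,
      (∀ x ∈ Set.Icc a b, HasDerivAt u (u' x) x) →
      IntervalIntegrable (fun x => (u' x) ^ 2) volume a b →
      (∀ x ∈ Set.Icc a b, u x ∈ Set.Icc M₁ M₂) →
      (∫ x in a..b, |u x - v x|) ≤ δ →
      ∀ ε ∈ Set.Ioo (0:ℝ) ε₀,
        (N : ℝ) * γ₀ - C * Real.exp (-A / ε) ≤
          ∫ x in a..b, (ε / 2 * (D (u x) * u' x) ^ 2 + G (u x) / ε) := by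
  have hαI : α ∈ I := hsub (left_mem_Icc.2 hαβ.le)
  have hβI : β ∈ I := hsub (right_mem_Icc.2 hαβ.le)
  have hDpos : ∀ s ∈ I, 0 < D s := fun s hs => hd.trans_le (hDd s hs)
  have hG0 : ∀ s ∈ I, 0 ≤ G s := by
    intro s hs
    by_cases h1 : s = α
    · rw [h1, hGα]
    by_cases h2 : s = β
    · rw [h2, hGβ]
    exact (hGpos s hs h1 h2).le
  have hG1reg : ContDiffOn ℝ 2 (deriv G) I := hGreg.deriv_of_isOpen hIopen (by norm_num)
  have hG2reg : ContDiffOn ℝ 1 (deriv (deriv G)) I := hG1reg.deriv_of_isOpen hIopen (by norm_num)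
  have hG1 : ∀ s ∈ I, HasDerivAt G (deriv G s) s := fun s hs =>
    ((hGreg.contDiffAt (hIopen.mem_nhds hs)).differentiableAt (by norm_num)).hasDerivAt
  have hG2 : ∀ s ∈ I, HasDerivAt (deriv G) (deriv (deriv G) s) s := fun s hs =>
    ((hG1reg.contDiffAt (hIopen.mem_nhds hs)).differentiableAt (by norm_num)).hasDerivAt
  have hfc : ContinuousOn (fun s => Real.sqrt (2 * G s) * D s) I :=
    (continuousOn_const.mul hGreg.continuousOn).sqrt.mul hD.continuousOn
  obtain ⟨Ψ, hΨdef⟩ : ∃ Ψ : ℝ → ℝ, Ψ = fun s => ∫ t in α..s, Real.sqrt (2 * G t) * D t := ⟨_, rfl⟩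
  have hΨ : ∀ s ∈ I, HasDerivAt Ψ (Real.sqrt (2 * G s) * D s) s := by
    intro s hs
    rw [hΨdef]
    exact intervalIntegral.integral_hasDerivAt_right
      ((hfc.mono (hIconn.uIcc_subset hαI hs)).intervalIntegrable)
      (hfc.stronglyMeasurableAtFilter hIopen s hs) (hfc.continuousAt (hIopen.mem_nhds hs))
  have hΨα : Ψ α = 0 := by simp [hΨdef]
  have hΨβ : Ψ β = γ₀ := by rw [hγ₀, hΨdef]
  have hlam0 : 0 < lam := by
    have := hDpos α hαI
    have := hDpos β hβI
    rw [hlam]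
    exact lt_min (by positivity) (by positivity)
  obtain ⟨μ, hμdef⟩ : ∃ μ, μ = 3 / 5 * Real.sqrt (2 * lam) := ⟨_, rfl⟩
  have hμ : 0 < μ := by rw [hμdef]; positivity
  have hμ2 : μ ^ 2 = 18 / 25 * lam := by
    rw [hμdef, mul_pow, Real.sq_sqrt (by positivity)]; ring
  have hμw : ∀ w ∈ I, lam ≤ deriv (deriv G) w / D w ^ 2 → (μ * D w) ^ 2 < deriv (deriv G) w := by
    intro w hw hle
    have hDw := hDpos w hw
    rw [le_div_iff₀ (by positivity)] at hle
    rw [mul_pow, hμ2]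
    nlinarith [mul_pos hlam0 (pow_pos hDw 2)]
  obtain ⟨ρ₁, η₁, hWα⟩ := exists_isWellNbhd hIopen hαI hDpos hD.continuousOn hG1 hG2
    hG2reg.continuousOn hGα hG'α hμ (hμw α hαI (hlam.trans_le (min_le_left _ _))) hΨ
  obtain ⟨ρ₂, η₂, hWβ⟩ := exists_isWellNbhd hIopen hβI hDpos hD.continuousOn hG1 hG2
    hG2reg.continuousOn hGβ hG'β hμ (hμw β hβI (hlam.trans_le (min_le_right _ _))) hΨ
  have hη : 0 < min η₁ η₂ := lt_min hWα.1 hWβ.1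
  have hvint : IntervalIntegrable v volume a b :=
    intervalIntegrable_of_piecewise_const hab.le (Set.finite_range h) hvval
      (fun x hx y hy hxy hF => hvconst x hx y hy hxy fun i => hF _ (mem_range_self i))
  have hwell : ∀ w, w = α ∨ w = β → ∃ ρ η, min η₁ η₂ ≤ η ∧ IsWellNbhd G Ψ w μ ρ η := by
    rintro w (rfl | rfl)
    · exact ⟨ρ₁, η₁, min_le_left _ _, hWα⟩
    · exact ⟨ρ₂, η₂, min_le_right _ _, hWβ⟩
  have hAμ : A ≤ 2 * (μ * (9 / 10 * r)) := by
    rw [hμdef]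
    nlinarith [mul_pos hr (Real.sqrt_pos.2 (show 0 < 2 * lam by positivity))]
  refine ⟨1, one_pos, 4 * N + 1, by positivity, min η₁ η₂ * (r / 20), by positivity,
    fun u u' hu hu'2 huM hL1 ε hε => ?_⟩
  have hε0 : 0 < ε := hε.1
  have hucont : ContinuousOn u (Icc a b) := fun x hx => (hu x hx).continuousAt.continuousWithinAt
  have huI : MapsTo u (Icc a b) I := fun x hx => hMsub (huM x hx)
  have hfin : FiniteEnergyOn I D G ε u u' a b := by
    refine ⟨hu, huI, ?_⟩
    rw [← intervalIntegrable_iff_integrableOn_Icc_of_le hab.le]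
    have hDu : ContinuousOn (fun x => ε / 2 * D (u x) ^ 2) (uIcc a b) := by
      rw [uIcc_of_le hab.le]
      exact continuousOn_const.mul ((hD.continuousOn.comp hucont huI).pow 2)
    have hGu : ContinuousOn (fun x => G (u x) / ε) (uIcc a b) := by
      rw [uIcc_of_le hab.le]
      exact (hGreg.continuousOn.comp hucont huI).div_const ε
    refine ((hu'2.continuousOn_mul hDu).add hGu.intervalIntegrable).congr fun x _ => ?_
    simp only [glDensity]
    ring
  have hL1int : IntervalIntegrable (fun x => |u x - v x|) volume a b := by
    have hui : IntervalIntegrable u volume a b := by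
      apply ContinuousOn.intervalIntegrable
      rwa [uIcc_of_le hab.le]
    exact (hui.sub hvint).abs
  have hsmall : ∫ x in a..b, |u x - v x| < min η₁ η₂ * (r / 10) :=
    hL1.trans_lt (by gcongr; norm_num)
  have hjump : ∀ i, γ₀ - 4 * Real.exp (-A / ε) ≤
      ∫ x in (h i - r)..(h i + r), glDensity D G ε u u' x := by
    intro i
    have hha' := hha i
    have hhb' := hhb i
    have hmemL : h i - r ∈ Icc a b := ⟨hha', by linarith⟩
    have hmemR : h i + r ∈ Icc a b := ⟨by linarith, hhb'⟩
    have hL : ∀ x ∈ Ioo (h i - r / 10) (h i), v x = v (h i - r) := by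
      intro x hx
      refine (hvconst _ hmemL x ⟨by linarith [hx.1], by linarith [hx.2]⟩ (by linarith [hx.1])
        fun j hj => ?_).symm
      rcases lt_trichotomy j i with hji | rfl | hji
      · linarith [hsep j i hji, hj.1]
      · linarith [hj.2, hx.2]
      · linarith [hmono hji, hj.2, hx.2]
    have hR : ∀ x ∈ Ioo (h i) (h i + r / 10), v x = v (h i + r) := by
      intro x hx
      refine hvconst x ⟨by linarith [hx.1], by linarith [hx.2]⟩ _ hmemR (by linarith [hx.2])
        fun j hj => ?_
      rcases lt_trichotomy j i with hji | rfl | hji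
      · linarith [hmono hji, hj.1, hx.1]
      · linarith [hj.1, hx.1]
      · linarith [hsep i j hji, hj.2]
    obtain ⟨x, hx, hxw⟩ := exists_abs_sub_le_of_integral_lt hL1int (by linarith) (by linarith)
      (by linarith) hL (hsmall.trans_eq (by ring))
    obtain ⟨y, hy, hyw⟩ := exists_abs_sub_le_of_integral_lt hL1int (by linarith) (by linarith)
      (by linarith) hR (hsmall.trans_eq (by ring))
    obtain ⟨ρ, η, hη', hW⟩ := hwell _ (hvval _ hmemL)
    obtain ⟨ρ', η', hη'', hW'⟩ := hwell _ (hvval _ hmemR)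
    have hlen : ∀ l, 9 / 10 * r ≤ l → A ≤ 2 * (μ * l) := fun l hl => hAμ.trans (by gcongr)
    have key := (hfin.mono hha' hhb').transition_le_integral hε0 hG0 hΨ hμ hW hW'
      (by linarith [hx.1]) (hx.2.trans hy.1).le (by linarith [hy.2]) (hxw.trans hη')
      (hyw.trans hη'') (hlen _ (by linarith [hx.1])) (hlen _ (by linarith [hy.2]))
    have habs : |Ψ (v (h i + r)) - Ψ (v (h i - r))| = |γ₀| := by
      have hne := hvjump i
      rcases hvval _ hmemL with h1 | h1 <;> rcases hvval _ hmemR with h2 | h2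
      · exact absurd (h1.trans h2.symm) hne
      · rw [h1, h2, hΨα, hΨβ, sub_zero]
      · rw [h1, h2, hΨα, hΨβ, zero_sub, abs_neg]
      · exact absurd (h1.trans h2.symm) hne
    rw [habs] at key
    linarith [le_abs_self γ₀]
  have hdisj : Pairwise (Function.onFun Disjoint fun i => Ioc (h i - r) (h i + r)) := by
    intro i j hij
    refine Set.disjoint_left.2 fun x hx hx' => ?_
    rcases lt_or_gt_of_ne hij with hlt | hlt
    · linarith [hsep i j hlt, hx.2, hx'.1]
    · linarith [hsep j i hlt, hx.1, hx'.2]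
  have hsum := sum_integral_le_integral hab.le (hfin.intervalIntegrable hab.le)
    (hfin.glDensity_nonneg hG0 hε0) hha (fun i => by linarith) hhb hdisj
  have hlow : (N : ℝ) * (γ₀ - 4 * Real.exp (-A / ε)) ≤
      ∑ i, ∫ x in (h i - r)..(h i + r), glDensity D G ε u u' x := by
    have := Finset.sum_le_sum fun i (_ : i ∈ Finset.univ) => hjump i
    rwa [Finset.sum_const, Finset.card_univ, Fintype.card_fin, nsmul_eq_mul] at this
  have hexp := Real.exp_pos (-A / ε)
  calc (N : ℝ) * γ₀ - (4 * N + 1) * Real.exp (-A / ε)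
      ≤ N * (γ₀ - 4 * Real.exp (-A / ε)) := by linarith
    _ ≤ ∫ x in a..b, glDensity D G ε u u' x := hlow.trans hsum
end

section
/- Fix $N\in\mathbb{N}$, transition points $a<h_1<\dots<h_N<b$, and $v$ the piecewise constant $\{\alpha,\beta\}$-valued function with jumps at the $h_i$. Under the assumptions $D\geq d>0$ ($C^2$), $f$ bistable ($C^2$) with balance conditions, there exists a family $u^\varepsilon\in H^1(a,b)$ with values in $(\alpha,\beta)$ built by gluing reflected translates of the standing wave $\Phi_\varepsilon$ at the midpoints between consecutive $h_i$, satisfying $\|u^\varepsilon-v\|_{L^1}\to 0$ as $\varepsilon\to 0^+$, $E_\varepsilon[u^\varepsilon]<N\gamma_0$ for all small $\varepsilon$, and $\lim_{\varepsilon\to 0^+}E_\varepsilon[u^\varepsilon]=N\gamma_0$. -/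
open MeasureTheory Set Filter

lemma exists_le_of_inv_le_deriv {T T' : ℝ → ℝ} {α β m C : ℝ} (hm : m ∈ Ioo α β) (hC : 0 < C)
    (hT : ∀ s ∈ Ioo α β, HasDerivAt T (T' s) s)
    (hT' : ∀ s ∈ Ioo α β, (C * (β - s))⁻¹ ≤ T' s) (hTm : T m = 0) (y : ℝ) :
    ∃ s ∈ Ioo α β, y ≤ T s := by
  have hβm : 0 < β - m := sub_pos.2 hm.2
  have hder : ∀ s ∈ Ioo α β,
      HasDerivAt (fun s => T s + C⁻¹ * Real.log (β - s)) (T' s - (C * (β - s))⁻¹) s := by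
    intro s hs
    have hne : β - s ≠ 0 := (sub_pos.2 hs.2).ne'
    refine ((hT s hs).add ((((hasDerivAt_id s).const_sub β).log hne).const_mul C⁻¹)).congr_deriv ?_
    rw [mul_inv, id, neg_div, one_div]
    ring
  have hmono : MonotoneOn (fun s => T s + C⁻¹ * Real.log (β - s)) (Ioo α β) := by
    refine monotoneOn_of_deriv_nonneg (convex_Ioo α β)
      (fun s hs => (hder s hs).continuousAt.continuousWithinAt) ?_ ?_
    · rw [interior_Ioo]
      exact fun s hs => (hder s hs).differentiableAt.differentiableWithinAt
    · rw [interior_Ioo]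
      intro s hs
      rw [(hder s hs).deriv]
      linarith [hT' s hs]
  set E := Real.exp (-(C * |y|)) with hE
  have hE0 : 0 < E := Real.exp_pos _
  have hE1 : E ≤ 1 := Real.exp_le_one_iff.2 (by
    have := mul_nonneg hC.le (abs_nonneg y); linarith)
  have hms : m ≤ β - (β - m) * E := by nlinarith
  have hs : β - (β - m) * E ∈ Ioo α β := ⟨hm.1.trans_le hms, by nlinarith⟩
  refine ⟨_, hs, ?_⟩
  have := hmono hm hs hms
  simp only [hTm, sub_sub_cancel] at this
  rw [Real.log_mul hβm.ne' hE0.ne', hE, Real.log_exp] at this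
  have h2 : C⁻¹ * (Real.log (β - m) + -(C * |y|)) = C⁻¹ * Real.log (β - m) - |y| := by
    field_simp
    ring
  rw [h2] at this
  linarith [le_abs_self y]

lemma exists_standing_wave {g : ℝ → ℝ} {α β C : ℝ} (hαβ : α < β) (hC : 0 < C)
    (hg : ContinuousOn g (Ioo α β)) (hpos : ∀ s ∈ Ioo α β, 0 < g s)
    (hgα : ∀ s ∈ Ioo α β, g s ≤ C * (s - α)) (hgβ : ∀ s ∈ Ioo α β, g s ≤ C * (β - s)) :
    ∃ φ : ℝ → ℝ, (∀ y, φ y ∈ Ioo α β) ∧ (∀ y, HasDerivAt φ (g (φ y)) y) ∧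
      Tendsto φ atTop (nhds β) ∧ Tendsto φ atBot (nhds α) := by
  obtain ⟨m, hm⟩ : (Ioo α β).Nonempty := nonempty_Ioo.2 hαβ
  set T : ℝ → ℝ := fun s => ∫ t in m..s, (g t)⁻¹ with hTdef
  have hgi : ContinuousOn (fun t => (g t)⁻¹) (Ioo α β) := hg.inv₀ fun s hs => (hpos s hs).ne'
  have hT : ∀ s ∈ Ioo α β, HasDerivAt T (g s)⁻¹ s := by
    intro s hs
    refine intervalIntegral.integral_hasDerivAt_right ?_ ?_ ?_
    · exact (hgi.mono (ordConnected_Ioo.uIcc_subset hm hs)).intervalIntegrable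
    · exact hgi.stronglyMeasurableAtFilter isOpen_Ioo s hs
    · exact hgi.continuousAt (isOpen_Ioo.mem_nhds hs)
  have hTm : T m = 0 := intervalIntegral.integral_same
  have hTmono : StrictMonoOn T (Ioo α β) := by
    refine strictMonoOn_of_deriv_pos (convex_Ioo α β)
      (fun s hs => (hT s hs).continuousAt.continuousWithinAt) ?_
    rw [interior_Ioo]
    intro s hs
    rw [(hT s hs).deriv]
    exact inv_pos.2 (hpos s hs)
  have hup : ∀ y, ∃ s ∈ Ioo α β, y ≤ T s :=
    exists_le_of_inv_le_deriv hm hC hT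
      (fun s hs => inv_anti₀ (hpos s hs) (hgβ s hs)) hTm
  have hdown : ∀ y, ∃ s ∈ Ioo α β, T s ≤ y := by
    intro y
    obtain ⟨s, hs, hy⟩ := exists_le_of_inv_le_deriv (T := fun s => -T (-s))
      (T' := fun s => (g (-s))⁻¹) (α := -β) (β := -α) (m := -m) (C := C)
      ⟨neg_lt_neg hm.2, neg_lt_neg hm.1⟩ hC
      (by
        intro s hs
        have hs' : -s ∈ Ioo α β := ⟨by linarith [hs.2], by linarith [hs.1]⟩
        exact ((hT (-s) hs').comp s (hasDerivAt_neg s)).neg.congr_deriv (by simp))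
      (by
        intro s hs
        have hs' : -s ∈ Ioo α β := ⟨by linarith [hs.2], by linarith [hs.1]⟩
        refine inv_anti₀ (hpos _ hs') ((hgα _ hs').trans_eq ?_)
        ring)
      (by simp [hTm]) (-y)
    exact ⟨-s, ⟨by linarith [hs.2], by linarith [hs.1]⟩, by simpa using hy⟩
  have hTc : ContinuousOn T (Ioo α β) := fun s hs => (hT s hs).continuousAt.continuousWithinAt
  have hsurj : Function.Surjective (fun s : Ioo α β => T s) := by
    intro y
    obtain ⟨s₁, hs₁, h₁⟩ := hdown y
    obtain ⟨s₂, hs₂, h₂⟩ := hup y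
    obtain ⟨s, hs, hsy⟩ := isPreconnected_Ioo.intermediate_value hs₁ hs₂ hTc ⟨h₁, h₂⟩
    exact ⟨⟨s, hs⟩, hsy⟩
  let e : Ioo α β ≃o ℝ := StrictMono.orderIsoOfSurjective (fun s : Ioo α β => T s)
    (fun s t hst => hTmono s.2 t.2 hst) hsurj
  have hTe : ∀ y, T (e.symm y) = y := fun y => e.apply_symm_apply y
  have heT : ∀ s (hs : s ∈ Ioo α β), (e.symm (T s) : ℝ) = s := fun s hs =>
    congrArg Subtype.val (e.symm_apply_apply ⟨s, hs⟩)
  have hmonoφ : Monotone fun y => (e.symm y : ℝ) := fun x y hxy => e.symm.monotone hxy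
  refine ⟨fun y => e.symm y, fun y => (e.symm y).2, fun y => ?_, ?_, ?_⟩
  · have := HasDerivAt.of_local_left_inverse (f := T) (g := fun y => (e.symm y : ℝ)) (a := y)
      (continuous_subtype_val.comp e.symm.continuous).continuousAt (hT _ (e.symm y).2)
      (inv_pos.2 (hpos _ (e.symm y).2)).ne' (Eventually.of_forall hTe)
    simpa using this
  · refine tendsto_order.2 ⟨fun c hc => ?_, fun c hc => ?_⟩
    · obtain ⟨s, hs⟩ := exists_between (max_lt hc hαβ)
      have hs' : s ∈ Ioo α β := ⟨(le_max_right _ _).trans_lt hs.1, hs.2⟩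
      filter_upwards [eventually_ge_atTop (T s)] with y hy
      have := hmonoφ hy
      simp only [heT s hs'] at this
      exact ((le_max_left _ _).trans_lt hs.1).trans_le this
    · exact Eventually.of_forall fun y => (e.symm y).2.2.trans hc
  · refine tendsto_order.2 ⟨fun c hc => ?_, fun c hc => ?_⟩
    · exact Eventually.of_forall fun y => hc.trans (e.symm y).2.1
    · obtain ⟨s, hs⟩ := exists_between (lt_min hc hαβ)
      have hs' : s ∈ Ioo α β := ⟨hs.1, hs.2.trans_le (min_le_right _ _)⟩
      filter_upwards [eventually_le_atBot (T s)] with y hy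
      have := hmonoφ hy
      simp only [heT s hs'] at this
      exact this.trans_lt (hs.2.trans_le (min_le_left _ _))

/-- A `1`-Lipschitz zigzag vanishing at the points `H j`, with corners at their midpoints. -/
lemma exists_zigzag (H M : ℕ → ℝ) (hM : Monotone M) (n : ℕ)
    (hMH : ∀ k < n, 2 * M (k + 1) = H k + H (k + 1)) :
    ∃ ρ : ℝ → ℝ, LipschitzWith 1 ρ ∧
      ∀ j ≤ n, ∀ x ∈ Icc (M j) (M (j + 1)), ρ x = (-1) ^ j * (x - H j) := by
  suffices h : ∃ ρ : ℝ → ℝ, LipschitzWith 1 ρ ∧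
      (∀ x, M n ≤ x → ρ x = (-1) ^ n * (x - H n)) ∧
      ∀ j ≤ n, ∀ x ∈ Icc (M j) (M (j + 1)), ρ x = (-1) ^ j * (x - H j) by
    obtain ⟨ρ, h₁, -, h₂⟩ := h
    exact ⟨ρ, h₁, h₂⟩
  induction n with
  | zero =>
    refine ⟨fun x => x - H 0, ?_, fun x _ => by simp, fun j hj x _ => ?_⟩
    · exact LipschitzWith.of_dist_le_mul fun x y => by simp
    · obtain rfl : j = 0 := by omega
      simp
  | succ n ih =>
    obtain ⟨ρ, hL, hlast, hρ⟩ := ih fun k hk => hMH k (by omega)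
    have hm := hMH n (by omega)
    have hglue : ρ (M (n + 1)) = (-1) ^ (n + 1) * (M (n + 1) - H (n + 1)) := by
      rw [hlast _ (hM (Nat.le_succ n)), pow_succ]
      linear_combination (-1) ^ n * hm
    have hright : ∀ x, M (n + 1) ≤ x →
        (if x ≤ M (n + 1) then ρ x else (-1) ^ (n + 1) * (x - H (n + 1)))
          = (-1) ^ (n + 1) * (x - H (n + 1)) := by
      intro x hx
      split_ifs with hx'
      · rw [le_antisymm hx' hx, hglue]
      · rfl
    refine ⟨fun x => if x ≤ M (n + 1) then ρ x else (-1) ^ (n + 1) * (x - H (n + 1)),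
      ?_, hright, ?_⟩
    · have habs : ∀ x y, |ρ x - ρ y| ≤ |x - y| := fun x y => by
        simpa [Real.dist_eq] using hL.dist_le_mul x y
      have hlin : ∀ x y, |(-1) ^ (n + 1) * (x - H (n + 1)) - (-1) ^ (n + 1) * (y - H (n + 1))|
          = |x - y| := by
        intro x y
        rw [← mul_sub, abs_mul, abs_pow]
        simp
      have hmix : ∀ x y, x ≤ M (n + 1) → M (n + 1) ≤ y →
          |ρ x - (-1) ^ (n + 1) * (y - H (n + 1))| ≤ |x - y| := by
        intro x y hx hy
        have h1 := habs x (M (n + 1))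
        have h2 := hlin (M (n + 1)) y
        rw [← hglue] at h2
        have h3 := abs_sub_le (ρ x) (ρ (M (n + 1))) ((-1) ^ (n + 1) * (y - H (n + 1)))
        rw [abs_of_nonpos (by linarith : x - M (n + 1) ≤ 0)] at h1
        rw [abs_of_nonpos (by linarith : M (n + 1) - y ≤ 0)] at h2
        rw [abs_of_nonpos (by linarith : x - y ≤ 0)]
        linarith
      refine LipschitzWith.of_dist_le_mul fun x y => ?_
      simp only [Real.dist_eq, NNReal.coe_one, one_mul]
      split_ifs with hx hy hy
      · exact habs x y
      · exact hmix x y hx (not_le.1 hy).le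
      · rw [abs_sub_comm, abs_sub_comm x]
        exact hmix y x hy (not_le.1 hx).le
      · exact (hlin x y).le
    · intro j hj x hx
      rcases Nat.lt_or_ge n j with hj' | hj'
      · obtain rfl : j = n + 1 := by omega
        exact hright x hx.1
      · simp only [if_pos (hx.2.trans (hM (by omega : j + 1 ≤ n + 1)))]
        exact hρ j hj' x hx

/-- Uniform approximation of a `1`-Lipschitz function by `C¹` functions of slope at most one. -/
lemma exists_contDiff_approx {ρ : ℝ → ℝ} (hρ : LipschitzWith 1 ρ) {δ : ℝ} (hδ : 0 < δ) :
    ∃ r s : ℝ → ℝ, (∀ x, HasDerivAt r (s x) x) ∧ Continuous s ∧ (∀ x, |s x| ≤ 1) ∧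
      ∀ x, |r x - ρ x| ≤ δ := by
  have hc := hρ.continuous
  have habs : ∀ x y, |ρ x - ρ y| ≤ |x - y| := fun x y => by
    simpa [Real.dist_eq] using hρ.dist_le_mul x y
  have hi : ∀ u v, IntervalIntegrable ρ volume u v := fun u v => hc.intervalIntegrable u v
  have hP : ∀ x, HasDerivAt (fun x => ∫ t in (0:ℝ)..x, ρ t) (ρ x) x := fun x =>
    intervalIntegral.integral_hasDerivAt_right (hi 0 x)
      (hc.stronglyMeasurableAtFilter _ _) hc.continuousAt
  refine ⟨fun x => δ⁻¹ * ((∫ t in (0:ℝ)..(x + δ), ρ t) - ∫ t in (0:ℝ)..x, ρ t),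
    fun x => δ⁻¹ * (ρ (x + δ) - ρ x), fun x => ?_, by fun_prop, fun x => ?_, fun x => ?_⟩
  · exact (((hP (x + δ)).comp_add_const x δ).sub (hP x)).const_mul _
  · rw [abs_mul, abs_of_pos (inv_pos.2 hδ), inv_mul_le_iff₀ hδ]
    simpa [abs_of_pos hδ] using habs (x + δ) x
  · beta_reduce
    rw [intervalIntegral.integral_interval_sub_left (hi _ _) (hi _ _)]
    have h1 : δ⁻¹ * (∫ t in x..(x + δ), ρ t) - ρ x = δ⁻¹ * ∫ t in x..(x + δ), (ρ t - ρ x) := by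
      rw [intervalIntegral.integral_sub (hi _ _) (by simp)]
      simp only [intervalIntegral.integral_const, add_sub_cancel_left, smul_eq_mul]
      field_simp
    rw [h1, abs_mul, abs_of_pos (inv_pos.2 hδ), inv_mul_le_iff₀ hδ]
    have := intervalIntegral.norm_integral_le_of_norm_le_const (a := x) (b := x + δ)
      (f := fun t => ρ t - ρ x) (C := δ) (by
        intro t ht
        rw [uIoc_of_le (by linarith)] at ht
        refine (habs t x).trans ?_
        rw [abs_of_nonneg (by linarith [ht.1])]
        linarith [ht.2])
    simpa [abs_of_pos hδ] using this

/-- The glued (unsmoothed) wave has energy strictly below `n + 1` times the wave energy `γ`. -/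
lemma integral_zigzag_lt {Q Θ ρ : ℝ → ℝ} {γ ε : ℝ} {H M : ℕ → ℝ} {n : ℕ} (hQ : Continuous Q)
    (hΘ : ∀ y, HasDerivAt Θ (Q y) y) (hΘmem : ∀ y, Θ y ∈ Ioo 0 γ) (hρ : Continuous ρ)
    (hM : ∀ k, M k ≤ M (k + 1))
    (hρH : ∀ j ≤ n, ∀ x ∈ Icc (M j) (M (j + 1)), ρ x = (-1) ^ j * (x - H j)) :
    ∫ x in M 0..M (n + 1), Q (ρ x / ε) / ε < ((n + 1 : ℕ) : ℝ) * γ := by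
  have hcont : Continuous fun x => Q (ρ x / ε) / ε :=
    (hQ.comp (hρ.div_const ε)).div_const ε
  rw [← intervalIntegral.sum_integral_adjacent_intervals
    fun k _ => hcont.intervalIntegrable (M k) (M (k + 1))]
  have hpiece : ∀ j ∈ Finset.range (n + 1),
      ∫ x in M j..M (j + 1), Q (ρ x / ε) / ε < γ := by
    intro j hj
    have hjn : j ≤ n := Nat.lt_succ_iff.1 (Finset.mem_range.1 hj)
    have hsq : ((-1 : ℝ) ^ j) * (-1) ^ j = 1 := by rw [← mul_pow]; simp
    have hF : ∀ x, HasDerivAt (fun x => (-1) ^ j * Θ ((-1) ^ j * (x - H j) / ε))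
        (Q ((-1) ^ j * (x - H j) / ε) / ε) x := by
      intro x
      refine (((hΘ _).comp x ((((hasDerivAt_id x).sub_const (H j)).const_mul
        ((-1 : ℝ) ^ j)).div_const ε)).const_mul ((-1 : ℝ) ^ j)).congr_deriv ?_
      simp only [id]
      linear_combination (Q ((-1) ^ j * (x - H j) / ε) / ε) * hsq
    have hcongr : ∫ x in M j..M (j + 1), Q (ρ x / ε) / ε
        = ∫ x in M j..M (j + 1), Q ((-1) ^ j * (x - H j) / ε) / ε := by
      refine intervalIntegral.integral_congr fun x hx => ?_
      rw [uIcc_of_le (hM j)] at hx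
      simp only [hρH j hjn x hx]
    rw [hcongr, intervalIntegral.integral_eq_sub_of_hasDerivAt (fun x _ => hF x)
      (Continuous.intervalIntegrable (by fun_prop) _ _)]
    have h1 := hΘmem ((-1) ^ j * (M (j + 1) - H j) / ε)
    have h2 := hΘmem ((-1) ^ j * (M j - H j) / ε)
    rcases neg_one_pow_eq_or ℝ j with h | h <;> rw [h] at h1 h2 ⊢ <;>
      linarith [h1.1, h1.2, h2.1, h2.2]
  refine (Finset.sum_lt_sum_of_nonempty ⟨0, by simp⟩ hpiece).trans_eq ?_
  simp

/-- Corners of a zigzag can be smoothed while keeping a strict upper bound on the energy. -/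
lemma exists_smooth_integral_lt {Q ρ : ℝ → ℝ} {K E a b ε : ℝ} (hQ : Continuous Q)
    (hQK : ∀ y, |Q y| ≤ K) (hρ : LipschitzWith 1 ρ) (hε : 0 < ε)
    (hE : ∫ x in a..b, Q (ρ x / ε) / ε < E) :
    ∃ r s : ℝ → ℝ, (∀ x, HasDerivAt r (s x) x) ∧ Continuous s ∧ (∀ x, |s x| ≤ 1) ∧
      (∀ x, |r x - ρ x| ≤ ε) ∧ ∫ x in a..b, Q (r x / ε) / ε < E := by
  choose r s hr hs hs1 hrρ using fun k : ℕ =>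
    exists_contDiff_approx hρ (Nat.one_div_pos_of_nat (α := ℝ) (n := k))
  have hrc : ∀ k, Continuous (r k) := fun k =>
    continuous_iff_continuousAt.2 fun x => (hr k x).continuousAt
  have h0 := tendsto_one_div_add_atTop_nhds_zero_nat (𝕜 := ℝ)
  have hlim : ∀ x, Tendsto (fun k => r k x) atTop (nhds (ρ x)) := fun x =>
    tendsto_iff_dist_tendsto_zero.2 (squeeze_zero (fun _ => dist_nonneg)
      (fun k => by simpa [Real.dist_eq] using hrρ k x) (by simpa using h0))
  have hint : Tendsto (fun k => ∫ x in a..b, Q (r k x / ε) / ε) atTop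
      (nhds (∫ x in a..b, Q (ρ x / ε) / ε)) := by
    refine intervalIntegral.tendsto_integral_filter_of_dominated_convergence (fun _ => K / ε)
      (Eventually.of_forall fun k => ?_) (Eventually.of_forall fun k => ?_) (by simp) ?_
    · have := hrc k
      exact Continuous.aestronglyMeasurable (by fun_prop)
    · refine Eventually.of_forall fun x _ => ?_
      rw [Real.norm_eq_abs, abs_div, abs_of_pos hε]
      exact div_le_div_of_nonneg_right (hQK _) hε.le
    · refine Eventually.of_forall fun x _ => ?_
      exact ((hQ.tendsto _).comp ((hlim x).div_const ε)).div_const ε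
  obtain ⟨k, hk, hkε⟩ := ((hint.eventually_lt_const hE).and (h0.eventually_lt_const hε)).exists
  exact ⟨r k, s k, hr k, hs k, hs1 k, fun x => (hrρ k x).trans hkε.le, hk⟩

lemma sum_abs_sub_le_integral {Q Θ r s : ℝ → ℝ} {ε : ℝ} {M : ℕ → ℝ} (hQ : Continuous Q)
    (hQ0 : ∀ y, 0 ≤ Q y) (hΘ : ∀ y, HasDerivAt Θ (Q y) y) (hr : ∀ x, HasDerivAt r (s x) x)
    (hs : Continuous s) (hM : ∀ k, M k ≤ M (k + 1)) (hε : 0 < ε) (n : ℕ) :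
    ∑ j ∈ Finset.range n, |Θ (r (M (j + 1)) / ε) - Θ (r (M j) / ε)| ≤
      ∫ x in M 0..M n, Q (r x / ε) / ε * ((1 + s x ^ 2) / 2) := by
  have hrc : Continuous r := continuous_iff_continuousAt.2 fun x => (hr x).continuousAt
  have hcont : Continuous fun x => Q (r x / ε) / ε * ((1 + s x ^ 2) / 2) := by fun_prop
  have hcont' : Continuous fun x => Q (r x / ε) / ε * s x := by fun_prop
  rw [← intervalIntegral.sum_integral_adjacent_intervals
    fun k _ => hcont.intervalIntegrable (M k) (M (k + 1))]
  refine Finset.sum_le_sum fun j _ => ?_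
  have hF : ∀ x, HasDerivAt (fun x => Θ (r x / ε)) (Q (r x / ε) / ε * s x) x := fun x =>
    ((hΘ _).comp x ((hr x).div_const ε)).congr_deriv (by ring)
  rw [← intervalIntegral.integral_eq_sub_of_hasDerivAt (fun x _ => hF x)
    (hcont'.intervalIntegrable _ _)]
  refine (intervalIntegral.abs_integral_le_integral_abs (hM j)).trans
    (intervalIntegral.integral_mono_on (hM j) (hcont'.abs.intervalIntegrable _ _)
      (hcont.intervalIntegrable _ _) fun x _ => ?_)
  have hq : 0 ≤ Q (r x / ε) / ε := div_nonneg (hQ0 _) hε.le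
  rw [abs_mul, abs_of_nonneg hq]
  refine mul_le_mul_of_nonneg_left ?_ hq
  nlinarith [sq_nonneg (|s x| - 1), sq_abs (s x)]

lemma tendsto_div_atTop_of_abs_sub_le {r : ℝ → ℝ} {c : ℝ} (hc : 0 < c)
    (hr : ∀ ε > 0, |r ε - c| ≤ ε) :
    Tendsto (fun ε => r ε / ε) (nhdsWithin 0 (Ioi 0)) atTop := by
  have h1 : Tendsto (fun ε : ℝ => -1 + c * ε⁻¹) (nhdsWithin 0 (Ioi 0)) atTop :=
    tendsto_atTop_add_const_left _ _ (tendsto_inv_nhdsGT_zero.const_mul_atTop hc)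
  refine tendsto_atTop_mono' _ ?_ h1
  filter_upwards [self_mem_nhdsWithin] with ε hε
  have hε' : (0 : ℝ) < ε := hε
  rw [le_div_iff₀ hε']
  have := (abs_le.1 (hr ε hε')).1
  field_simp
  linarith

lemma tendsto_div_atBot_of_abs_sub_le {r : ℝ → ℝ} {c : ℝ} (hc : c < 0)
    (hr : ∀ ε > 0, |r ε - c| ≤ ε) :
    Tendsto (fun ε => r ε / ε) (nhdsWithin 0 (Ioi 0)) atBot := by
  have := tendsto_div_atTop_of_abs_sub_le (r := fun ε => -r ε) (neg_pos.2 hc) fun ε hε => by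
    rw [← abs_neg]
    simpa [sub_eq_add_neg, add_comm] using hr ε hε
  simpa [neg_div, Function.comp_def] using tendsto_neg_atTop_atBot.comp this

lemma tendsto_sum_abs_sub {Θ ρ : ℝ → ℝ} {r : ℝ → ℝ → ℝ} {γ : ℝ} {H M : ℕ → ℝ} {n : ℕ}
    (hγ : 0 < γ) (htop : Tendsto Θ atTop (nhds γ)) (hbot : Tendsto Θ atBot (nhds 0))
    (hMH : ∀ j ≤ n, H j ∈ Ioo (M j) (M (j + 1)))
    (hρH : ∀ j ≤ n, ∀ x ∈ Icc (M j) (M (j + 1)), ρ x = (-1) ^ j * (x - H j))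
    (hr : ∀ ε > 0, ∀ x, |r ε x - ρ x| ≤ ε) :
    Tendsto (fun ε => ∑ j ∈ Finset.range (n + 1),
      |Θ (r ε (M (j + 1)) / ε) - Θ (r ε (M j) / ε)|) (nhdsWithin 0 (Ioi 0))
      (nhds (((n + 1 : ℕ) : ℝ) * γ)) := by
  have hconst : ((n + 1 : ℕ) : ℝ) * γ = ∑ _j ∈ Finset.range (n + 1), γ := by simp
  rw [hconst]
  refine tendsto_finsetSum _ fun j hj => ?_
  have hjn : j ≤ n := Nat.lt_succ_iff.1 (Finset.mem_range.1 hj)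
  obtain ⟨hl, hu⟩ := hMH j hjn
  have h1 := hρH j hjn (M j) (left_mem_Icc.2 (hl.trans hu).le)
  have h2 := hρH j hjn (M (j + 1)) (right_mem_Icc.2 (hl.trans hu).le)
  have hpos : ∀ x, 0 < ρ x →
      Tendsto (fun ε => Θ (r ε x / ε)) (nhdsWithin 0 (Ioi 0)) (nhds γ) := fun x hx =>
    htop.comp (tendsto_div_atTop_of_abs_sub_le hx fun ε hε => hr ε hε x)
  have hneg : ∀ x, ρ x < 0 →
      Tendsto (fun ε => Θ (r ε x / ε)) (nhdsWithin 0 (Ioi 0)) (nhds 0) := fun x hx =>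
    hbot.comp (tendsto_div_atBot_of_abs_sub_le hx fun ε hε => hr ε hε x)
  rcases neg_one_pow_eq_or ℝ j with h | h <;> rw [h] at h1 h2
  · simpa [abs_of_pos hγ] using
      ((hpos (M (j + 1)) (by linarith)).sub (hneg (M j) (by linarith))).abs
  · simpa [abs_of_pos hγ] using
      ((hneg (M (j + 1)) (by linarith)).sub (hpos (M j) (by linarith))).abs

lemma exists_partition {n : ℕ} {h : Fin (n + 1) → ℝ} {a b : ℝ} (hmono : StrictMono h)
    (hha : ∀ i, a < h i) (hhb : ∀ i, h i < b) :
    ∃ H M : ℕ → ℝ, M 0 = a ∧ M (n + 1) = b ∧ Monotone M ∧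
      (∀ k < n, 2 * M (k + 1) = H k + H (k + 1)) ∧
      (∀ j ≤ n, H j ∈ Ioo (M j) (M (j + 1))) ∧ ∀ i : Fin (n + 1), h i = H i := by
  set H : ℕ → ℝ := fun k => h ⟨min k n, by omega⟩ with hH
  set M : ℕ → ℝ := fun k =>
    if k = 0 then a else if k ≤ n then (H (k - 1) + H k) / 2 else b with hMd
  have hHlt : ∀ k < n, H k < H (k + 1) := fun k hk => hmono (by
    rw [Fin.mk_lt_mk]; omega)
  have hHa : ∀ k, a < H k := fun k => hha _
  have hHb : ∀ k, H k < b := fun k => hhb _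
  have hM0 : M 0 = a := rfl
  have hMmid : ∀ k < n, M (k + 1) = (H k + H (k + 1)) / 2 := fun k hk => by
    simp [hMd, Nat.succ_le_of_lt hk]
  have hMb : ∀ k, n ≤ k → M (k + 1) = b := fun k hk => by
    simp [hMd, Nat.not_le.2 (Nat.lt_succ_of_le hk)]
  have hmem : ∀ j ≤ n, H j ∈ Ioo (M j) (M (j + 1)) := by
    intro j hj
    constructor
    · rcases j with _ | j
      · exact hHa 0
      · rw [hMmid j (by omega)]
        linarith [hHlt j (by omega)]
    · rcases hj.lt_or_eq with hj | rfl
      · rw [hMmid j hj]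
        linarith [hHlt j hj]
      · rw [hMb j le_rfl]
        exact hHb j
  refine ⟨H, M, hM0, hMb n le_rfl, monotone_nat_of_le_succ fun k => ?_, fun k hk => ?_, hmem,
    fun i => ?_⟩
  · rcases Nat.lt_or_ge n k with hk | hk
    · obtain ⟨k, rfl⟩ : ∃ l, k = l + 1 := ⟨k - 1, by omega⟩
      rw [hMb k (by omega), hMb (k + 1) (by omega)]
    · exact ((hmem k hk).1.trans (hmem k hk).2).le
  · rw [hMmid k hk]
    ring
  · simp only [hH]
    congr 1
    ext
    simp only
    omega

lemma exists_mem_Icc_partition {M : ℕ → ℝ} {x : ℝ} (n : ℕ) (hx : x ∈ Icc (M 0) (M (n + 1))) :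
    ∃ j ≤ n, x ∈ Icc (M j) (M (j + 1)) := by
  induction n with
  | zero => exact ⟨0, le_rfl, hx⟩
  | succ n ih =>
    rcases le_total x (M (n + 1)) with h | h
    · obtain ⟨j, hj, hxj⟩ := ih ⟨hx.1, h⟩
      exact ⟨j, by omega, hxj⟩
    · exact ⟨n + 1, le_rfl, h, hx.2⟩

lemma card_filter_le_of_mem_Icc {n j : ℕ} {h : Fin (n + 1) → ℝ} {H M : ℕ → ℝ} {x : ℝ}
    (hM : Monotone M) (hMH : ∀ j ≤ n, H j ∈ Ioo (M j) (M (j + 1)))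
    (hH : ∀ i : Fin (n + 1), h i = H i) (hj : j ≤ n) (hx : x ∈ Icc (M j) (M (j + 1))) :
    (Finset.univ.filter fun i : Fin (n + 1) => h i ≤ x).card = if x < H j then j else j + 1 := by
  have hlow : ∀ i : Fin (n + 1), i.val < j → h i ≤ x := fun i hi => by
    rw [hH]
    exact (hMH i (by omega)).2.le.trans ((hM (by omega)).trans hx.1)
  have hhigh : ∀ i : Fin (n + 1), j < i.val → ¬ h i ≤ x := fun i hi => by
    rw [hH, not_le]
    exact (hx.2.trans (hM (by omega))).trans_lt (hMH i (by omega)).1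
  have hcard : ∀ m ≤ n + 1, (∀ i : Fin (n + 1), h i ≤ x ↔ i.val < m) →
      (Finset.univ.filter fun i : Fin (n + 1) => h i ≤ x).card = m := fun m hm hiff => by
    simp only [hiff, Fin.card_filter_val_lt]
    omega
  split_ifs with hxj
  · refine hcard j (by omega) fun i => ⟨fun hi => ?_, hlow i⟩
    by_contra hij
    rcases (not_lt.1 hij).lt_or_eq with h' | h'
    · exact hhigh i h' hi
    · rw [hH, ← h'] at hi
      linarith
  · refine hcard (j + 1) (by omega) fun i => ⟨fun hi => ?_, fun hi => ?_⟩
    · by_contra hij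
      exact hhigh i (by omega) hi
    · rcases (Nat.lt_succ_iff.1 hi).lt_or_eq with h' | h'
      · exact hlow i h'
      · rw [hH, h']
        exact not_lt.1 hxj

lemma ite_even_eq_of_mem_Icc {n j : ℕ} {h : Fin (n + 1) → ℝ} {H M : ℕ → ℝ} {x α β : ℝ}
    (hM : Monotone M) (hMH : ∀ j ≤ n, H j ∈ Ioo (M j) (M (j + 1)))
    (hH : ∀ i : Fin (n + 1), h i = H i) (hj : j ≤ n) (hx : x ∈ Icc (M j) (M (j + 1)))
    (hxj : x ≠ H j) :
    (if Even (Finset.univ.filter fun i : Fin (n + 1) => h i ≤ x).card then α else β) =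
      if (-1) ^ j * (x - H j) < 0 then α else β := by
  rw [card_filter_le_of_mem_Icc hM hMH hH hj hx]
  rcases hxj.lt_or_gt with hlt | hgt
  · rw [if_pos hlt]
    rcases Nat.even_or_odd j with h' | h'
    · rw [h'.neg_one_pow, if_pos h', if_pos (by linarith)]
    · rw [h'.neg_one_pow, if_neg (Nat.not_even_iff_odd.2 h'), if_neg (by linarith)]
  · rw [if_neg hgt.not_gt]
    rcases Nat.even_or_odd j with h' | h'
    · rw [h'.neg_one_pow, if_neg (Nat.not_even_iff_odd.2 h'.add_one), if_neg (by linarith)]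
    · rw [h'.neg_one_pow, if_pos h'.add_one, if_pos (by linarith)]

lemma measurable_ite_even_card {ι : Type*} [Fintype ι] (h : ι → ℝ) (α β : ℝ) :
    Measurable fun x : ℝ =>
      if Even (Finset.univ.filter fun i => h i ≤ x).card then α else β := by
  have hcard : Measurable fun x : ℝ => (Finset.univ.filter fun i => h i ≤ x).card := by
    simp only [Finset.card_filter]
    exact Finset.measurable_sum _ fun i _ =>
      Measurable.ite measurableSet_Ici measurable_const measurable_const
  exact Measurable.ite (hcard (.of_discrete (s := {k : ℕ | Even k})))
    measurable_const measurable_const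

lemma exists_integral_le_sq {k : ℝ → ℝ} {I : Set ℝ} {α β : ℝ} (hI : IsOpen I)
    (hαβ : α < β) (hsub : Icc α β ⊆ I) (hk : ContDiffOn ℝ 1 k I) (hkα : k α = 0)
    (hkβ : k β = 0) (hint : ∫ t in α..β, k t = 0) :
    ∃ L > 0, ∀ s ∈ Icc α β, (∫ t in α..s, k t) ≤ L * (s - α) ^ 2 ∧
      (∫ t in α..s, k t) ≤ L * (β - s) ^ 2 := by
  have hder : ContinuousOn (deriv k) (Icc α β) :=
    (hk.continuousOn_deriv_of_isOpen hI le_rfl).mono hsub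
  obtain ⟨L, hL⟩ := isCompact_Icc.exists_bound_of_continuousOn hder
  have hlip : ∀ s ∈ Icc α β, ∀ t ∈ Icc α β, |k t - k s| ≤ L * |t - s| := fun s hs t ht =>
    (convex_Icc α β).norm_image_sub_le_of_norm_deriv_le
      (fun x hx => (hk.contDiffAt (hI.mem_nhds (hsub hx))).differentiableAt one_ne_zero) hL hs ht
  have hL0 : 0 ≤ L := (norm_nonneg _).trans (hL α (left_mem_Icc.2 hαβ.le))
  have hkc : ContinuousOn k (Icc α β) := hk.continuousOn.mono hsub
  have hki : ∀ s ∈ Icc α β, ∀ t ∈ Icc α β, IntervalIntegrable k volume s t := fun s hs t ht =>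
    (hkc.mono (ordConnected_Icc.uIcc_subset hs ht)).intervalIntegrable
  have hα : α ∈ Icc α β := left_mem_Icc.2 hαβ.le
  have hβ : β ∈ Icc α β := right_mem_Icc.2 hαβ.le
  refine ⟨L + 1, by linarith, fun s hs => ⟨?_, ?_⟩⟩
  · have := intervalIntegral.norm_integral_le_of_norm_le_const (a := α) (b := s) (f := k)
      (C := L * (s - α)) (by
        intro t ht
        rw [uIoc_of_le hs.1] at ht
        have := hlip α hα t ⟨ht.1.le, ht.2.trans hs.2⟩
        rw [hkα, sub_zero, abs_of_nonneg (sub_nonneg.2 ht.1.le)] at this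
        exact this.trans (mul_le_mul_of_nonneg_left (by linarith [ht.2]) hL0))
    rw [abs_of_nonneg (by linarith [hs.1])] at this
    have := (le_abs_self _).trans this
    nlinarith [sq_nonneg (s - α)]
  · have hsum := intervalIntegral.integral_add_adjacent_intervals (hki α hα s hs) (hki s hs β hβ)
    have := intervalIntegral.norm_integral_le_of_norm_le_const (a := s) (b := β) (f := k)
      (C := L * (β - s)) (by
        intro t ht
        rw [uIoc_of_le hs.2] at ht
        have := hlip β hβ t ⟨hs.1.trans ht.1.le, ht.2⟩
        rw [hkβ, sub_zero, abs_of_nonpos (sub_nonpos.2 ht.2)] at this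
        exact this.trans (mul_le_mul_of_nonneg_left (by linarith [ht.1]) hL0))
    rw [abs_of_nonneg (by linarith [hs.2])] at this
    have := (neg_abs_le _).trans' (neg_le_neg this)
    nlinarith [sq_nonneg (β - s)]

/-- The standing wave `φ` of `D(φ) φ' = √(2 G(φ))` and its accumulated energy `Θ`. -/
lemma exists_standing_wave_energy {G D : ℝ → ℝ} {α β d L : ℝ} (hαβ : α < β)
    (hG : ContinuousOn G (Icc α β)) (hD : ContinuousOn D (Icc α β)) (hd : 0 < d)
    (hDd : ∀ s ∈ Icc α β, d ≤ D s) (hGpos : ∀ s ∈ Ioo α β, 0 < G s) (hL : 0 < L)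
    (hGα : ∀ s ∈ Icc α β, G s ≤ L * (s - α) ^ 2) (hGβ : ∀ s ∈ Icc α β, G s ≤ L * (β - s) ^ 2) :
    ∃ φ Θ : ℝ → ℝ, (∀ y, φ y ∈ Ioo α β) ∧
      (∀ y, HasDerivAt φ (Real.sqrt (2 * G (φ y)) / D (φ y)) y) ∧
      Tendsto φ atTop (nhds β) ∧ Tendsto φ atBot (nhds α) ∧
      (∀ y, HasDerivAt Θ (2 * G (φ y)) y) ∧
      (∀ y, Θ y ∈ Ioo 0 (∫ s in α..β, Real.sqrt (2 * G s) * D s)) ∧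
      Tendsto Θ atTop (nhds (∫ s in α..β, Real.sqrt (2 * G s) * D s)) ∧
      Tendsto Θ atBot (nhds 0) := by
  have hα : α ∈ Icc α β := left_mem_Icc.2 hαβ.le
  have hβ : β ∈ Icc α β := right_mem_Icc.2 hαβ.le
  have hDpos : ∀ s ∈ Icc α β, 0 < D s := fun s hs => hd.trans_le (hDd s hs)
  have hsqrt : ContinuousOn (fun s => Real.sqrt (2 * G s)) (Icc α β) := (hG.const_mul 2).sqrt
  have hbound : ∀ s ∈ Icc α β, ∀ t, 0 ≤ t → G s ≤ L * t ^ 2 →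
      Real.sqrt (2 * G s) / D s ≤ Real.sqrt (2 * L) / d * t := by
    intro s hs t ht hGt
    have h1 : Real.sqrt (2 * G s) ≤ Real.sqrt (2 * L) * t := by
      refine Real.sqrt_le_iff.2 ⟨by positivity, ?_⟩
      rw [mul_pow, Real.sq_sqrt (by positivity)]
      linarith
    rw [div_mul_eq_mul_div]
    exact div_le_div₀ (by positivity) h1 hd (hDd s hs)
  obtain ⟨φ, hφ, hφ', htop, hbot⟩ := exists_standing_wave
    (g := fun s => Real.sqrt (2 * G s) / D s) (C := Real.sqrt (2 * L) / d) hαβ (by positivity)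
    ((hsqrt.div hD fun s hs => (hDpos s hs).ne').mono Ioo_subset_Icc_self)
    (fun s hs => div_pos (Real.sqrt_pos.2 (mul_pos two_pos (hGpos s hs)))
      (hDpos s (Ioo_subset_Icc_self hs)))
    (fun s hs => hbound s (Ioo_subset_Icc_self hs) _ (sub_nonneg.2 hs.1.le)
      (hGα s (Ioo_subset_Icc_self hs)))
    (fun s hs => hbound s (Ioo_subset_Icc_self hs) _ (sub_nonneg.2 hs.2.le)
      (hGβ s (Ioo_subset_Icc_self hs)))
  set q : ℝ → ℝ := fun s => Real.sqrt (2 * G s) * D s with hq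
  have hqc : ContinuousOn q (Icc α β) := hsqrt.mul hD
  have hqi : IntegrableOn q (uIcc α β) volume := by
    rw [uIcc_of_le hαβ.le]
    exact hqc.integrableOn_Icc
  set Ψ : ℝ → ℝ := fun s => ∫ t in α..s, q t with hΨ
  have hΨc : ContinuousOn Ψ (Icc α β) := by
    simpa [uIcc_of_le hαβ.le] using intervalIntegral.continuousOn_primitive_interval hqi
  have hΨ' : ∀ s ∈ Ioo α β, HasDerivAt Ψ (q s) s := fun s hs =>
    intervalIntegral.integral_hasDerivAt_right
      (hqc.mono (ordConnected_Icc.uIcc_subset hα (Ioo_subset_Icc_self hs))).intervalIntegrable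
      ((hqc.mono Ioo_subset_Icc_self).stronglyMeasurableAtFilter isOpen_Ioo s hs)
      (hqc.continuousAt (Icc_mem_nhds hs.1 hs.2))
  have hΨmono : StrictMonoOn Ψ (Icc α β) := by
    refine strictMonoOn_of_deriv_pos (convex_Icc α β) hΨc fun s hs => ?_
    rw [interior_Icc] at hs
    rw [(hΨ' s hs).deriv]
    exact mul_pos (Real.sqrt_pos.2 (mul_pos two_pos (hGpos s hs)))
      (hDpos s (Ioo_subset_Icc_self hs))
  have hΨα : Ψ α = 0 := intervalIntegral.integral_same
  have hφI : ∀ y, φ y ∈ Icc α β := fun y => Ioo_subset_Icc_self (hφ y)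
  refine ⟨φ, fun y => Ψ (φ y), hφ, hφ', htop, hbot, fun y => ?_, fun y => ⟨?_, ?_⟩, ?_, ?_⟩
  · refine ((hΨ' _ (hφ y)).comp y (hφ' y)).congr_deriv ?_
    have h1 := (hDpos _ (hφI y)).ne'
    have h2 := Real.mul_self_sqrt (mul_nonneg zero_le_two (hGpos _ (hφ y)).le)
    simp only [hq]
    field_simp
    rw [sq, h2]
  · rw [← hΨα]
    exact hΨmono hα (hφI y) (hφ y).1
  · exact hΨmono (hφI y) hβ (hφ y).2
  · exact (hΨc β hβ).tendsto.comp
      (tendsto_nhdsWithin_iff.2 ⟨htop, Eventually.of_forall hφI⟩)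
  · rw [← hΨα]
    exact (hΨc α hα).tendsto.comp
      (tendsto_nhdsWithin_iff.2 ⟨hbot, Eventually.of_forall hφI⟩)

lemma tendsto_integral_layers {φ ρ v : ℝ → ℝ} {r : ℝ → ℝ → ℝ} {α β a b : ℝ}
    (hφ : ∀ y, φ y ∈ Ioo α β) (hφc : Continuous φ) (htop : Tendsto φ atTop (nhds β))
    (hbot : Tendsto φ atBot (nhds α)) (hrc : ∀ ε > 0, Continuous (r ε))
    (hr : ∀ ε > 0, ∀ x, |r ε x - ρ x| ≤ ε) (hv : Measurable v)
    (hvρ : ∀ᵐ x, x ∈ uIoc a b → (ρ x < 0 ∧ v x = α) ∨ (0 < ρ x ∧ v x = β)) :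
    Tendsto (fun ε => ∫ x in a..b, |φ (r ε x / ε) - v x|) (nhdsWithin 0 (Ioi 0)) (nhds 0) := by
  have hαβ : α < β := (hφ 0).1.trans (hφ 0).2
  have hlim : Tendsto (fun ε => ∫ x in a..b, |φ (r ε x / ε) - v x|) (nhdsWithin 0 (Ioi 0))
      (nhds (∫ _x in a..b, (0 : ℝ))) := by
    refine intervalIntegral.tendsto_integral_filter_of_dominated_convergence (fun _ => β - α)
      ?_ (Eventually.of_forall fun ε => ?_) (by simp) ?_
    · filter_upwards [self_mem_nhdsWithin] with ε hε
      have := hrc ε hε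
      have hm : Measurable fun x => φ (r ε x / ε) := Continuous.measurable (by fun_prop)
      exact (hm.sub hv).norm.aestronglyMeasurable
    · filter_upwards [hvρ] with x hx hxab
      have h1 := hφ (r ε x / ε)
      rw [Real.norm_eq_abs, abs_abs, abs_le]
      rcases hx hxab with ⟨-, h⟩ | ⟨-, h⟩ <;> rw [h] <;> constructor <;> linarith [h1.1, h1.2]
    · filter_upwards [hvρ] with x hx hxab
      rcases hx hxab with ⟨hρ, h⟩ | ⟨hρ, h⟩
      · have := (hbot.comp (tendsto_div_atBot_of_abs_sub_le hρ fun ε hε => hr ε hε x)).sub_const α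
        simpa [h] using this.abs
      · have := (htop.comp (tendsto_div_atTop_of_abs_sub_le hρ fun ε hε => hr ε hε x)).sub_const β
        simpa [h] using this.abs
  simpa using hlim

/-- Existence of metastable `N`-transition layer states: a family `u^ε ∈ H¹(a,b)`
with values in `(α,β)` such that `‖u^ε - v‖_{L¹} → 0`, `E_ε[u^ε] < N γ₀` for small
`ε`, and `E_ε[u^ε] → N γ₀` as `ε → 0⁺`. -/
theorem stmt12
    (I : Set ℝ) (hIopen : IsOpen I) (hIconn : I.OrdConnected)
    (D f G : ℝ → ℝ) (d α β γ₀ : ℝ)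
    (hαβ : α < β) (hsub : Set.Icc α β ⊆ I)
    (hD : ContDiffOn ℝ 2 D I) (hd : 0 < d) (hDd : ∀ u ∈ I, d ≤ D u)
    (hf : ContDiffOn ℝ 2 f I)
    (hfα : f α = 0) (hfβ : f β = 0)
    (hf'α : 0 < deriv f α) (hf'β : 0 < deriv f β)
    (hint0 : (∫ s in α..β, f s * D s) = 0)
    (hG : ∀ u, G u = ∫ s in α..u, f s * D s)
    (hGpos : ∀ u ∈ Set.Icc α β, u ≠ α → u ≠ β → 0 < G u)
    (hγ₀ : γ₀ = ∫ s in α..β, Real.sqrt (2 * G s) * D s)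
    (a b : ℝ) (hab : a < b)
    (N : ℕ) (hN : 1 ≤ N) (h : Fin N → ℝ) (hmono : StrictMono h)
    (hha : ∀ i, a < h i) (hhb : ∀ i, h i < b)
    (v : ℝ → ℝ)
    (hv : ∀ x, v x = if Even (Finset.univ.filter (fun i : Fin N => h i ≤ x)).card
      then α else β) :
    ∃ U : ℝ → ℝ → ℝ,
      (∀ ε > (0:ℝ), Differentiable ℝ (U ε) ∧ ∀ x ∈ Set.Icc a b, U ε x ∈ Set.Ioo α β) ∧
      Tendsto (fun ε => ∫ x in a..b, |U ε x - v x|) (nhdsWithin 0 (Set.Ioi 0)) (nhds 0) ∧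
      (∃ ε₁ > (0:ℝ), ∀ ε ∈ Set.Ioo (0:ℝ) ε₁,
        (∫ x in a..b, (ε / 2 * (D (U ε x) * deriv (U ε) x) ^ 2 + G (U ε x) / ε)) <
          (N : ℝ) * γ₀) ∧
      Tendsto
        (fun ε => ∫ x in a..b, (ε / 2 * (D (U ε x) * deriv (U ε) x) ^ 2 + G (U ε x) / ε))
        (nhdsWithin 0 (Set.Ioi 0)) (nhds ((N : ℝ) * γ₀)) := by
  obtain ⟨n, rfl⟩ : ∃ n, N = n + 1 := ⟨N - 1, by omega⟩
  have hα : α ∈ Icc α β := left_mem_Icc.2 hαβ.le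
  have hDpos : ∀ s ∈ Icc α β, 0 < D s := fun s hs => hd.trans_le (hDd s (hsub hs))
  have hk : ContDiffOn ℝ 1 (fun s => f s * D s) I := (hf.mul hD).of_le one_le_two
  obtain ⟨L, hL, hLb⟩ := exists_integral_le_sq hIopen hαβ hsub hk (by simp [hfα])
    (by simp [hfβ]) hint0
  have hkc : ContinuousOn (fun s => f s * D s) (Icc α β) := hk.continuousOn.mono hsub
  have hGc : ContinuousOn G (Icc α β) := by
    rw [funext hG]
    have hi : IntegrableOn (fun s => f s * D s) (uIcc α β) volume := by
      rw [uIcc_of_le hαβ.le]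
      exact hkc.integrableOn_Icc
    simpa [uIcc_of_le hαβ.le] using intervalIntegral.continuousOn_primitive_interval hi
  have hGpos' : ∀ s ∈ Ioo α β, 0 < G s := fun s hs =>
    hGpos s (Ioo_subset_Icc_self hs) hs.1.ne' hs.2.ne
  obtain ⟨φ, Θ, hφ, hφ', hφtop, hφbot, hΘ, hΘmem, hΘtop, hΘbot⟩ :=
    exists_standing_wave_energy hαβ hGc (hD.continuousOn.mono hsub) hd
      (fun s hs => hDd s (hsub hs)) hGpos' hL
      (fun s hs => (hG s).trans_le (hLb s hs).1) (fun s hs => (hG s).trans_le (hLb s hs).2)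
  rw [← hγ₀] at hΘmem hΘtop
  have hφI : ∀ y, φ y ∈ Icc α β := fun y => Ioo_subset_Icc_self (hφ y)
  have hφc : Continuous φ := continuous_iff_continuousAt.2 fun y => (hφ' y).continuousAt
  set Q : ℝ → ℝ := fun y => 2 * G (φ y) with hQdef
  have hQ0 : ∀ y, 0 ≤ Q y := fun y => mul_nonneg zero_le_two (hGpos' _ (hφ y)).le
  have hQ : Continuous Q := continuous_const.mul (hGc.comp_continuous hφc hφI)
  obtain ⟨K, hK⟩ := isCompact_Icc.exists_bound_of_continuousOn (hGc.const_mul 2)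
  obtain ⟨H, M, hM0, hMn, hM, hMmid, hMH, hhH⟩ := exists_partition hmono hha hhb
  obtain ⟨ρ, hρL, hρH⟩ := exists_zigzag H M hM n hMmid
  have hMs : ∀ k, M k ≤ M (k + 1) := fun k => hM (Nat.le_succ k)
  have hsmooth : ∀ ε : ℝ, ∃ r s : ℝ → ℝ, 0 < ε → (∀ x, HasDerivAt r (s x) x) ∧ Continuous s ∧
      (∀ x, |s x| ≤ 1) ∧ (∀ x, |r x - ρ x| ≤ ε) ∧
      ∫ x in a..b, Q (r x / ε) / ε < ((n + 1 : ℕ) : ℝ) * γ₀ := by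
    intro ε
    by_cases hε : 0 < ε
    · have hlt := integral_zigzag_lt (ε := ε) hQ hΘ hΘmem hρL.continuous hMs hρH
      rw [hM0, hMn] at hlt
      obtain ⟨r, s, hrs⟩ := exists_smooth_integral_lt hQ (fun y => hK _ (hφI y)) hρL hε hlt
      exact ⟨r, s, fun _ => hrs⟩
    · exact ⟨0, 0, fun h => absurd h hε⟩
  choose r s hrs using hsmooth
  have hrc : ∀ ε > 0, Continuous (r ε) := fun ε hε =>
    continuous_iff_continuousAt.2 fun x => ((hrs ε hε).1 x).continuousAt
  have hrρ : ∀ ε > 0, ∀ x, |r ε x - ρ x| ≤ ε := fun ε hε => (hrs ε hε).2.2.2.1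
  have hU : ∀ ε > 0, ∀ x, HasDerivAt (fun x => φ (r ε x / ε))
      (Real.sqrt (2 * G (φ (r ε x / ε))) / D (φ (r ε x / ε)) * (s ε x / ε)) x :=
    fun ε hε x => (hφ' _).comp x (((hrs ε hε).1 x).div_const ε)
  have henergy : ∀ ε > 0, (∫ x in a..b, (ε / 2 * (D (φ (r ε x / ε)) *
      deriv (fun x => φ (r ε x / ε)) x) ^ 2 + G (φ (r ε x / ε)) / ε)) =
      ∫ x in a..b, Q (r ε x / ε) / ε * ((1 + s ε x ^ 2) / 2) := by
    intro ε hε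
    refine intervalIntegral.integral_congr fun x _ => ?_
    have h1 := (hDpos _ (hφI (r ε x / ε))).ne'
    have h2 := Real.sq_sqrt (hQ0 (r ε x / ε))
    simp only [(hU ε hε x).deriv, hQdef] at h2 ⊢
    have h3 : D (φ (r ε x / ε)) * (Real.sqrt (2 * G (φ (r ε x / ε))) / D (φ (r ε x / ε)) *
        (s ε x / ε)) = Real.sqrt (2 * G (φ (r ε x / ε))) * (s ε x / ε) := by
      field_simp
    rw [h3, mul_pow, h2]
    field_simp
    ring
  have hupper : ∀ ε > 0, (∫ x in a..b, Q (r ε x / ε) / ε * ((1 + s ε x ^ 2) / 2)) <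
      ((n + 1 : ℕ) : ℝ) * γ₀ := by
    intro ε hε
    obtain ⟨-, hsc, hs1, -, hlt⟩ := hrs ε hε
    have := hrc ε hε
    refine lt_of_le_of_lt (intervalIntegral.integral_mono_on hab.le
      (Continuous.intervalIntegrable (by fun_prop) _ _)
      (Continuous.intervalIntegrable (by fun_prop) _ _) fun x _ => ?_) hlt
    refine mul_le_of_le_one_right (div_nonneg (hQ0 _) hε.le) ?_
    have := (sq_le_one_iff_abs_le_one _).2 (hs1 x)
    linarith
  have hlower : ∀ ε > 0, ∑ j ∈ Finset.range (n + 1),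
      |Θ (r ε (M (j + 1)) / ε) - Θ (r ε (M j) / ε)| ≤
        ∫ x in a..b, Q (r ε x / ε) / ε * ((1 + s ε x ^ 2) / 2) := by
    intro ε hε
    have := sum_abs_sub_le_integral hQ hQ0 hΘ (hrs ε hε).1 (hrs ε hε).2.1 hMs hε (n + 1)
    rwa [hM0, hMn] at this
  have hγpos : 0 < γ₀ := (hΘmem 0).1.trans (hΘmem 0).2
  have hvρ : ∀ᵐ x, x ∈ uIoc a b → (ρ x < 0 ∧ v x = α) ∨ (0 < ρ x ∧ v x = β) := by
    have hnull : ∀ᵐ x : ℝ, x ∉ range h :=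
      (measure_eq_zero_iff_ae_notMem.1 ((finite_range h).measure_zero volume))
    filter_upwards [hnull] with x hx hxab
    rw [uIoc_of_le hab.le] at hxab
    obtain ⟨j, hj, hxj⟩ := exists_mem_Icc_partition (M := M) (x := x) n
      (by rw [hM0, hMn]; exact Ioc_subset_Icc_self hxab)
    have hne : x ≠ H j := fun he => hx ⟨⟨j, by omega⟩, (hhH _).trans he.symm⟩
    have hρne : (-1) ^ j * (x - H j) ≠ 0 :=
      mul_ne_zero (pow_ne_zero _ (by norm_num)) (sub_ne_zero.2 hne)
    rw [hv, ite_even_eq_of_mem_Icc hM hMH hhH hj hxj hne, hρH j hj x hxj]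
    rcases hρne.lt_or_gt with hlt | hgt
    · exact .inl ⟨hlt, if_pos hlt⟩
    · exact .inr ⟨hgt, if_neg hgt.not_gt⟩
  refine ⟨fun ε x => φ (r ε x / ε), fun ε hε => ⟨fun x => (hU ε hε x).differentiableAt,
    fun x _ => hφ _⟩, ?_, ⟨1, one_pos, fun ε hε => ?_⟩, ?_⟩
  · refine tendsto_integral_layers hφ hφc hφtop hφbot hrc hrρ ?_ hvρ
    rw [funext hv]
    exact measurable_ite_even_card h α β
  · exact (henergy ε hε.1).trans_lt (hupper ε hε.1)
  · refine tendsto_of_tendsto_of_tendsto_of_le_of_le'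
      (tendsto_sum_abs_sub hγpos hΘtop hΘbot hMH hρH hrρ) tendsto_const_nhds ?_ ?_
    · filter_upwards [self_mem_nhdsWithin] with ε hε
      exact (hlower ε hε).trans_eq (henergy ε hε).symm
    · filter_upwards [self_mem_nhdsWithin] with ε hε
      exact ((henergy ε hε).trans_lt (hupper ε hε)).le
end

section
/- Assume the hypotheses of the sharp lower bound: $f,D\in C^2(I)$ with $D\geq d>0$, bistable balanced $f$, and the solution $u^\varepsilon$ of the Neumann problem for $u_t=\varepsilon^2(D(u)u_x)_x-f(u)$ with initial datum $u_0^\varepsilon$ taking values in a compact subinterval of $I$, satisfying $\|u_0^\varepsilon-v\|_{L^1}\to 0$ and $E_\varepsilon[u_0^\varepsilon]\leq N\gamma_0+Ce^{-A/\varepsilon}$ with $A\in(0,r\sqrt{2\lambda})$. Then there exist $\varepsilon_0,C_1,C_2>0$ such that for all $\varepsilon\in(0,\varepsilon_0)$, $\int_0^{C_1\varepsilon^{-1}\exp(A/\varepsilon)}\|u_t^\varepsilon(\cdot,t)\|_{L^2(a,b)}^2\,dt\leq C_2\,\varepsilon\,\exp(-A/\varepsilon)$. -/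
open MeasureTheory Set Filter

/-! ### Lower bounds for one-dimensional Modica-Mortola energies -/

/-- The profile `(1 - e^{-2s}) / (1 + e^{-2s}) = tanh s`. -/
noncomputable def tanhProfile (s : ℝ) : ℝ :=
  (1 - Real.exp (-2 * s)) / (1 + Real.exp (-2 * s))

lemma tanhProfile_zero : tanhProfile 0 = 0 := by simp [tanhProfile]

lemma hasDerivAt_tanhProfile (s : ℝ) :
    HasDerivAt tanhProfile (1 - tanhProfile s ^ 2) s := by
  have hpos : 0 < 1 + Real.exp (-2 * s) := by positivity
  have h1 : HasDerivAt (fun s : ℝ => Real.exp (-2 * s)) (Real.exp (-2 * s) * (-2)) s := by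
    simpa using ((hasDerivAt_id s).const_mul (-2)).exp
  have h2 := (h1.const_sub 1).div (h1.const_add 1) hpos.ne'
  refine h2.congr_deriv ?_
  unfold tanhProfile
  field_simp
  ring

lemma tanhProfile_mem_Icc {s : ℝ} (hs : 0 ≤ s) : tanhProfile s ∈ Icc (0 : ℝ) 1 := by
  have hpos : 0 < Real.exp (-2 * s) := Real.exp_pos _
  have hle : Real.exp (-2 * s) ≤ 1 := Real.exp_le_one_iff.2 (by linarith)
  unfold tanhProfile
  constructor
  · exact div_nonneg (by linarith) (by linarith)
  · rw [div_le_one (by linarith)]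
    linarith

lemma one_sub_tanhProfile_le (s : ℝ) : 1 - tanhProfile s ≤ 2 * Real.exp (-2 * s) := by
  have hpos : 0 < Real.exp (-2 * s) := Real.exp_pos _
  unfold tanhProfile
  rw [one_sub_div (by linarith), div_le_iff₀ (by linarith)]
  nlinarith

lemma sub_le_of_tanhProfile_mul_le {s y J : ℝ} (hs : 0 ≤ s) (h : tanhProfile s * y ≤ J) :
    y - 2 * Real.exp (-2 * s) * |y| ≤ J := by
  have h1 : (1 - tanhProfile s) * y ≤ (1 - tanhProfile s) * |y| :=
    mul_le_mul_of_nonneg_left (le_abs_self y) (by linarith [(tanhProfile_mem_Icc hs).2])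
  have h2 := mul_le_mul_of_nonneg_right (one_sub_tanhProfile_le s) (abs_nonneg y)
  linarith

/-- The energy to the right of a point `p` at which the distance of the solution to its well,
measured by `ψ`, is small. -/
lemma sub_exp_le_energy_right {p q k ε : ℝ} (hpq : p ≤ q) (hε : 0 < ε) (hk : 0 ≤ k)
    {ψ ψ' e : ℝ → ℝ} (hψ : ∀ x ∈ Icc p q, HasDerivAt ψ (ψ' x) x)
    (he : IntegrableOn e (Icc p q))
    (hcal : ∀ x ∈ Icc p q, ∀ θ ∈ Icc (0 : ℝ) 1,
      θ * |ψ' x| + k / ε * (1 - θ ^ 2) * ψ x ≤ e x) :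
    ψ p - 2 * Real.exp (-2 * (k * (q - p) / ε)) * |ψ p| ≤ ∫ x in p..q, e x := by
  have hsnn : ∀ x ∈ Icc p q, 0 ≤ k * (q - x) / ε := fun x hx =>
    div_nonneg (mul_nonneg hk (by linarith [hx.2])) hε.le
  apply sub_le_of_tanhProfile_mul_le (hsnn p ⟨le_rfl, hpq⟩)
  have hS : ∀ x ∈ Icc p q, HasDerivAt (fun x => -(tanhProfile (k * (q - x) / ε) * ψ x))
      (-((1 - tanhProfile (k * (q - x) / ε) ^ 2) * (-k / ε) * ψ x
        + tanhProfile (k * (q - x) / ε) * ψ' x)) x := by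
    intro x hx
    have h1 : HasDerivAt (fun x => k * (q - x) / ε) (-k / ε) x := by
      simpa using ((((hasDerivAt_id x).const_sub q).const_mul k).div_const ε)
    exact (((hasDerivAt_tanhProfile _).comp x h1).mul (hψ x hx)).neg
  have := intervalIntegral.sub_le_integral_of_hasDeriv_right_of_le hpq
    (fun x hx => (hS x hx).continuousAt.continuousWithinAt)
    (fun x hx => (hS x (Ioo_subset_Icc_self hx)).hasDerivWithinAt) he
    (fun x hx => ?_)
  · simpa [tanhProfile_zero] using this
  · have hx' := Ioo_subset_Icc_self hx
    have hθ := tanhProfile_mem_Icc (hsnn x hx')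
    refine le_trans ?_ (hcal x hx' _ hθ)
    have := mul_le_mul_of_nonneg_left (neg_abs_le (ψ' x)) hθ.1
    have h2 : -k / ε = -(k / ε) := by ring
    rw [h2]
    nlinarith

/-- The energy to the left of a point `q` at which the distance of the solution to its well,
measured by `ψ`, is small. -/
lemma sub_exp_le_energy_left {p q k ε : ℝ} (hpq : p ≤ q) (hε : 0 < ε) (hk : 0 ≤ k)
    {ψ ψ' e : ℝ → ℝ} (hψ : ∀ x ∈ Icc p q, HasDerivAt ψ (ψ' x) x)
    (he : IntegrableOn e (Icc p q))
    (hcal : ∀ x ∈ Icc p q, ∀ θ ∈ Icc (0 : ℝ) 1,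
      θ * |ψ' x| + k / ε * (1 - θ ^ 2) * ψ x ≤ e x) :
    ψ q - 2 * Real.exp (-2 * (k * (q - p) / ε)) * |ψ q| ≤ ∫ x in p..q, e x := by
  have hsnn : ∀ x ∈ Icc p q, 0 ≤ k * (x - p) / ε := fun x hx =>
    div_nonneg (mul_nonneg hk (by linarith [hx.1])) hε.le
  apply sub_le_of_tanhProfile_mul_le (hsnn q ⟨hpq, le_rfl⟩)
  have hS : ∀ x ∈ Icc p q, HasDerivAt (fun x => tanhProfile (k * (x - p) / ε) * ψ x)
      ((1 - tanhProfile (k * (x - p) / ε) ^ 2) * (k / ε) * ψ x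
        + tanhProfile (k * (x - p) / ε) * ψ' x) x := by
    intro x hx
    have h1 : HasDerivAt (fun x => k * (x - p) / ε) (k / ε) x := by
      simpa using ((((hasDerivAt_id x).sub_const p).const_mul k).div_const ε)
    exact (((hasDerivAt_tanhProfile _).comp x h1).mul (hψ x hx))
  have := intervalIntegral.sub_le_integral_of_hasDeriv_right_of_le hpq
    (fun x hx => (hS x hx).continuousAt.continuousWithinAt)
    (fun x hx => (hS x (Ioo_subset_Icc_self hx)).hasDerivWithinAt) he
    (fun x hx => ?_)
  · simpa [tanhProfile_zero] using this
  · have hx' := Ioo_subset_Icc_self hx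
    have hθ := tanhProfile_mem_Icc (hsnn x hx')
    refine le_trans ?_ (hcal x hx' _ hθ)
    have := mul_le_mul_of_nonneg_left (le_abs_self (ψ' x)) hθ.1
    nlinarith

/-- A function is bounded in variation by the integral of any majorant of its derivative. -/
lemma abs_sub_le_integral {p q : ℝ} (hpq : p ≤ q) {φ φ' e : ℝ → ℝ}
    (hφ : ∀ x ∈ Icc p q, HasDerivAt φ (φ' x) x) (he : IntegrableOn e (Icc p q))
    (hle : ∀ x ∈ Icc p q, |φ' x| ≤ e x) : |φ q - φ p| ≤ ∫ x in p..q, e x := by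
  have hc : ContinuousOn φ (Icc p q) := fun x hx => (hφ x hx).continuousAt.continuousWithinAt
  rw [abs_le']
  constructor
  · exact intervalIntegral.sub_le_integral_of_hasDeriv_right_of_le hpq hc
      (fun x hx => (hφ x (Ioo_subset_Icc_self hx)).hasDerivWithinAt) he
      (fun x hx => (le_abs_self _).trans (hle x (Ioo_subset_Icc_self hx)))
  · have := intervalIntegral.sub_le_integral_of_hasDeriv_right_of_le hpq hc.neg
      (fun x hx => (hφ x (Ioo_subset_Icc_self hx)).neg.hasDerivWithinAt) he
      (fun x hx => (neg_le_abs _).trans (hle x (Ioo_subset_Icc_self hx)))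
    simp only [Pi.neg_apply] at this
    linarith

/-- Sharp lower bound for the energy of a single transition from `0` to `γ` between
`c - r` and `c + r`. -/
lemma single_transition_energy_ge {c r ρ k ε γ σ τ η : ℝ} (hρ : 0 < ρ) (hρr : ρ < r)
    (hε : 0 < ε) (hk : 0 ≤ k) {φ φ' e g : ℝ → ℝ}
    (hφ : ∀ x ∈ Icc (c - r) (c + r), HasDerivAt φ (φ' x) x)
    (he : IntegrableOn e (Icc (c - r) (c + r)))
    (hyoung : ∀ x ∈ Icc (c - r) (c + r), ∀ θ ∈ Icc (0 : ℝ) 1,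
      θ * |φ' x| + (1 - θ ^ 2) * (g x / ε) ≤ e x)
    (hzero : ∀ x ∈ Icc (c - r) (c + r), φ x ≤ η → k * φ x ≤ g x)
    (htop : ∀ x ∈ Icc (c - r) (c + r), γ - η ≤ φ x → k * (γ - φ x) ≤ g x)
    {p p' : ℝ} (hp' : p' ∈ Icc (c - ρ) c) (hp : p ∈ Icc c (c + ρ))
    (hφp' : |φ p'| ≤ σ) (hφp : |φ p - γ| ≤ σ) (hη : 3 * σ + τ ≤ η)
    (hE : (∫ x in (c - r)..(c + r), e x) ≤ γ + τ) :
    γ - 4 * σ * Real.exp (-2 * (k * (r - ρ) / ε)) ≤ ∫ x in (c - r)..(c + r), e x := by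
  obtain ⟨hp'1, hp'2⟩ := hp'
  obtain ⟨hp1, hp2⟩ := hp
  have hsub : ∀ {s t : ℝ}, c - r ≤ s → t ≤ c + r → Icc s t ⊆ Icc (c - r) (c + r) :=
    fun h1 h2 => Icc_subset_Icc h1 h2
  have hle : ∀ x ∈ Icc (c - r) (c + r), |φ' x| ≤ e x := fun x hx => by
    simpa using hyoung x hx 1 (by simp)
  have hint : ∀ {s t : ℝ}, c - r ≤ s → s ≤ t → t ≤ c + r → IntervalIntegrable e volume s t :=
    fun h1 h2 h3 => by
      rw [intervalIntegrable_iff_integrableOn_Icc_of_le h2]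
      exact he.mono_set (hsub h1 h3)
  have hnn : ∀ {s t : ℝ}, c - r ≤ s → s ≤ t → t ≤ c + r → 0 ≤ ∫ x in s..t, e x :=
    fun h1 h2 h3 => intervalIntegral.integral_nonneg h2
      fun x hx => (abs_nonneg _).trans (hle x (hsub h1 h3 hx))
  have hvar : ∀ {s t : ℝ}, c - r ≤ s → s ≤ t → t ≤ c + r →
      |φ t - φ s| ≤ ∫ x in s..t, e x := fun h1 h2 h3 =>
    abs_sub_le_integral h2 (fun x hx => hφ x (hsub h1 h3 hx)) (he.mono_set (hsub h1 h3))
      (fun x hx => hle x (hsub h1 h3 hx))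
  have hsplit : ∀ {s t m : ℝ}, c - r ≤ s → s ≤ m → m ≤ t → t ≤ c + r →
      (∫ x in s..t, e x) = (∫ x in s..m, e x) + ∫ x in m..t, e x := fun h1 h2 h3 h4 =>
    (intervalIntegral.integral_add_adjacent_intervals (hint h1 h2 (h3.trans h4))
      (hint (h1.trans h2) h3 h4)).symm
  have hS1 := hsplit (s := c - r) (t := c + r) (m := p') le_rfl (by linarith) (by linarith) le_rfl
  have hS2 := hsplit (s := p') (t := c + r) (m := p) (by linarith) (by linarith) (by linarith)
    le_rfl
  have hcore := (le_abs_self _).trans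
    (hvar (s := p') (t := p) (by linarith) (by linarith) (by linarith))
  have hl0 := hnn (s := c - r) (t := p') le_rfl (by linarith) (by linarith)
  have hr0 := hnn (s := p) (t := c + r) (by linarith) (by linarith) le_rfl
  obtain ⟨a1, a2⟩ := abs_le.1 hφp'
  obtain ⟨b1, b2⟩ := abs_le.1 hφp
  -- the solution stays close to the wells away from the core `[p', p]`
  have hright : ∀ x ∈ Icc p (c + r), γ - η ≤ φ x := by
    intro x hx
    have h1 := hsplit (s := p) (t := c + r) (m := x) (by linarith) hx.1 hx.2 le_rfl
    have h2 := (neg_le_abs _).trans (hvar (s := p) (t := x) (by linarith) hx.1 hx.2)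
    have h3 := hnn (s := x) (t := c + r) (by linarith [hx.1]) hx.2 le_rfl
    linarith
  have hleft : ∀ x ∈ Icc (c - r) p', φ x ≤ η := by
    intro x hx
    have h1 := hsplit (s := c - r) (t := p') (m := x) le_rfl hx.1 hx.2 (by linarith)
    have h2 := (neg_le_abs _).trans (hvar (s := x) (t := p') hx.1 hx.2 (by linarith))
    have h3 := hnn (s := c - r) (t := x) le_rfl hx.1 (by linarith [hx.2])
    linarith
  have hR := sub_exp_le_energy_right (p := p) (q := c + r) (k := k) (ε := ε) (ψ := fun x => γ - φ x)
    (ψ' := fun x => -φ' x) (e := e) (by linarith) hε hk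
    (fun x hx => (hφ x (hsub (by linarith) le_rfl hx)).const_sub γ)
    (he.mono_set (hsub (by linarith) le_rfl)) (fun x hx θ hθ => by
      have hx' := hsub (s := p) (t := c + r) (by linarith) le_rfl hx
      refine le_trans ?_ (hyoung x hx' θ hθ)
      have h1 : 0 ≤ 1 - θ ^ 2 := by nlinarith [hθ.1, hθ.2]
      have h2 : k / ε * (γ - φ x) ≤ g x / ε := by
        rw [div_mul_eq_mul_div]
        exact div_le_div_of_nonneg_right (htop x hx' (hright x hx)) hε.le
      have := mul_le_mul_of_nonneg_left h2 h1
      rw [abs_neg]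
      nlinarith)
  have hL := sub_exp_le_energy_left (p := c - r) (q := p') (k := k) (ε := ε) (ψ := φ)
    (ψ' := φ') (e := e) (by linarith) hε hk
    (fun x hx => (hφ x (hsub le_rfl (by linarith) hx)))
    (he.mono_set (hsub le_rfl (by linarith))) (fun x hx θ hθ => by
      have hx' := hsub (s := c - r) (t := p') le_rfl (by linarith) hx
      refine le_trans ?_ (hyoung x hx' θ hθ)
      have h1 : 0 ≤ 1 - θ ^ 2 := by nlinarith [hθ.1, hθ.2]
      have h2 : k / ε * φ x ≤ g x / ε := by
        rw [div_mul_eq_mul_div]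
        exact div_le_div_of_nonneg_right (hzero x hx' (hleft x hx)) hε.le
      have := mul_le_mul_of_nonneg_left h2 h1
      nlinarith)
  have hexp : ∀ {l y : ℝ}, r - ρ ≤ l → |y| ≤ σ → 2 * Real.exp (-2 * (k * l / ε)) * |y|
      ≤ 2 * Real.exp (-2 * (k * (r - ρ) / ε)) * σ := by
    intro l y hl hy
    have : k * (r - ρ) / ε ≤ k * l / ε := by gcongr
    have h2 : Real.exp (-2 * (k * l / ε)) ≤ Real.exp (-2 * (k * (r - ρ) / ε)) :=
      Real.exp_le_exp.2 (by linarith)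
    exact mul_le_mul (by linarith) hy (abs_nonneg _) (by positivity)
  have hR' := hexp (l := c + r - p) (y := γ - φ p) (by linarith) (by rwa [abs_sub_comm])
  have hL' := hexp (l := p' - (c - r)) (y := φ p') (by linarith) hφp'
  linarith

/-! ### The potentials associated with a balanced bistable nonlinearity -/

lemma hasDerivAt_primitive {I : Set ℝ} (hI : IsOpen I) (hIc : I.OrdConnected) {q : ℝ → ℝ}
    (hq : ContinuousOn q I) {α s : ℝ} (hα : α ∈ I) (hs : s ∈ I) :
    HasDerivAt (fun s => ∫ z in α..s, q z) (q s) s :=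
  intervalIntegral.integral_hasDerivAt_right
    (hq.mono (hIc.uIcc_subset hα hs)).intervalIntegrable
    (hq.stronglyMeasurableAtFilter hI s hs) (hq.continuousAt (hI.mem_nhds hs))

/-- Near a nondegenerate well, located at `0`, the potential `Γ` controls the geodesic distance
`Λ` from the well. -/
lemma mul_geodesic_le_potential {F F' Δ Γ Λ : ℝ → ℝ} {τ κ : ℝ} (hκ : 0 ≤ κ)
    (hF : ∀ t ∈ Icc 0 τ, HasDerivAt F (F' t) t)
    (hΓ : ∀ t ∈ Icc 0 τ, HasDerivAt Γ (F t * Δ t) t)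
    (hΛ : ∀ t ∈ Icc 0 τ, HasDerivAt Λ (Real.sqrt (2 * Γ t) * Δ t) t)
    (hF0 : F 0 = 0) (hΓ0 : Γ 0 = 0) (hΛ0 : Λ 0 = 0)
    (hF' : ∀ t ∈ Icc 0 τ, 0 ≤ F' t) (hΔ : ∀ t ∈ Icc 0 τ, 0 ≤ Δ t)
    (hΔF' : ∀ t ∈ Icc 0 τ, 2 * κ ^ 2 * Δ t ≤ 2 * F' t) :
    ∀ t ∈ Icc 0 τ, κ * Λ t ≤ Γ t := by
  have mono : ∀ {H H' : ℝ → ℝ}, (∀ t ∈ Icc 0 τ, HasDerivAt H (H' t) t) →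
      (∀ t ∈ Icc 0 τ, 0 ≤ H' t) → H 0 = 0 → ∀ t ∈ Icc 0 τ, 0 ≤ H t := by
    intro H H' hH hH' h0 t ht
    have hm : MonotoneOn H (Icc 0 τ) := monotoneOn_of_hasDerivWithinAt_nonneg (convex_Icc _ _)
      (fun t ht => (hH t ht).continuousAt.continuousWithinAt)
      (fun t ht => (hH t (interior_subset ht)).hasDerivWithinAt)
      (fun t ht => hH' t (interior_subset ht))
    rw [← h0]
    exact hm ⟨le_rfl, ht.1.trans ht.2⟩ ht ht.1
  have h1 := mono hF hF' hF0
  have h2 : ∀ t ∈ Icc 0 τ, 0 ≤ F t ^ 2 - 2 * κ ^ 2 * Γ t := by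
    refine mono (H' := fun t => F t * (2 * F' t - 2 * κ ^ 2 * Δ t)) (fun t ht => ?_)
      (fun t ht => mul_nonneg (h1 t ht) (by linarith [hΔF' t ht])) (by simp [hF0, hΓ0])
    refine (((hF t ht).pow 2).sub ((hΓ t ht).const_mul (2 * κ ^ 2))).congr_deriv ?_
    simp only [Nat.cast_ofNat, Nat.add_one_sub_one, pow_one]
    ring
  have h3 : ∀ t ∈ Icc 0 τ, κ * Real.sqrt (2 * Γ t) ≤ F t := by
    intro t ht
    rw [← Real.sqrt_sq hκ, ← Real.sqrt_mul (sq_nonneg κ)]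
    exact (Real.sqrt_le_left (h1 t ht)).2 (by linarith [h2 t ht])
  intro t ht
  have h4 := mono (H := fun t => Γ t - κ * Λ t) (fun t ht => (hΓ t ht).sub ((hΛ t ht).const_mul κ))
    (fun t ht => by nlinarith [h3 t ht, hΔ t ht, mul_le_mul_of_nonneg_right (h3 t ht) (hΔ t ht)])
    (by simp [hΓ0, hΛ0]) t ht
  linarith

/-- `P` and `Q` are primitives of the parts of the weight `√(2G) D` supported in `[α, β]` and
outside of `[α, β]` respectively; near the wells `P` is controlled by `G`, and small values
of `|Q|` confine the argument to `[k₁, k₂] ⊆ I`. -/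
structure IsWellPotential (I : Set ℝ) (D G : ℝ → ℝ) (α β γ κ η ξ k₁ k₂ : ℝ)
    (P Q p q : ℝ → ℝ) : Prop where
  G_nonneg : ∀ s ∈ I, 0 ≤ G s
  hasDerivAt_P : ∀ s ∈ I, HasDerivAt P (p s) s
  hasDerivAt_Q : ∀ s ∈ I, HasDerivAt Q (q s) s
  continuousOn_p : ContinuousOn p I
  continuousOn_q : ContinuousOn q I
  p_nonneg : ∀ s ∈ I, 0 ≤ p s
  q_nonneg : ∀ s ∈ I, 0 ≤ q s
  p_add_q : ∀ s ∈ I, p s + q s = Real.sqrt (2 * G s) * D s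
  P_left : P α = 0
  P_right : P β = γ
  Q_left : Q α = 0
  Q_right : Q β = 0
  η_pos : 0 < η
  ξ_pos : 0 < ξ
  mul_P_le : ∀ s ∈ I, P s ≤ η → κ * P s ≤ G s
  mul_sub_P_le : ∀ s ∈ I, γ - η ≤ P s → κ * (γ - P s) ≤ G s
  Icc_subset : Icc k₁ k₂ ⊆ I
  mem_Icc : ∀ s ∈ I, |Q s| ≤ ξ → s ∈ Icc k₁ k₂

lemma exists_isWellPotential
    {I : Set ℝ} (hIopen : IsOpen I) (hIconn : I.OrdConnected)
    {D f G : ℝ → ℝ} {α β κ : ℝ} (hαβ : α < β) (hsub : Icc α β ⊆ I)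
    (hD : ContinuousOn D I) (hDpos : ∀ s ∈ I, 0 < D s)
    (hf : DifferentiableOn ℝ f I) (hf' : ContinuousOn (deriv f) I)
    (hfα : f α = 0) (hfβ : f β = 0) (hf'α : 0 < deriv f α) (hf'β : 0 < deriv f β)
    (hGd : ∀ s ∈ I, HasDerivAt G (f s * D s) s) (hGα : G α = 0) (hGβ : G β = 0)
    (hGpos : ∀ s ∈ I, s ≠ α → s ≠ β → 0 < G s)
    (hκ : 0 ≤ κ) (hκα : 2 * κ ^ 2 * D α ≤ deriv f α) (hκβ : 2 * κ ^ 2 * D β ≤ deriv f β) :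
    ∃ η ξ k₁ k₂ P Q p q,
      IsWellPotential I D G α β (∫ s in α..β, Real.sqrt (2 * G s) * D s) κ η ξ k₁ k₂ P Q p q := by
  have hαI : α ∈ I := hsub ⟨le_rfl, hαβ.le⟩
  have hβI : β ∈ I := hsub ⟨hαβ.le, le_rfl⟩
  have hGnn : ∀ s ∈ I, 0 ≤ G s := fun s hs => by
    rcases eq_or_ne s α with rfl | h1
    · exact hGα.ge
    rcases eq_or_ne s β with rfl | h2
    · exact hGβ.ge
    exact (hGpos s hs h1 h2).le
  have hGc : ContinuousOn G I := fun s hs => (hGd s hs).continuousAt.continuousWithinAt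
  set g : ℝ → ℝ := fun s => Real.sqrt (2 * G s) * D s with hg
  have hgc : ContinuousOn g I := ((continuousOn_const.mul hGc).sqrt).mul hD
  have hgnn : ∀ s ∈ I, 0 ≤ g s := fun s hs => mul_nonneg (Real.sqrt_nonneg _) (hDpos s hs).le
  have hgpos : ∀ s ∈ I, s ≠ α → s ≠ β → 0 < g s := fun s hs h1 h2 =>
    mul_pos (Real.sqrt_pos.2 (by linarith [hGpos s hs h1 h2])) (hDpos s hs)
  have hgα : g α = 0 := by simp [hg, hGα]
  have hgβ : g β = 0 := by simp [hg, hGβ]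
  set p : ℝ → ℝ := fun s => g (max α (min β s)) with hp
  have hclamp : ∀ s, max α (min β s) ∈ Icc α β := fun s =>
    ⟨le_max_left _ _, max_le hαβ.le (min_le_left _ _)⟩
  have hpc : Continuous p := hgc.comp_continuous (by fun_prop) (fun s => hsub (hclamp s))
  have hpin : ∀ s ∈ Icc α β, p s = g s := fun s hs => by
    simp only [hp]
    rw [min_eq_right hs.2, max_eq_right hs.1]
  have hplt : ∀ s, s ≤ α → p s = 0 := fun s hs => by
    simp only [hp]
    rw [max_eq_left ((min_le_right _ _).trans hs), hgα]
  have hpgt : ∀ s, β ≤ s → p s = 0 := fun s hs => by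
    simp only [hp]
    rw [min_eq_left hs, max_eq_right hαβ.le, hgβ]
  have hpnn : ∀ s, 0 ≤ p s := fun s => hgnn _ (hsub (hclamp s))
  set q : ℝ → ℝ := fun s => g s - p s with hq
  have hqc : ContinuousOn q I := hgc.sub hpc.continuousOn
  have hqin : ∀ s ∈ Icc α β, q s = 0 := fun s hs => by simp [hq, hpin s hs]
  have hqlt : ∀ s, s ≤ α → q s = g s := fun s hs => by simp [hq, hplt s hs]
  have hqgt : ∀ s, β ≤ s → q s = g s := fun s hs => by simp [hq, hpgt s hs]
  have hqnn : ∀ s ∈ I, 0 ≤ q s := fun s hs => by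
    rcases le_total s α with h1 | h1
    · exact (hqlt s h1).symm ▸ hgnn s hs
    rcases le_total β s with h2 | h2
    · exact (hqgt s h2).symm ▸ hgnn s hs
    · exact (hqin s ⟨h1, h2⟩).ge
  set P : ℝ → ℝ := fun s => ∫ z in α..s, p z with hP
  set Q : ℝ → ℝ := fun s => ∫ z in α..s, q z with hQ
  have hPd : ∀ s, HasDerivAt P (p s) s := fun s =>
    hasDerivAt_primitive isOpen_univ ordConnected_univ hpc.continuousOn (mem_univ _) (mem_univ _)
  have hQd : ∀ s ∈ I, HasDerivAt Q (q s) s := fun s hs =>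
    hasDerivAt_primitive hIopen hIconn hqc hαI hs
  have hPα : P α = 0 := by simp [hP]
  have hQα : Q α = 0 := by simp [hQ]
  have hPβ : P β = ∫ s in α..β, g s := intervalIntegral.integral_congr fun s hs => by
    rw [uIcc_of_le hαβ.le] at hs
    exact hpin s hs
  have hQβ : Q β = 0 := by
    rw [show Q β = ∫ s in α..β, (0 : ℝ) from intervalIntegral.integral_congr fun s hs => by
      rw [uIcc_of_le hαβ.le] at hs
      exact hqin s hs]
    simp
  have hPmono : Monotone P := monotone_of_hasDerivAt_nonneg hPd hpnn
  have hQmono : MonotoneOn Q I := monotoneOn_of_hasDerivWithinAt_nonneg hIconn.convex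
    (fun s hs => (hQd s hs).continuousAt.continuousWithinAt)
    (fun s hs => (hQd s (interior_subset hs)).hasDerivWithinAt)
    (fun s hs => hqnn s (interior_subset hs))
  have hPstrict : StrictMonoOn P (Icc α β) := strictMonoOn_of_deriv_pos (convex_Icc _ _)
    (fun s _ => (hPd s).continuousAt.continuousWithinAt) fun s hs => by
      rw [interior_Icc] at hs
      rw [(hPd s).deriv, hpin s (Ioo_subset_Icc_self hs)]
      exact hgpos s (hsub (Ioo_subset_Icc_self hs)) hs.1.ne' hs.2.ne
  have hnear : ∀ z ∈ I, 0 < deriv f z → 2 * κ ^ 2 * D z ≤ deriv f z → ∃ τ > 0, τ < β - α ∧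
      ∀ s, |s - z| ≤ τ → s ∈ I ∧ 0 ≤ deriv f s ∧ 2 * κ ^ 2 * D s ≤ 2 * deriv f s := by
    intro z hz hz1 hz2
    have c1 : ContinuousAt (deriv f) z := hf'.continuousAt (hIopen.mem_nhds hz)
    have c2 : ContinuousAt (fun s => 2 * deriv f s - 2 * κ ^ 2 * D s) z :=
      (c1.const_mul 2).sub ((hD.continuousAt (hIopen.mem_nhds hz)).const_mul _)
    have e2 := c2.eventually_const_lt (show 0 < 2 * deriv f z - 2 * κ ^ 2 * D z by linarith)
    obtain ⟨τ, hτ, hball⟩ := Metric.eventually_nhds_iff.1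
      ((hIopen.eventually_mem hz).and ((c1.eventually_const_lt hz1).and e2))
    refine ⟨min τ (β - α) / 2, by have := lt_min hτ (sub_pos.2 hαβ); linarith, ?_, fun s hs => ?_⟩
    · have := min_le_right τ (β - α)
      linarith
    · have h1 : dist s z < τ := by
        rw [Real.dist_eq]
        have h2 := min_le_left τ (β - α)
        linarith
      obtain ⟨h3, h4, h5⟩ := hball h1
      exact ⟨h3, h4.le, by linarith⟩
  have hfd : ∀ s ∈ I, HasDerivAt f (deriv f s) s := fun s hs =>
    (hf.differentiableAt (hIopen.mem_nhds hs)).hasDerivAt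
  obtain ⟨τ₁, hτ₁, hτ₁', hn₁⟩ := hnear α hαI hf'α hκα
  obtain ⟨τ₂, hτ₂, hτ₂', hn₂⟩ := hnear β hβI hf'β hκβ
  have hwellα : ∀ t ∈ Icc 0 τ₁, κ * P (α + t) ≤ G (α + t) := by
    have key : ∀ t ∈ Icc 0 τ₁, |α + t - α| ≤ τ₁ := fun t ht => by
      rw [add_sub_cancel_left, abs_of_nonneg ht.1]
      exact ht.2
    refine mul_geodesic_le_potential (F := fun t => f (α + t)) (F' := fun t => deriv f (α + t))
      (Δ := fun t => D (α + t)) hκ (fun t ht => ?_) (fun t ht => ?_) (fun t ht => ?_)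
      (by simp [hfα]) (by simp [hGα]) (by simp [hPα]) (fun t ht => (hn₁ _ (key t ht)).2.1)
      (fun t ht => (hDpos _ (hn₁ _ (key t ht)).1).le) (fun t ht => (hn₁ _ (key t ht)).2.2)
    · exact (hfd _ (hn₁ _ (key t ht)).1).comp_const_add α t
    · exact (hGd _ (hn₁ _ (key t ht)).1).comp_const_add α t
    · refine ((hPd (α + t)).comp_const_add α t).congr_deriv (hpin _ ⟨?_, ?_⟩)
      · linarith [ht.1]
      · linarith [ht.2]
  have hwellβ : ∀ t ∈ Icc 0 τ₂, κ * (P β - P (β - t)) ≤ G (β - t) := by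
    have key : ∀ t ∈ Icc 0 τ₂, |β - t - β| ≤ τ₂ := fun t ht => by
      rw [sub_sub_cancel_left, abs_neg, abs_of_nonneg ht.1]
      exact ht.2
    refine mul_geodesic_le_potential (F := fun t => -f (β - t)) (F' := fun t => deriv f (β - t))
      (Δ := fun t => D (β - t)) (Γ := fun t => G (β - t)) (Λ := fun t => P β - P (β - t))
      hκ (fun t ht => ?_) (fun t ht => ?_) (fun t ht => ?_)
      (by simp [hfβ]) (by simp [hGβ]) (by simp) (fun t ht => (hn₂ _ (key t ht)).2.1)
      (fun t ht => (hDpos _ (hn₂ _ (key t ht)).1).le) (fun t ht => (hn₂ _ (key t ht)).2.2)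
    · exact ((hfd _ (hn₂ _ (key t ht)).1).comp_const_sub β t).fun_neg.congr_deriv (neg_neg _)
    · simpa using ((hGd _ (hn₂ _ (key t ht)).1).comp_const_sub β t)
    · refine (((hPd (β - t)).comp_const_sub β t).const_sub (P β)).congr_deriv ?_
      rw [neg_neg]
      refine hpin _ ⟨?_, ?_⟩
      · linarith [ht.2]
      · linarith [ht.1]
  -- the interval `[k₁, k₂]`
  obtain ⟨θ₁, hθ₁, hball₁⟩ := Metric.isOpen_iff.1 hIopen α hαI
  obtain ⟨θ₂, hθ₂, hball₂⟩ := Metric.isOpen_iff.1 hIopen β hβI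
  have hk₁ : α - θ₁ / 2 ∈ I := hball₁ (by
    rw [Metric.mem_ball, Real.dist_eq, sub_sub_cancel_left, abs_neg, abs_of_pos] <;> linarith)
  have hk₂ : β + θ₂ / 2 ∈ I := hball₂ (by
    rw [Metric.mem_ball, Real.dist_eq, add_sub_cancel_left, abs_of_pos] <;> linarith)
  have hQk₁ : Q (α - θ₁ / 2) < 0 := by
    rw [← hQα]
    have hss : Icc (α - θ₁ / 2) α ⊆ I := hIconn.out hk₁ hαI
    refine strictMonoOn_of_deriv_pos (convex_Icc (α - θ₁ / 2) α)
      (fun s hs => (hQd s (hss hs)).continuousAt.continuousWithinAt) (fun s hs => ?_)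
      ⟨le_rfl, by linarith⟩ ⟨by linarith, le_rfl⟩ (by linarith)
    rw [interior_Icc] at hs
    have hsI := hss (Ioo_subset_Icc_self hs)
    rw [(hQd s hsI).deriv, hqlt s hs.2.le]
    exact hgpos s hsI hs.2.ne (hs.2.trans hαβ).ne
  have hQk₂ : 0 < Q (β + θ₂ / 2) := by
    rw [← hQβ]
    have hss : Icc β (β + θ₂ / 2) ⊆ I := hIconn.out hβI hk₂
    refine strictMonoOn_of_deriv_pos (convex_Icc β (β + θ₂ / 2))
      (fun s hs => (hQd s (hss hs)).continuousAt.continuousWithinAt) (fun s hs => ?_)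
      ⟨le_rfl, by linarith⟩ ⟨by linarith, le_rfl⟩ (by linarith)
    rw [interior_Icc] at hs
    have hsI := hss (Ioo_subset_Icc_self hs)
    rw [(hQd s hsI).deriv, hqgt s hs.1.le]
    exact hgpos s hsI (hαβ.trans hs.1).ne' hs.1.ne'
  have hη₁ : 0 < P (α + τ₁) := by
    rw [← hPα]
    exact hPstrict ⟨le_rfl, hαβ.le⟩ ⟨by linarith, by linarith⟩ (by linarith)
  have hη₂ : P (β - τ₂) < P β :=
    hPstrict ⟨by linarith, by linarith⟩ ⟨hαβ.le, le_rfl⟩ (by linarith)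
  rw [← hPβ]
  refine ⟨min (P (α + τ₁)) (P β - P (β - τ₂)) / 2, min (-Q (α - θ₁ / 2)) (Q (β + θ₂ / 2)) / 2,
    α - θ₁ / 2, β + θ₂ / 2, P, Q, p, q,
    { G_nonneg := hGnn
      hasDerivAt_P := fun s _ => hPd s
      hasDerivAt_Q := hQd
      continuousOn_p := hpc.continuousOn
      continuousOn_q := hqc
      p_nonneg := fun s _ => hpnn s
      q_nonneg := hqnn
      p_add_q := fun s _ => by simp [hq, hg]
      P_left := hPα
      P_right := rfl
      Q_left := hQα
      Q_right := hQβ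
      η_pos := half_pos (lt_min hη₁ (by linarith))
      ξ_pos := half_pos (lt_min (by linarith) hQk₂)
      mul_P_le := fun s hs hle => ?_
      mul_sub_P_le := fun s hs hle => ?_
      Icc_subset := hIconn.out hk₁ hk₂
      mem_Icc := fun s hs hle => ?_ }⟩
  · rcases le_total s α with h1 | h1
    · have := hPmono h1
      rw [hPα] at this
      exact (mul_nonpos_of_nonneg_of_nonpos hκ this).trans (hGnn s hs)
    · have hlt : P s < P (α + τ₁) := by
        have := min_le_left (P (α + τ₁)) (P β - P (β - τ₂))
        linarith
      have := hPmono.reflect_lt hlt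
      simpa using hwellα (s - α) ⟨by linarith, by linarith⟩
  · rcases le_total β s with h1 | h1
    · have := hPmono h1
      exact (mul_nonpos_of_nonneg_of_nonpos hκ (by linarith)).trans (hGnn s hs)
    · have hlt : P (β - τ₂) < P s := by
        have := min_le_right (P (α + τ₁)) (P β - P (β - τ₂))
        linarith
      have := hPmono.reflect_lt hlt
      simpa using hwellβ (β - s) ⟨by linarith, by linarith⟩
  · obtain ⟨h1, h2⟩ := abs_le.1 hle
    have h3 := min_le_left (-Q (α - θ₁ / 2)) (Q (β + θ₂ / 2))
    have h4 := min_le_right (-Q (α - θ₁ / 2)) (Q (β + θ₂ / 2))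
    constructor
    · by_contra! hlt
      linarith [hQmono hs hk₁ hlt.le]
    · by_contra! hlt
      linarith [hQmono hk₂ hs hlt.le]

/-! ### The sharp lower bound for functions close to a step function -/

lemma young_energy {θ g m ε : ℝ} (hg : 0 ≤ g) (hε : 0 < ε) :
    θ * (Real.sqrt (2 * g) * |m|) + (1 - θ ^ 2) * (g / ε) ≤ ε / 2 * m ^ 2 + g / ε := by
  have h1 : Real.sqrt (2 * g) ^ 2 = 2 * g := Real.sq_sqrt (by linarith)
  have h2 : 0 ≤ (ε * |m| - θ * Real.sqrt (2 * g)) ^ 2 / (2 * ε) := by positivity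
  have h3 : (ε * |m| - θ * Real.sqrt (2 * g)) ^ 2 / (2 * ε)
      = ε / 2 * m ^ 2 - θ * (Real.sqrt (2 * g) * |m|) + θ ^ 2 * (g / ε) := by
    rw [← sq_abs m]
    have h4 : (ε * |m| - θ * Real.sqrt (2 * g)) ^ 2 =
        ε ^ 2 * |m| ^ 2 - 2 * ε * θ * (Real.sqrt (2 * g) * |m|) + θ ^ 2 * (2 * g) := by
      linear_combination θ ^ 2 * h1
    rw [h4]
    field_simp
  linarith

lemma sum_integral_le {a b r : ℝ} (hab : a ≤ b) (hr : 0 ≤ r) {N : ℕ} {h : Fin N → ℝ}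
    (hsep : ∀ i j : Fin N, i < j → h i + r < h j - r)
    (hha : ∀ i, a ≤ h i - r) (hhb : ∀ i, h i + r ≤ b) {e : ℝ → ℝ}
    (he : IntegrableOn e (Icc a b)) (hnn : ∀ x ∈ Icc a b, 0 ≤ e x) :
    ∑ i, ∫ x in (h i - r)..(h i + r), e x ≤ ∫ x in a..b, e x := by
  have hsub : (⋃ i, Ioc (h i - r) (h i + r)) ⊆ Ioc a b :=
    iUnion_subset fun i => Ioc_subset_Ioc (hha i) (hhb i)
  have he' : IntegrableOn e (Ioc a b) := he.mono_set Ioc_subset_Icc_self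
  have hdisj : Pairwise (Function.onFun Disjoint fun i => Ioc (h i - r) (h i + r)) := by
    intro i j hij
    rw [Function.onFun, Set.disjoint_left]
    rintro x ⟨hx1, hx2⟩ ⟨hx3, hx4⟩
    rcases lt_or_gt_of_ne hij with hlt | hlt
    · linarith [hsep i j hlt]
    · linarith [hsep j i hlt]
  calc ∑ i, ∫ x in (h i - r)..(h i + r), e x
      = ∑ i, ∫ x in Ioc (h i - r) (h i + r), e x := Finset.sum_congr rfl fun i _ =>
        intervalIntegral.integral_of_le (by linarith)
    _ = ∫ x in ⋃ i, Ioc (h i - r) (h i + r), e x :=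
        (integral_iUnion_fintype (fun i => measurableSet_Ioc) hdisj
          (fun i => he'.mono_set (Ioc_subset_Ioc (hha i) (hhb i)))).symm
    _ ≤ ∫ x in Ioc a b, e x := setIntegral_mono_set he'
        ((ae_restrict_iff' measurableSet_Ioc).2 (ae_of_all _ fun x hx =>
          hnn x (Ioc_subset_Icc_self hx))) (ae_of_all _ hsub)
    _ = ∫ x in a..b, e x := (intervalIntegral.integral_of_le hab).symm

lemma integral_le_of_subinterval {a b c d : ℝ} (hac : a ≤ c) (hcd : c ≤ d) (hdb : d ≤ b)
    {e : ℝ → ℝ} (he : IntervalIntegrable e volume a b) (hnn : ∀ x ∈ Icc a b, 0 ≤ e x) :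
    ∫ x in c..d, e x ≤ ∫ x in a..b, e x :=
  intervalIntegral.integral_mono_interval hac hcd hdb
    ((ae_restrict_iff' measurableSet_Ioc).2 (ae_of_all _ fun x hx =>
          hnn x (Ioc_subset_Icc_self hx))) he

lemma exists_mem_Ioo_le {a b c d δ ω : ℝ} (hac : a ≤ c) (hcd : c < d) (hdb : d ≤ b) {F : ℝ → ℝ}
    (hF : IntervalIntegrable F volume a b) (hnn : ∀ x ∈ Icc a b, 0 ≤ F x)
    (hδ : ∫ x in a..b, F x ≤ δ) (hω : δ < ω * (d - c)) : ∃ x ∈ Ioo c d, F x ≤ ω := by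
  by_contra! hcon
  have h1 := integral_le_of_subinterval hac hcd.le hdb hF hnn
  have hF' : IntervalIntegrable F volume c d := hF.mono_set (by
    rw [uIcc_of_le hcd.le, uIcc_of_le (hac.trans (hcd.le.trans hdb))]
    exact Icc_subset_Icc hac hdb)
  have h2 : ∫ x in c..d, ω ≤ ∫ x in c..d, F x :=
    intervalIntegral.integral_mono_on_of_le_Ioo hcd.le (by simp) hF' fun x hx => (hcon x hx).le
  rw [intervalIntegral.integral_const, smul_eq_mul] at h2
  linarith

lemma intervalIntegrable_of_step {a b α β : ℝ} (hab : a ≤ b) {N : ℕ} {h : Fin N → ℝ} {v : ℝ → ℝ}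
    (hvval : ∀ x ∈ Icc a b, v x = α ∨ v x = β)
    (hvconst : ∀ x ∈ Icc a b, ∀ y ∈ Icc a b, x ≤ y →
      (∀ i, ¬(x ≤ h i ∧ h i ≤ y)) → v x = v y) :
    IntervalIntegrable v volume a b := by
  have hopen : IsOpen (Ioo a b ∩ (range h)ᶜ) :=
    isOpen_Ioo.inter (finite_range h).isClosed.isOpen_compl
  have hcont : ContinuousOn v (Ioo a b ∩ (range h)ᶜ) := by
    intro x hx
    obtain ⟨τ, hτ, hball⟩ := Metric.isOpen_iff.1 hopen x hx
    have hloc : ∀ y ∈ Metric.ball x τ, v y = v x := by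
      intro y hy
      have hseg : ∀ z ∈ uIcc y x, z ∈ Ioo a b ∩ (range h)ᶜ := fun z hz => hball
        ((convex_ball x τ).ordConnected.uIcc_subset hy (Metric.mem_ball_self hτ) hz)
      have hyI := Ioo_subset_Icc_self (hseg y left_mem_uIcc).1
      have hxI := Ioo_subset_Icc_self hx.1
      rcases le_total y x with hle | hle
      · exact hvconst y hyI x hxI hle fun i hi =>
          (hseg (h i) (by rwa [uIcc_of_le hle])).2 (mem_range_self i)
      · exact (hvconst x hxI y hyI hle fun i hi =>
          (hseg (h i) (by rwa [uIcc_of_ge hle])).2 (mem_range_self i)).symm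
    have : v =ᶠ[nhds x] fun _ => v x :=
      Filter.eventually_of_mem (Metric.ball_mem_nhds x hτ) hloc
    exact (continuousAt_const.congr this.symm).continuousWithinAt
  have hmeas : AEStronglyMeasurable v (volume.restrict (Ioc a b)) := by
    have h1 := hcont.aestronglyMeasurable (μ := volume) hopen.measurableSet
    have h2 : (Ioo a b ∩ (range h)ᶜ : Set ℝ) =ᵐ[volume] Ioc a b := by
      refine Filter.EventuallyEq.trans ?_ Ioo_ae_eq_Ioc
      refine inter_ae_eq_left_of_ae_eq_univ ?_
      rw [ae_eq_univ, compl_compl]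
      exact (finite_range h).measure_zero _
    rwa [Measure.restrict_congr_set h2] at h1
  rw [intervalIntegrable_iff_integrableOn_Ioc_of_le hab]
  refine Integrable.of_bound hmeas (max |α| |β|) ?_
  refine (ae_restrict_iff' measurableSet_Ioc).2 (ae_of_all _ fun x hx => ?_)
  rcases hvval x (Ioc_subset_Icc_self hx) with h1 | h1 <;> rw [h1, Real.norm_eq_abs]
  · exact le_max_left _ _
  · exact le_max_right _ _

/-- Functions which are `L¹`-close to a step function with `N` jumps and whose energy is almost
minimal have, up to an exponentially small error, at least the energy of `N` transitions, and
take values in `[k₁, k₂]`. -/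
lemma exists_energy_lower_bound {I : Set ℝ} {D G : ℝ → ℝ} {α β γ κ η ξ k₁ k₂ : ℝ}
    {P Q p q : ℝ → ℝ} (hW : IsWellPotential I D G α β γ κ η ξ k₁ k₂ P Q p q) (hκ : 0 ≤ κ)
    (hD : ContinuousOn D I) (hDnn : ∀ s ∈ I, 0 ≤ D s) (hG : ContinuousOn G I)
    (hαI : α ∈ I) (hβI : β ∈ I)
    {a b r ρ : ℝ} (hab : a < b) (hρ : 0 < ρ) (hρr : ρ < r) {N : ℕ} {h : Fin N → ℝ}
    (hsep : ∀ i j : Fin N, i < j → h i + r < h j - r)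
    (hha : ∀ i, a ≤ h i - r) (hhb : ∀ i, h i + r ≤ b) {v : ℝ → ℝ}
    (hvval : ∀ x ∈ Icc a b, v x = α ∨ v x = β)
    (hvconst : ∀ x ∈ Icc a b, ∀ y ∈ Icc a b, x ≤ y →
      (∀ i, ¬(x ≤ h i ∧ h i ≤ y)) → v x = v y)
    (hvjump : ∀ i, v (h i - r) ≠ v (h i + r))
    {A C₀ : ℝ} (hA : 0 < A) (hκA : 2 * (κ * (r - ρ)) = A) :
    ∃ δ > 0, ∃ C > 0, ∃ ε₁ > 0, ∀ ε ∈ Ioo (0 : ℝ) ε₁, ∀ y y' : ℝ → ℝ,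
      (∀ x ∈ Icc a b, HasDerivAt y (y' x) x) → ContinuousOn y' (Icc a b) →
      (∀ x ∈ Icc a b, y x ∈ I) → (∫ x in a..b, |y x - v x|) ≤ δ →
      (∫ x in a..b, (ε / 2 * (D (y x) * y' x) ^ 2 + G (y x) / ε))
        ≤ N * γ + C₀ * Real.exp (-A / ε) →
      N * γ - C * Real.exp (-A / ε)
        ≤ (∫ x in a..b, (ε / 2 * (D (y x) * y' x) ^ 2 + G (y x) / ε)) ∧
      ∀ x ∈ Icc a b, y x ∈ Icc k₁ k₂ := by
  have hr : 0 < r := hρ.trans hρr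
  obtain ⟨σ, hσ, hση, hσξ⟩ : ∃ σ > 0, (2 * N + 4) * σ ≤ η ∧ (2 * N + 4) * σ ≤ ξ := by
    have h4 : (0 : ℝ) < 2 * N + 4 := by positivity
    refine ⟨min η ξ / (2 * N + 4), div_pos (lt_min hW.η_pos hW.ξ_pos) h4, ?_, ?_⟩ <;>
      rw [mul_div_cancel₀ _ h4.ne']
    exacts [min_le_left _ _, min_le_right _ _]
  obtain ⟨ω, hω, hωα, hωβ⟩ : ∃ ω > 0, (∀ s, |s - α| ≤ ω → |P s| ≤ σ ∧ |Q s| ≤ σ) ∧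
      ∀ s, |s - β| ≤ ω → |P s - γ| ≤ σ ∧ |Q s| ≤ σ := by
    have key : ∀ {H : ℝ → ℝ} {z : ℝ}, ContinuousAt H z →
        ∀ᶠ ω in nhdsWithin 0 (Ioi 0), ∀ s, |s - z| ≤ ω → |H s - H z| ≤ σ := by
      intro H z hH
      obtain ⟨τ, hτ, hball⟩ := Metric.continuousAt_iff.1 hH σ hσ
      filter_upwards [Ioo_mem_nhdsGT hτ] with ω hω s hs
      exact (hball (lt_of_le_of_lt hs hω.2)).le
    have e1 := key (hW.hasDerivAt_P α hαI).continuousAt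
    have e2 := key (hW.hasDerivAt_Q α hαI).continuousAt
    have e3 := key (hW.hasDerivAt_P β hβI).continuousAt
    have e4 := key (hW.hasDerivAt_Q β hβI).continuousAt
    rw [hW.P_left] at e1
    rw [hW.Q_left] at e2
    rw [hW.P_right] at e3
    rw [hW.Q_right] at e4
    simp only [sub_zero] at e1 e2 e4
    have e0 : ∀ᶠ ω : ℝ in nhdsWithin 0 (Ioi 0), 0 < ω := self_mem_nhdsWithin
    obtain ⟨ω, hω, h1, h2, h3, h4⟩ := (e0.and (e1.and (e2.and (e3.and e4)))).exists
    exact ⟨ω, hω, fun s hs => ⟨h1 s hs, h2 s hs⟩, fun s hs => ⟨h3 s hs, h4 s hs⟩⟩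
  obtain ⟨ε₁, hε₁, hexp⟩ : ∃ ε₁ > 0, ∀ ε ∈ Ioo (0 : ℝ) ε₁, C₀ * Real.exp (-A / ε) ≤ σ := by
    have hlim : Tendsto (fun ε : ℝ => C₀ * Real.exp (-A / ε)) (nhdsWithin 0 (Ioi 0)) (nhds 0) := by
      have h1 : Tendsto (fun ε : ℝ => A * ε⁻¹) (nhdsWithin 0 (Ioi 0)) atTop :=
        tendsto_inv_nhdsGT_zero.const_mul_atTop hA
      have h2 := (Real.tendsto_exp_neg_atTop_nhds_zero.comp h1).const_mul C₀
      rw [mul_zero] at h2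
      refine h2.congr fun ε => ?_
      simp only [Function.comp_apply]
      congr 2
      ring
    obtain ⟨ε₁, hε₁, hs⟩ := mem_nhdsGT_iff_exists_Ioo_subset.1
      (hlim.eventually_le_const hσ)
    exact ⟨ε₁, hε₁, fun ε hε => hs hε⟩
  have hmin : 0 < min ρ (b - a) := lt_min hρ (by linarith)
  refine ⟨ω * min ρ (b - a) / 2, by positivity, N * (4 * σ) + 1, by positivity, ε₁, hε₁,
    fun ε hε y y' hy hy' hyI hL1 hE => ?_⟩
  have hε0 := hε.1
  have hyc : ContinuousOn y (Icc a b) := fun x hx => (hy x hx).continuousAt.continuousWithinAt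
  have hcomp : ∀ {H : ℝ → ℝ}, ContinuousOn H I → ContinuousOn (fun x => H (y x)) (Icc a b) :=
    fun hH => hH.comp hyc hyI
  set e : ℝ → ℝ := fun x => ε / 2 * (D (y x) * y' x) ^ 2 + G (y x) / ε with he_def
  have hec : ContinuousOn e (Icc a b) :=
    (continuousOn_const.mul (((hcomp hD).mul hy').pow 2)).add ((hcomp hG).div_const ε)
  have hei : IntegrableOn e (Icc a b) := hec.integrableOn_Icc
  have hyoung : ∀ x ∈ Icc a b, ∀ θ ∈ Icc (0 : ℝ) 1,
      θ * (p (y x) * |y' x| + q (y x) * |y' x|) + (1 - θ ^ 2) * (G (y x) / ε) ≤ e x := by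
    intro x hx θ hθ
    have h1 := young_energy (θ := θ) (m := D (y x) * y' x) (hW.G_nonneg _ (hyI x hx)) hε0
    rw [abs_mul, abs_of_nonneg (hDnn _ (hyI x hx)), ← mul_assoc (Real.sqrt _),
      ← hW.p_add_q _ (hyI x hx), add_mul] at h1
    exact h1
  have hpq : ∀ x ∈ Icc a b, p (y x) * |y' x| + q (y x) * |y' x| ≤ e x := fun x hx => by
    simpa using hyoung x hx 1 (by simp)
  have hpn : ∀ x ∈ Icc a b, 0 ≤ p (y x) * |y' x| := fun x hx =>
    mul_nonneg (hW.p_nonneg _ (hyI x hx)) (abs_nonneg _)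
  have hqn : ∀ x ∈ Icc a b, 0 ≤ q (y x) * |y' x| := fun x hx =>
    mul_nonneg (hW.q_nonneg _ (hyI x hx)) (abs_nonneg _)
  have hpi : ContinuousOn (fun x => p (y x) * |y' x|) (Icc a b) :=
    (hcomp hW.continuousOn_p).mul hy'.abs
  have hqi : ContinuousOn (fun x => q (y x) * |y' x|) (Icc a b) :=
    (hcomp hW.continuousOn_q).mul hy'.abs
  have hPd : ∀ x ∈ Icc a b, HasDerivAt (fun x => P (y x)) (p (y x) * y' x) x := fun x hx =>
    (hW.hasDerivAt_P _ (hyI x hx)).comp x (hy x hx)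
  have hQd : ∀ x ∈ Icc a b, HasDerivAt (fun x => Q (y x)) (q (y x) * y' x) x := fun x hx =>
    (hW.hasDerivAt_Q _ (hyI x hx)).comp x (hy x hx)
  have habsP : ∀ x ∈ Icc a b, |p (y x) * y' x| = p (y x) * |y' x| := fun x hx => by
    rw [abs_mul, abs_of_nonneg (hW.p_nonneg _ (hyI x hx))]
  have habsQ : ∀ x ∈ Icc a b, |q (y x) * y' x| = q (y x) * |y' x| := fun x hx => by
    rw [abs_mul, abs_of_nonneg (hW.q_nonneg _ (hyI x hx))]
  have hvi := intervalIntegrable_of_step hab.le hvval hvconst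
  have hdi : IntervalIntegrable (fun x => |y x - v x|) volume a b :=
    ((hyc.intervalIntegrable_of_Icc hab.le).sub hvi).abs
  have hmark : ∀ {c d : ℝ}, a ≤ c → c < d → d ≤ b → min ρ (b - a) ≤ d - c →
      ∃ x ∈ Ioo c d, |y x - v x| ≤ ω := fun h1 h2 h3 h4 =>
    exists_mem_Ioo_le h1 h2 h3 hdi (fun x _ => abs_nonneg _) hL1 (by
      have := mul_le_mul_of_nonneg_left h4 hω.le
      have := mul_pos hω hmin
      linarith)
  have hsubi : ∀ i, Icc (h i - r) (h i + r) ⊆ Icc a b := fun i => Icc_subset_Icc (hha i) (hhb i)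
  have hvr : ∀ i, ∀ x ∈ Ioo (h i) (h i + ρ), v x = v (h i + r) := by
    intro i x hx
    have hx' : x ≤ h i + r := by linarith [hx.2]
    refine hvconst x (hsubi i ⟨by linarith [hx.1], hx'⟩) _
      (hsubi i ⟨by linarith, le_rfl⟩) hx' fun j hj => ?_
    rcases lt_trichotomy i j with hij | rfl | hij
    · linarith [hsep i j hij, hj.2]
    · linarith [hj.1, hx.1]
    · linarith [hsep j i hij, hj.1, hx.1]
  have hvl : ∀ i, ∀ x ∈ Ioo (h i - ρ) (h i), v x = v (h i - r) := by
    intro i x hx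
    have hx' : h i - r ≤ x := by linarith [hx.1]
    refine (hvconst _ (hsubi i ⟨le_rfl, by linarith⟩) x
      (hsubi i ⟨hx', by linarith [hx.2]⟩) hx' fun j hj => ?_).symm
    rcases lt_trichotomy i j with hij | rfl | hij
    · linarith [hsep i j hij, hj.2, hx.2]
    · linarith [hj.2, hx.2]
    · linarith [hsep j i hij, hj.1]
  have hlayer : ∀ i, ∃ z' ∈ Icc (h i - ρ) (h i), ∃ z ∈ Icc (h i) (h i + ρ),
      (|P (y z')| ≤ σ ∧ |P (y z) - γ| ≤ σ) ∨ (|P (y z') - γ| ≤ σ ∧ |P (y z)| ≤ σ) := by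
    intro i
    obtain ⟨z', hz', hz'ω⟩ := hmark (c := h i - ρ) (d := h i) (by linarith [hha i]) (by linarith)
      (by linarith [hhb i]) (by linarith [min_le_left ρ (b - a)])
    obtain ⟨z, hz, hzω⟩ := hmark (c := h i) (d := h i + ρ) (by linarith [hha i]) (by linarith)
      (by linarith [hhb i]) (by linarith [min_le_left ρ (b - a)])
    refine ⟨z', Ioo_subset_Icc_self hz', z, Ioo_subset_Icc_self hz, ?_⟩
    rw [hvl i z' hz'] at hz'ω
    rw [hvr i z hz] at hzω
    have hne := hvjump i
    rcases hvval (h i - r) (hsubi i ⟨le_rfl, by linarith⟩) with h1 | h1 <;>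
    rcases hvval (h i + r) (hsubi i ⟨by linarith, le_rfl⟩) with h2 | h2 <;>
      rw [h1] at hz'ω <;> rw [h2] at hzω
    · exact absurd (h1.trans h2.symm) hne
    · exact Or.inl ⟨(hωα _ hz'ω).1, (hωβ _ hzω).1⟩
    · exact Or.inr ⟨(hωβ _ hz'ω).1, (hωα _ hzω).1⟩
    · exact absurd (h1.trans h2.symm) hne
  have hPlayer : ∀ i, γ - 2 * σ ≤ ∫ x in (h i - r)..(h i + r), p (y x) * |y' x| := by
    intro i
    obtain ⟨z', ⟨hz'1, hz'2⟩, z, ⟨hz1, hz2⟩, hor⟩ := hlayer i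
    have hss : Icc z' z ⊆ Icc a b :=
      (Icc_subset_Icc (by linarith) (by linarith)).trans (hsubi i)
    have h1 := abs_sub_le_integral (p := z') (q := z) (by linarith) (fun x hx => hPd x (hss hx))
      (hpi.mono hss).integrableOn_Icc (fun x hx => (habsP x (hss hx)).le)
    have h2 := integral_le_of_subinterval (a := h i - r) (b := h i + r) (c := z') (d := z)
      (by linarith) (by linarith) (by linarith)
      ((hpi.mono (hsubi i)).intervalIntegrable_of_Icc (by linarith)) (fun x hx => hpn x (hsubi i hx))
    refine le_trans ?_ (h1.trans h2)
    rcases hor with ⟨o1, o2⟩ | ⟨o1, o2⟩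
    · rw [abs_le] at o1 o2
      refine le_trans ?_ (le_abs_self _)
      linarith
    · rw [abs_le] at o1 o2
      refine le_trans ?_ (neg_le_abs _)
      linarith
  have hσexp := hexp ε hε
  constructor
  · have hEi : ∀ i, γ - 2 * σ ≤ ∫ x in (h i - r)..(h i + r), e x := fun i =>
      (hPlayer i).trans (intervalIntegral.integral_mono_on (by linarith)
        ((hpi.mono (hsubi i)).intervalIntegrable_of_Icc (by linarith))
        ((hec.mono (hsubi i)).intervalIntegrable_of_Icc (by linarith))
        (fun x hx => by linarith [hpq x (hsubi i hx), hqn x (hsubi i hx)]))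
    have hsum := sum_integral_le hab.le hr.le hsep hha hhb hei
      (fun x hx => by linarith [hpq x hx, hqn x hx, hpn x hx])
    have hEi' : ∀ i, ∫ x in (h i - r)..(h i + r), e x ≤ γ + (2 * N + 1) * σ := by
      intro i
      have h1 : ∑ j ∈ Finset.univ.erase i, (γ - 2 * σ)
          ≤ ∑ j ∈ Finset.univ.erase i, ∫ x in (h j - r)..(h j + r), e x :=
        Finset.sum_le_sum fun j _ => hEi j
      have h2 := Finset.sum_erase_add Finset.univ
        (fun j => ∫ x in (h j - r)..(h j + r), e x) (Finset.mem_univ i)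
      have h3 := Finset.sum_erase_add Finset.univ
        (fun _ : Fin N => γ - 2 * σ) (Finset.mem_univ i)
      have h4 : ∑ _ : Fin N, (γ - 2 * σ) = N * (γ - 2 * σ) := by
        rw [Finset.sum_const, Finset.card_univ, Fintype.card_fin, nsmul_eq_mul]
      linarith
    have hexpA : Real.exp (-2 * (κ * (r - ρ) / ε)) = Real.exp (-A / ε) := by
      congr 1
      rw [← hκA]
      ring
    have hEi'' : ∀ i, γ - 4 * σ * Real.exp (-A / ε) ≤ ∫ x in (h i - r)..(h i + r), e x := by
      intro i
      obtain ⟨z', hz', z, hz, hor⟩ := hlayer i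
      rw [← hexpA]
      have hy1 : ∀ x ∈ Icc (h i - r) (h i + r), ∀ θ ∈ Icc (0 : ℝ) 1,
          θ * |p (y x) * y' x| + (1 - θ ^ 2) * (G (y x) / ε) ≤ e x := by
        intro x hx θ hθ
        refine le_trans ?_ (hyoung x (hsubi i hx) θ hθ)
        rw [habsP x (hsubi i hx), mul_add]
        linarith [mul_nonneg hθ.1 (hqn x (hsubi i hx))]
      rcases hor with ⟨o1, o2⟩ | ⟨o1, o2⟩
      · exact single_transition_energy_ge (η := η) hρ hρr hε0 hκ (g := fun x => G (y x))
          (fun x hx => hPd x (hsubi i hx)) (hei.mono_set (hsubi i)) hy1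
          (fun x hx => hW.mul_P_le _ (hyI x (hsubi i hx)))
          (fun x hx => hW.mul_sub_P_le _ (hyI x (hsubi i hx))) hz' hz o1 o2
          (by linarith) (hEi' i)
      · refine single_transition_energy_ge (η := η) hρ hρr hε0 hκ (g := fun x => G (y x))
          (φ := fun x => γ - P (y x)) (φ' := fun x => -(p (y x) * y' x))
          (fun x hx => (hPd x (hsubi i hx)).const_sub γ) (hei.mono_set (hsubi i))
          (fun x hx θ hθ => by rw [abs_neg]; exact hy1 x hx θ hθ)
          (fun x hx hle => hW.mul_sub_P_le _ (hyI x (hsubi i hx)) (by linarith))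
          (fun x hx hle => ?_) hz' hz (by rwa [abs_sub_comm])
          (by rwa [sub_sub_cancel_left, abs_neg])
          (by linarith) (hEi' i)
        rw [sub_sub_cancel]
        exact hW.mul_P_le _ (hyI x (hsubi i hx)) (by linarith)
    have h1 : ∑ i : Fin N, (γ - 4 * σ * Real.exp (-A / ε))
        ≤ ∑ i, ∫ x in (h i - r)..(h i + r), e x := Finset.sum_le_sum fun i _ => hEi'' i
    rw [Finset.sum_const, Finset.card_univ, Fintype.card_fin, nsmul_eq_mul] at h1
    nlinarith [Real.exp_pos (-A / ε)]
  · intro x hx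
    refine hW.mem_Icc _ (hyI x hx) (le_trans ?_ hσξ)
    obtain ⟨m, hm, hmω⟩ := hmark le_rfl hab le_rfl (min_le_right _ _)
    have hm' := Ioo_subset_Icc_self hm
    have hQm : |Q (y m)| ≤ σ := by
      rcases hvval m hm' with h1 | h1 <;> rw [h1] at hmω
      · exact (hωα _ hmω).2
      · exact (hωβ _ hmω).2
    have hvarQ : |Q (y x) - Q (y m)| ≤ ∫ x in a..b, q (y x) * |y' x| := by
      have key : ∀ {s t : ℝ}, s ∈ Icc a b → t ∈ Icc a b → s ≤ t →
          |Q (y t) - Q (y s)| ≤ ∫ x in a..b, q (y x) * |y' x| := by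
        intro s t hs ht hst
        have hss : Icc s t ⊆ Icc a b := Icc_subset_Icc hs.1 ht.2
        exact (abs_sub_le_integral hst (fun x hx => hQd x (hss hx))
          (hqi.mono hss).integrableOn_Icc (fun x hx => (habsQ x (hss hx)).le)).trans
          (integral_le_of_subinterval hs.1 hst ht.2 (hqi.intervalIntegrable_of_Icc hab.le) hqn)
      rcases le_total m x with h1 | h1
      · exact key hm' hx h1
      · rw [abs_sub_comm]
        exact key hx hm' h1
    have hsum := sum_integral_le hab.le hr.le hsep hha hhb hpi.integrableOn_Icc hpn
    have h1 : ∑ i : Fin N, (γ - 2 * σ)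
        ≤ ∑ i, ∫ x in (h i - r)..(h i + r), p (y x) * |y' x| :=
      Finset.sum_le_sum fun i _ => hPlayer i
    rw [Finset.sum_const, Finset.card_univ, Fintype.card_fin, nsmul_eq_mul] at h1
    have h2 : (∫ x in a..b, p (y x) * |y' x|) + (∫ x in a..b, q (y x) * |y' x|)
        ≤ ∫ x in a..b, e x := by
      rw [← intervalIntegral.integral_add (hpi.intervalIntegrable_of_Icc hab.le)
        (hqi.intervalIntegrable_of_Icc hab.le)]
      exact intervalIntegral.integral_mono_on hab.le
        ((hpi.add hqi).intervalIntegrable_of_Icc hab.le) (hec.intervalIntegrable_of_Icc hab.le) hpq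
    have h3 := abs_sub_abs_le_abs_sub (Q (y x)) (Q (y m))
    linarith

/-! ### Dissipation of the energy -/

lemma continuousOn_integral_of_continuousOn_prod {F : ℝ × ℝ → ℝ} {a b T : ℝ} (hab : a ≤ b)
    (hT : 0 ≤ T) (hF : ContinuousOn F (Icc 0 T ×ˢ Icc a b)) :
    ContinuousOn (fun t => ∫ x in a..b, F (t, x)) (Icc 0 T) := by
  have hc : Continuous fun p : ℝ × ℝ =>
      F ((projIcc 0 T hT p.1 : ℝ), (projIcc a b hab p.2 : ℝ)) :=
    hF.comp_continuous (by fun_prop) fun p => ⟨(projIcc 0 T hT p.1).2, (projIcc a b hab p.2).2⟩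
  refine (intervalIntegral.continuous_parametric_intervalIntegral_of_continuous'
    (μ := volume) (f := fun t x => F ((projIcc 0 T hT t : ℝ), (projIcc a b hab x : ℝ)))
    hc a b).continuousOn.congr fun t ht => ?_
  refine intervalIntegral.integral_congr fun x hx => ?_
  rw [uIcc_of_le hab] at hx
  simp only [projIcc_of_mem hT ht, projIcc_of_mem hab hx]

section Dissipation

variable {I : Set ℝ} {D f G : ℝ → ℝ} {d ε a b T : ℝ} {u ut ux w : ℝ → ℝ → ℝ}

/-- Energy identity for the Neumann problem `uₜ = ε² (D(u) uₓ)ₓ - f(u)`. -/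
lemma hasDerivAt_energy (hIopen : IsOpen I) (hIconn : I.OrdConnected)
    (hD : ContinuousOn D I) (hf : ContinuousOn f I)
    (hGd : ∀ s ∈ I, HasDerivAt G (f s * D s) s) (hε : 0 < ε) (hab : a ≤ b)
    (hux : ∀ t ≥ (0 : ℝ), ∀ x ∈ Icc a b, HasDerivAt (fun y => u t y) (ux t x) x)
    (hut : ∀ t ≥ (0 : ℝ), ∀ x ∈ Icc a b, HasDerivAt (fun s => u s x) (ut t x) t)
    (hw : ∀ t ≥ (0 : ℝ), ∀ x ∈ Icc a b, HasDerivAt (fun y => D (u t y) * ux t y) (w t x) x)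
    (hpde : ∀ t > (0 : ℝ), ∀ x ∈ Icc a b, ut t x = ε ^ 2 * w t x - f (u t x))
    (hneu : ∀ t ≥ (0 : ℝ), ux t a = 0 ∧ ux t b = 0)
    (hreg : Continuous fun p : ℝ × ℝ => u p.1 p.2)
    (hregt : Continuous fun p : ℝ × ℝ => ut p.1 p.2)
    (hregx : Continuous fun p : ℝ × ℝ => ux p.1 p.2)
    (hmem : ∀ t ∈ Icc 0 T, ∀ x ∈ Icc a b, u t x ∈ I) {t : ℝ} (ht : t ∈ Ioo 0 T) :
    HasDerivAt (fun t => ∫ x in a..b, (ε / 2 * (D (u t x) * ux t x) ^ 2 + G (u t x) / ε))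
      (-(1 / ε) * ∫ x in a..b, D (u t x) * ut t x ^ 2) t := by
  have htT := Ioo_subset_Icc_self ht
  have haI : u t a ∈ I := hmem t htT a ⟨le_rfl, hab⟩
  set K : ℝ → ℝ := fun s => ∫ z in (u t a)..s, D z with hK_def
  have hK : ∀ s ∈ I, HasDerivAt K (D s) s := fun s hs => hasDerivAt_primitive hIopen hIconn hD haI hs
  have hKc : ContinuousOn K I := fun s hs => (hK s hs).continuousAt.continuousWithinAt
  have hGc : ContinuousOn G I := fun s hs => (hGd s hs).continuousAt.continuousWithinAt
  have hcomp : ∀ {H : ℝ → ℝ}, ContinuousOn H I →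
      ContinuousOn (fun p : ℝ × ℝ => H (u p.1 p.2)) (Icc 0 T ×ˢ Icc a b) := fun hH =>
    hH.comp hreg.continuousOn fun p hp => hmem p.1 hp.1 p.2 hp.2
  have hslice : ∀ {H : ℝ × ℝ → ℝ}, ContinuousOn H (Icc 0 T ×ˢ Icc a b) → ∀ s ∈ Icc 0 T,
      ContinuousOn (fun x => H (s, x)) (Icc a b) := fun hH s hs =>
    hH.comp (by fun_prop) fun x hx => ⟨hs, hx⟩
  set W : ℝ → ℝ → ℝ := fun s x => (ut s x + f (u s x)) / ε ^ 2 with hW_def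
  have hWw : ∀ s ∈ Ioo 0 T, ∀ x ∈ Icc a b, w s x = W s x := by
    intro s hs x hx
    simp only [hW_def, hpde s hs.1 x hx]
    field_simp
    ring
  have hWc : ContinuousOn (fun p : ℝ × ℝ => W p.1 p.2) (Icc 0 T ×ˢ Icc a b) :=
    (hregt.continuousOn.add (hcomp hf)).div_const _
  have hKt : ∀ s ∈ Ioo 0 T, ∀ x ∈ Icc a b,
      HasDerivAt (fun s => K (u s x)) (D (u s x) * ut s x) s := fun s hs x hx =>
    HasDerivAt.comp s (h₂ := K) (hK _ (hmem s (Ioo_subset_Icc_self hs) x hx)) (hut s hs.1.le x hx)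
  have hGt : ∀ s ∈ Ioo 0 T, ∀ x ∈ Icc a b,
      HasDerivAt (fun s => G (u s x)) (f (u s x) * D (u s x) * ut s x) s := fun s hs x hx =>
    (hGd _ (hmem s (Ioo_subset_Icc_self hs) x hx)).comp s (hut s hs.1.le x hx)
  have hScomp : IsCompact (Icc 0 T ×ˢ Icc a b) := isCompact_Icc.prod isCompact_Icc
  obtain ⟨M₁, hM₁⟩ := hScomp.exists_bound_of_continuousOn
    ((hcomp hD).mul hregt.continuousOn)
  obtain ⟨M₂, hM₂⟩ := hScomp.exists_bound_of_continuousOn hWc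
  obtain ⟨M₃, hM₃⟩ := hScomp.exists_bound_of_continuousOn
    (((hcomp hf).mul (hcomp hD)).mul hregt.continuousOn)
  have hslope : ∀ {H H' : ℝ → ℝ → ℝ} {M : ℝ},
      (∀ s ∈ Ioo 0 T, ∀ x ∈ Icc a b, HasDerivAt (fun s => H s x) (H' s x) s) →
      (∀ p ∈ Icc 0 T ×ˢ Icc a b, ‖H' p.1 p.2‖ ≤ M) → ∀ s ∈ Ioo 0 T, ∀ x ∈ Icc a b,
      |(s - t)⁻¹ * (H s x - H t x)| ≤ M := by
    intro H H' M hH hM s hs x hx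
    have h1 := Convex.norm_image_sub_le_of_norm_hasDerivWithin_le (C := M)
      (fun s hs => (hH s hs x hx).hasDerivWithinAt)
      (fun s hs => hM (s, x) ⟨Ioo_subset_Icc_self hs, hx⟩) (convex_Ioo 0 T) ht hs
    have hM0 : 0 ≤ M := (norm_nonneg _).trans (hM (t, x) ⟨htT, hx⟩)
    rw [Real.norm_eq_abs, Real.norm_eq_abs] at h1
    rw [abs_mul, abs_inv]
    exact inv_mul_le_of_le_mul₀ (abs_nonneg _) hM0 (by rwa [mul_comm])
  set Φ : ℝ → ℝ → ℝ := fun s x =>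
    -(ε / 2) * (((s - t)⁻¹ * (K (u s x) - K (u t x))) * (W s x + W t x)) +
      (s - t)⁻¹ * (G (u s x) - G (u t x)) / ε with hΦ_def
  have hΦc : ∀ s ∈ Ioo 0 T, ContinuousOn (Φ s) (Icc a b) := by
    intro s hs
    have hs' := Ioo_subset_Icc_self hs
    exact (continuousOn_const.mul ((continuousOn_const.mul
      ((hslice (hcomp hKc) s hs').sub (hslice (hcomp hKc) t htT))).mul
      ((hslice hWc s hs').add (hslice hWc t htT)))).add
      ((continuousOn_const.mul ((hslice (hcomp hGc) s hs').sub
        (hslice (hcomp hGc) t htT))).div_const _)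
  have hux_c : ∀ s, ContinuousOn (fun x => ux s x) (Icc a b) := fun s =>
    (hregx.comp (by fun_prop : Continuous fun x : ℝ => (s, x))).continuousOn
  have hmc : ∀ s ∈ Icc 0 T, ContinuousOn (fun x => D (u s x) * ux s x) (Icc a b) :=
    fun s hs => (hslice (hcomp hD) s hs).mul (hux_c s)
  have hΦint : ∀ s ∈ Ioo 0 T,
      slope (fun t => ∫ x in a..b, (ε / 2 * (D (u t x) * ux t x) ^ 2 + G (u t x) / ε)) t s
        = ∫ x in a..b, Φ s x := by
    intro s hs
    have hs' := Ioo_subset_Icc_self hs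
    have hKx : ∀ r ∈ Icc 0 T, ∀ x ∈ Icc a b,
        HasDerivAt (fun x => K (u r x)) (D (u r x) * ux r x) x := fun r hr x hx =>
      (hK _ (hmem r hr x hx)).comp x (hux r hr.1 x hx)
    have hmx : ∀ r ∈ Ioo 0 T, ∀ x ∈ Icc a b,
        HasDerivAt (fun y => D (u r y) * ux r y) (W r x) x := fun r hr x hx => by
      rw [← hWw r hr x hx]
      exact hw r hr.1.le x hx
    have hIBP := intervalIntegral.integral_mul_deriv_eq_deriv_mul (a := a) (b := b)
      (u := fun x => K (u s x) - K (u t x))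
      (u' := fun x => D (u s x) * ux s x - D (u t x) * ux t x)
      (v := fun x => D (u s x) * ux s x + D (u t x) * ux t x) (v' := fun x => W s x + W t x)
      (fun x hx => (hKx s hs' x (by rwa [uIcc_of_le hab] at hx)).sub
        (hKx t htT x (by rwa [uIcc_of_le hab] at hx)))
      (fun x hx => (hmx s hs x (by rwa [uIcc_of_le hab] at hx)).add
        (hmx t ht x (by rwa [uIcc_of_le hab] at hx)))
      (((hmc s hs').sub (hmc t htT)).intervalIntegrable_of_Icc hab)
      (((hslice hWc s hs').add (hslice hWc t htT)).intervalIntegrable_of_Icc hab)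
    simp only [(hneu s hs.1.le).1, (hneu s hs.1.le).2, (hneu t ht.1.le).1, (hneu t ht.1.le).2,
      mul_zero, add_zero, sub_zero, zero_sub] at hIBP
    have hec : ∀ r ∈ Icc 0 T, IntervalIntegrable
        (fun x => ε / 2 * (D (u r x) * ux r x) ^ 2 + G (u r x) / ε) volume a b := fun r hr =>
      ((continuousOn_const.mul ((hmc r hr).pow 2)).add
        ((hslice (hcomp hGc) r hr).div_const ε)).intervalIntegrable_of_Icc hab
    have hi1 : IntervalIntegrable (fun x => (D (u s x) * ux s x - D (u t x) * ux t x) *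
        (D (u s x) * ux s x + D (u t x) * ux t x)) volume a b :=
      (((hmc s hs').sub (hmc t htT)).mul ((hmc s hs').add
        (hmc t htT))).intervalIntegrable_of_Icc hab
    have hi2 : IntervalIntegrable (fun x => (K (u s x) - K (u t x)) * (W s x + W t x))
        volume a b :=
      (((hslice (hcomp hKc) s hs').sub (hslice (hcomp hKc) t htT)).mul
        ((hslice hWc s hs').add (hslice hWc t htT))).intervalIntegrable_of_Icc hab
    have hi3 : IntervalIntegrable (fun x => (G (u s x) - G (u t x)) / ε) volume a b :=
      (((hslice (hcomp hGc) s hs').sub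
        (hslice (hcomp hGc) t htT)).div_const _).intervalIntegrable_of_Icc hab
    rw [slope_def_module, smul_eq_mul, ← intervalIntegral.integral_sub (hec s hs') (hec t htT)]
    have e1 : (∫ x in a..b, ((ε / 2 * (D (u s x) * ux s x) ^ 2 + G (u s x) / ε) -
        (ε / 2 * (D (u t x) * ux t x) ^ 2 + G (u t x) / ε))) =
        ∫ x in a..b, (ε / 2 * ((D (u s x) * ux s x - D (u t x) * ux t x) *
        (D (u s x) * ux s x + D (u t x) * ux t x)) + (G (u s x) - G (u t x)) / ε) :=
      intervalIntegral.integral_congr fun x _ => by ring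
    have e2 : (∫ x in a..b, Φ s x) = ∫ x in a..b, (s - t)⁻¹ *
        (-(ε / 2) * ((K (u s x) - K (u t x)) * (W s x + W t x)) + (G (u s x) - G (u t x)) / ε) :=
      intervalIntegral.integral_congr fun x _ => by simp only [hΦ_def]; ring
    rw [e1, e2, intervalIntegral.integral_const_mul,
      intervalIntegral.integral_add (hi1.const_mul _) hi3,
      intervalIntegral.integral_add (hi2.const_mul _) hi3,
      intervalIntegral.integral_const_mul, intervalIntegral.integral_const_mul, hIBP]
    ring
  have hIoo : ∀ᶠ s in nhdsWithin t {t}ᶜ, s ∈ Ioo 0 T :=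
    nhdsWithin_le_nhds (Ioo_mem_nhds ht.1 ht.2)
  have hIoc : uIoc a b ⊆ Icc a b := by
    rw [uIoc_of_le hab]
    exact Ioc_subset_Icc_self
  rw [hasDerivAt_iff_tendsto_slope, ← intervalIntegral.integral_const_mul]
  refine Tendsto.congr' (hIoo.mono fun s hs => (hΦint s hs).symm) ?_
  refine intervalIntegral.tendsto_integral_filter_of_dominated_convergence
    (fun _ => ε / 2 * (M₁ * (M₂ + M₂)) + M₃ / ε) ?_ ?_ (by simp) ?_
  · refine hIoo.mono fun s hs => ?_
    rw [uIoc_of_le hab]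
    exact ((hΦc s hs).mono Ioc_subset_Icc_self).aestronglyMeasurable measurableSet_Ioc
  · refine hIoo.mono fun s hs => ae_of_all _ fun x hx => ?_
    have hx' := hIoc hx
    have b1 := hslope hKt hM₁ s hs x hx'
    have b2 := hM₂ (s, x) ⟨Ioo_subset_Icc_self hs, hx'⟩
    have b3 := hM₂ (t, x) ⟨htT, hx'⟩
    have b4 := hslope hGt hM₃ s hs x hx'
    rw [Real.norm_eq_abs] at b2 b3 ⊢
    refine (abs_add_le _ _).trans (add_le_add ?_ ?_)
    · rw [abs_mul, abs_neg, abs_of_pos (half_pos hε), abs_mul]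
      gcongr
      · exact (abs_nonneg _).trans b1
      · exact (abs_add_le _ _).trans (add_le_add b2 b3)
    · rw [abs_div, abs_of_pos hε]
      gcongr
  · refine ae_of_all _ fun x hx => ?_
    have hx' := hIoc hx
    have l1 := hasDerivAt_iff_tendsto_slope.1 (hKt t ht x hx')
    have l2 := hasDerivAt_iff_tendsto_slope.1 (hGt t ht x hx')
    have l3 : Tendsto (fun s => W s x) (nhdsWithin t {t}ᶜ) (nhds (W t x)) := by
      have h1 : ContinuousOn (fun s => W s x) (Icc 0 T) :=
        hWc.comp (by fun_prop : ContinuousOn (fun s : ℝ => (s, x)) (Icc 0 T))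
          fun s hs => ⟨hs, hx'⟩
      exact (h1.continuousAt (Icc_mem_nhds ht.1 ht.2)).tendsto.mono_left nhdsWithin_le_nhds
    have l4 := ((l1.mul (l3.add_const (W t x))).const_mul (-(ε / 2))).add (l2.div_const ε)
    have e1 : -(1 / ε) * (D (u t x) * ut t x ^ 2) =
        -(ε / 2) * (D (u t x) * ut t x * (W t x + W t x)) +
          f (u t x) * D (u t x) * ut t x / ε := by
      simp only [hW_def]
      field_simp
      ring
    rw [e1]
    exact l4.congr fun s => by simp only [hΦ_def, slope_def_module, smul_eq_mul]

/-- The energy dissipation inequality. -/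
lemma energy_dissipation (hIopen : IsOpen I) (hIconn : I.OrdConnected)
    (hD : ContinuousOn D I) (hDd : ∀ s ∈ I, d ≤ D s) (hf : ContinuousOn f I)
    (hGd : ∀ s ∈ I, HasDerivAt G (f s * D s) s) (hε : 0 < ε) (hab : a ≤ b) (hT : 0 ≤ T)
    (hux : ∀ t ≥ (0 : ℝ), ∀ x ∈ Icc a b, HasDerivAt (fun y => u t y) (ux t x) x)
    (hut : ∀ t ≥ (0 : ℝ), ∀ x ∈ Icc a b, HasDerivAt (fun s => u s x) (ut t x) t)
    (hw : ∀ t ≥ (0 : ℝ), ∀ x ∈ Icc a b, HasDerivAt (fun y => D (u t y) * ux t y) (w t x) x)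
    (hpde : ∀ t > (0 : ℝ), ∀ x ∈ Icc a b, ut t x = ε ^ 2 * w t x - f (u t x))
    (hneu : ∀ t ≥ (0 : ℝ), ux t a = 0 ∧ ux t b = 0)
    (hreg : Continuous fun p : ℝ × ℝ => u p.1 p.2)
    (hregt : Continuous fun p : ℝ × ℝ => ut p.1 p.2)
    (hregx : Continuous fun p : ℝ × ℝ => ux p.1 p.2)
    (hmem : ∀ t ∈ Icc 0 T, ∀ x ∈ Icc a b, u t x ∈ I) :
    (∫ x in a..b, (ε / 2 * (D (u T x) * ux T x) ^ 2 + G (u T x) / ε)) +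
        d / ε * (∫ t in (0 : ℝ)..T, ∫ x in a..b, ut t x ^ 2) ≤
      ∫ x in a..b, (ε / 2 * (D (u 0 x) * ux 0 x) ^ 2 + G (u 0 x) / ε) := by
  have hcomp : ∀ {H : ℝ → ℝ}, ContinuousOn H I →
      ContinuousOn (fun p : ℝ × ℝ => H (u p.1 p.2)) (Icc 0 T ×ˢ Icc a b) := fun hH =>
    hH.comp hreg.continuousOn fun p hp => hmem p.1 hp.1 p.2 hp.2
  have hGc : ContinuousOn G I := fun s hs => (hGd s hs).continuousAt.continuousWithinAt
  have hEc := continuousOn_integral_of_continuousOn_prod hab hT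
    ((continuousOn_const (c := ε / 2)).mul
      (((hcomp hD).mul hregx.continuousOn).pow 2) |>.add ((hcomp hGc).div_const ε))
  have hJc : Continuous fun t => ∫ x in a..b, ut t x ^ 2 :=
    intervalIntegral.continuous_parametric_intervalIntegral_of_continuous'
      (f := fun t x => ut t x ^ 2) (by fun_prop) a b
  have hJd : ∀ t, HasDerivAt (fun t => ∫ s in (0 : ℝ)..t, ∫ x in a..b, ut s x ^ 2)
      (∫ x in a..b, ut t x ^ 2) t := fun t => (hJc.integral_hasStrictDerivAt 0 t).hasDerivAt
  have hanti := antitoneOn_of_hasDerivWithinAt_nonpos (convex_Icc 0 T)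
    (f := fun t => (∫ x in a..b, (ε / 2 * (D (u t x) * ux t x) ^ 2 + G (u t x) / ε)) +
        d / ε * (∫ s in (0 : ℝ)..t, ∫ x in a..b, ut s x ^ 2))
    (f' := fun t => -(1 / ε) * (∫ x in a..b, D (u t x) * ut t x ^ 2) +
      d / ε * ∫ x in a..b, ut t x ^ 2)
    (hEc.add (continuousOn_const.mul
      fun t _ => (hJd t).continuousAt.continuousWithinAt)) ?_ ?_
  · simpa using hanti ⟨le_rfl, hT⟩ ⟨hT, le_rfl⟩ hT
  · intro t ht
    rw [interior_Icc] at ht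
    exact ((hasDerivAt_energy hIopen hIconn hD hf hGd hε hab hux hut hw hpde hneu hreg hregt hregx
      hmem ht).add ((hJd t).const_mul _)).hasDerivWithinAt
  · intro t ht
    rw [interior_Icc] at ht
    have hut2 : Continuous fun x => ut t x ^ 2 :=
      (hregt.comp (by fun_prop : Continuous fun x : ℝ => (t, x))).pow 2
    have hDut : ContinuousOn (fun x => D (u t x) * ut t x ^ 2) (Icc a b) :=
      ((hcomp hD).comp (by fun_prop : ContinuousOn (fun x : ℝ => (t, x)) (Icc a b))
        fun x hx => ⟨Ioo_subset_Icc_self ht, hx⟩).mul hut2.continuousOn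
    have h1 : d * (∫ x in a..b, ut t x ^ 2) ≤ ∫ x in a..b, D (u t x) * ut t x ^ 2 := by
      rw [← intervalIntegral.integral_const_mul]
      exact intervalIntegral.integral_mono_on hab ((hut2.intervalIntegrable a b).const_mul d)
        (hDut.intervalIntegrable_of_Icc hab) fun x hx => mul_le_mul_of_nonneg_right
          (hDd _ (hmem t (Ioo_subset_Icc_self ht) x hx)) (sq_nonneg _)
    have h2 := mul_le_mul_of_nonneg_left h1 (one_div_pos.2 hε).le
    have h3 : 1 / ε * (d * ∫ x in a..b, ut t x ^ 2) = d / ε * ∫ x in a..b, ut t x ^ 2 := by ring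
    linarith

end Dissipation

/-- Young's inequality turns the dissipated energy into a bound for the drift in `L¹`. -/
lemma integral_abs_sub_le_dissipation {a b t μ : ℝ} {u ut : ℝ → ℝ → ℝ} (hab : a ≤ b) (ht : 0 ≤ t)
    (hμ : 0 < μ)
    (hut : ∀ t ≥ (0 : ℝ), ∀ x ∈ Icc a b, HasDerivAt (fun s => u s x) (ut t x) t)
    (hreg : Continuous fun p : ℝ × ℝ => u p.1 p.2)
    (hregt : Continuous fun p : ℝ × ℝ => ut p.1 p.2) :
    (∫ x in a..b, |u t x - u 0 x|) ≤
      μ / 2 * (t * (b - a)) + 1 / (2 * μ) * ∫ s in (0 : ℝ)..t, ∫ x in a..b, ut s x ^ 2 := by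
  have hutx : ∀ x, Continuous fun s => ut s x := fun x =>
    hregt.comp (by fun_prop : Continuous fun s : ℝ => (s, x))
  have hswapc : Continuous fun p : ℝ × ℝ => ut p.2 p.1 := hregt.comp continuous_swap
  have hJc : Continuous fun x => ∫ s in (0 : ℝ)..t, ut s x ^ 2 :=
    intervalIntegral.continuous_parametric_intervalIntegral_of_continuous'
      (f := fun x s => ut s x ^ 2) (by fun_prop) 0 t
  have hpt : ∀ x ∈ Icc a b,
      |u t x - u 0 x| ≤ μ / 2 * t + 1 / (2 * μ) * ∫ s in (0 : ℝ)..t, ut s x ^ 2 := by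
    intro x hx
    have h1 : ∫ s in (0 : ℝ)..t, ut s x = u t x - u 0 x :=
      intervalIntegral.integral_eq_sub_of_hasDerivAt
        (fun s hs => hut s (by rw [uIcc_of_le ht] at hs; exact hs.1) x hx)
        ((hutx x).intervalIntegrable 0 t)
    have h2 : |∫ s in (0 : ℝ)..t, ut s x| ≤ ∫ s in (0 : ℝ)..t, |ut s x| :=
      intervalIntegral.abs_integral_le_integral_abs ht
    have h3 : (∫ s in (0 : ℝ)..t, |ut s x|) ≤
        ∫ s in (0 : ℝ)..t, (μ / 2 + 1 / (2 * μ) * ut s x ^ 2) := by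
      refine intervalIntegral.integral_mono_on ht ((hutx x).abs.intervalIntegrable 0 t)
        ((continuous_const.add (continuous_const.mul ((hutx x).pow 2))).intervalIntegrable 0 t)
        fun s _ => ?_
      have h4 : 0 ≤ (μ - |ut s x|) ^ 2 / (2 * μ) := by positivity
      have h5 : (μ - |ut s x|) ^ 2 / (2 * μ) = μ / 2 + 1 / (2 * μ) * ut s x ^ 2 - |ut s x| := by
        rw [← sq_abs (ut s x)]
        field_simp
        ring
      linarith
    have h6 : IntervalIntegrable (fun s => 1 / (2 * μ) * ut s x ^ 2) volume 0 t :=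
      (continuous_const.mul ((hutx x).pow 2)).intervalIntegrable 0 t
    rw [intervalIntegral.integral_add intervalIntegrable_const h6,
      intervalIntegral.integral_const_mul, intervalIntegral.integral_const, smul_eq_mul] at h3
    rw [← h1]
    linarith
  have hux : ∀ s, Continuous fun x => u s x := fun s =>
    hreg.comp (by fun_prop : Continuous fun x : ℝ => (s, x))
  have hswap : (∫ x in a..b, ∫ s in (0 : ℝ)..t, ut s x ^ 2) =
      ∫ s in (0 : ℝ)..t, ∫ x in a..b, ut s x ^ 2 :=
    intervalIntegral_intervalIntegral_swap (F := fun x s => ut s x ^ 2)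
      (((hswapc.pow 2).continuousOn.integrableOn_compact
        (isCompact_uIcc.prod isCompact_uIcc)).mono_set
          (prod_mono uIoc_subset_uIcc uIoc_subset_uIcc))
  have hJi : IntervalIntegrable (fun x => 1 / (2 * μ) * ∫ s in (0 : ℝ)..t, ut s x ^ 2)
      volume a b := (continuous_const.mul hJc).intervalIntegrable a b
  calc (∫ x in a..b, |u t x - u 0 x|)
      ≤ ∫ x in a..b, (μ / 2 * t + 1 / (2 * μ) * ∫ s in (0 : ℝ)..t, ut s x ^ 2) :=
        intervalIntegral.integral_mono_on hab
          (((hux t).sub (hux 0)).abs.intervalIntegrable a b)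
          ((continuous_const.add (continuous_const.mul hJc)).intervalIntegrable a b) hpt
    _ = _ := by
        rw [intervalIntegral.integral_add intervalIntegrable_const hJi,
          intervalIntegral.integral_const_mul (1 / (2 * μ)), intervalIntegral.integral_const,
          smul_eq_mul, hswap]
        ring

/-! ### Confinement of the solution -/

lemma integral_abs_sub_le_add {a b : ℝ} (hab : a ≤ b) {y z v : ℝ → ℝ} (hy : Continuous y)
    (hz : Continuous z) (hv : IntervalIntegrable v volume a b) :
    (∫ x in a..b, |y x - v x|) ≤ (∫ x in a..b, |z x - v x|) + ∫ x in a..b, |y x - z x| := by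
  have h1 := ((hy.intervalIntegrable a b).sub hv).abs
  have h2 := ((hz.intervalIntegrable a b).sub hv).abs
  have h3 : IntervalIntegrable (fun x => |y x - z x|) volume a b :=
    (hy.sub hz).abs.intervalIntegrable a b
  rw [← intervalIntegral.integral_add h2 h3]
  refine intervalIntegral.integral_mono_on hab h1 (h2.add h3) fun x _ => ?_
  rw [add_comm]
  exact abs_sub_le _ _ _

lemma continuous_integral_abs_sub {a b : ℝ} (hab : a ≤ b) {u : ℝ → ℝ → ℝ} {v : ℝ → ℝ}
    (hreg : Continuous fun p : ℝ × ℝ => u p.1 p.2) (hv : IntervalIntegrable v volume a b) :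
    Continuous fun t => ∫ x in a..b, |u t x - v x| := by
  have hux : ∀ s, Continuous fun x => u s x := fun s =>
    hreg.comp (by fun_prop : Continuous fun x : ℝ => (s, x))
  refine continuous_iff_continuousAt.2 fun t => ?_
  have hc : Continuous fun s => ∫ x in a..b, |u s x - u t x| :=
    intervalIntegral.continuous_parametric_intervalIntegral_of_continuous'
      (f := fun s x => |u s x - u t x|)
      (hreg.sub ((hux t).comp continuous_snd)).abs a b
  have h0 : Tendsto (fun s => ∫ x in a..b, |u s x - u t x|) (nhds t) (nhds 0) := by
    simpa using hc.tendsto t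
  refine tendsto_iff_dist_tendsto_zero.2 (squeeze_zero (fun _ => dist_nonneg) (fun s => ?_) h0)
  have h1 := integral_abs_sub_le_add hab (hux s) (hux t) hv
  have h2 := integral_abs_sub_le_add hab (hux t) (hux s) hv
  simp only [abs_sub_comm (u t _) (u s _)] at h2
  rw [Real.dist_eq, abs_le]
  constructor <;> linarith

/-- A continuity argument: if, as long as `u` takes values in `I` and stays `δ`-close to `v`, it
in fact takes values in `[k₁, k₂]` and is strictly `δ`-close to `v`, then this holds throughout. -/
lemma confinement {I : Set ℝ} (hIopen : IsOpen I) {a b T k₁ k₂ δ : ℝ} {u : ℝ → ℝ → ℝ}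
    {v : ℝ → ℝ} (hab : a ≤ b) (hT : 0 ≤ T) (hk : Icc k₁ k₂ ⊆ I)
    (hreg : Continuous fun p : ℝ × ℝ => u p.1 p.2) (hv : IntervalIntegrable v volume a b)
    (hstep : ∀ t ∈ Icc 0 T, (∀ s ∈ Icc 0 t, ∀ x ∈ Icc a b, u s x ∈ I) →
      (∫ x in a..b, |u t x - v x|) ≤ δ →
      (∀ x ∈ Icc a b, u t x ∈ Icc k₁ k₂) ∧ (∫ x in a..b, |u t x - v x|) < δ)
    (hI0 : ∀ x ∈ Icc a b, u 0 x ∈ I) (hδ0 : (∫ x in a..b, |u 0 x - v x|) ≤ δ) :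
    ∀ t ∈ Icc 0 T, (∀ x ∈ Icc a b, u t x ∈ Icc k₁ k₂) ∧ (∫ x in a..b, |u t x - v x|) ≤ δ := by
  have hLc := continuous_integral_abs_sub hab hreg hv
  set L : ℝ → ℝ := fun t => ∫ x in a..b, |u t x - v x| with hL
  set S : Set ℝ := {t | (∀ x ∈ Icc a b, u t x ∈ Icc k₁ k₂) ∧ L t ≤ δ} with hS
  have hSclosed : IsClosed S := by
    refine IsClosed.and ?_ (isClosed_le hLc continuous_const)
    simp only [ofPred_forall]
    exact isClosed_iInter fun x => isClosed_iInter fun _ => isClosed_Icc.preimage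
      (hreg.comp (by fun_prop : Continuous fun t : ℝ => (t, x)))
  have h0S : (0 : ℝ) ∈ S := by
    obtain ⟨h1, h2⟩ := hstep 0 ⟨le_rfl, hT⟩ (fun s hs x hx => by
      rw [le_antisymm hs.2 hs.1]
      exact hI0 x hx) hδ0
    exact ⟨h1, h2.le⟩
  set B : Set ℝ := {t | Icc 0 t ⊆ S} with hB
  have hBclosed : IsClosed (B ∩ Icc 0 T) := by
    refine isClosed_of_closure_subset fun t ht => ?_
    have htT : t ∈ Icc 0 T := closure_minimal inter_subset_right isClosed_Icc ht
    refine ⟨fun s hs => ?_, htT⟩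
    have hlt : ∀ s ∈ Ico 0 t, s ∈ S := by
      intro s hs
      obtain ⟨t', ht', ht'B⟩ := mem_closure_iff.1 ht (Ioi s) isOpen_Ioi hs.2
      exact ht'B.1 ⟨hs.1, (mem_Ioi.1 ht').le⟩
    rcases htT.1.eq_or_lt with h0 | h0
    · rw [le_antisymm (hs.2.trans h0.ge) hs.1]
      exact h0S
    · have h1 := closure_minimal (t := S) (fun s hs => hlt s hs) hSclosed
      rw [closure_Ico h0.ne] at h1
      exact h1 hs
  have hsub : Icc 0 T ⊆ B := by
    refine hBclosed.Icc_subset_of_forall_exists_gt (fun s hs => ?_) ?_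
    · rw [le_antisymm hs.2 hs.1]
      exact h0S
    · rintro t ⟨htB, ht⟩ y hy
      have hltδ := (hstep t (Ico_subset_Icc_self ht)
        (fun s hs x hx => hk ((htB hs).1 x hx)) (htB ⟨ht.1, le_rfl⟩).2).2
      have hev1 : ∀ᶠ s in nhds t, L s < δ := hLc.continuousAt.eventually_lt_const hltδ
      have hev2 : ∀ᶠ s in nhds t, ∀ x ∈ Icc a b, u s x ∈ I :=
        isCompact_Icc.eventually_forall_of_forall_eventually fun x hx =>
          hreg.continuousAt.eventually (hIopen.mem_nhds (hk ((htB ⟨ht.1, le_rfl⟩).1 x hx)))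
      obtain ⟨τ, hτ, hball⟩ := Metric.eventually_nhds_iff.1 (hev1.and hev2)
      have hlt : t < min (t + τ / 2) (min y T) :=
        lt_min (by linarith) (lt_min hy ht.2)
      refine ⟨min (t + τ / 2) (min y T), fun s hs => ?_, hlt,
        (min_le_right _ _).trans (min_le_left _ _)⟩
      have hnear : ∀ s', t < s' → s' ≤ s → L s' < δ ∧ ∀ x ∈ Icc a b, u s' x ∈ I := by
        intro s' h1 h2
        refine hball ?_
        have h3 := (h2.trans hs.2).trans (min_le_left _ _)
        rw [Real.dist_eq, abs_of_pos (sub_pos.2 h1)]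
        linarith
      rcases le_or_gt s t with hst | hst
      · exact htB ⟨hs.1, hst⟩
      · have hsT : s ≤ T := (hs.2.trans (min_le_right _ _)).trans (min_le_right _ _)
        have hLs := (hnear s hst le_rfl).1.le
        refine ⟨(hstep s ⟨hs.1, hsT⟩ (fun s' hs' x hx => ?_) hLs).1, hLs⟩
        rcases le_or_gt s' t with hst' | hst'
        · exact hk ((htB ⟨hs'.1, hst'⟩).1 x hx)
        · exact (hnear s' hst' hs'.2).2 x hx
  exact fun t ht => hsub ht ⟨ht.1, le_rfl⟩

/-- Exponentially small dissipation over exponentially long times: for the solution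
`u^ε` of the Neumann problem with an initial datum having an `N`-transition layer
structure, `∫_0^{C₁ ε⁻¹ exp(A/ε)} ‖u_t^ε‖²_{L²} dt ≤ C₂ ε exp(-A/ε)`. -/
theorem stmt18
    (I : Set ℝ) (hIopen : IsOpen I) (hIconn : I.OrdConnected)
    (D f G : ℝ → ℝ) (d α β : ℝ) (hαβ : α < β) (hsub : Set.Icc α β ⊆ I)
    (hD : ContDiffOn ℝ 2 D I) (hd : 0 < d) (hDd : ∀ s ∈ I, d ≤ D s)
    (hf : ContDiffOn ℝ 2 f I)
    (hfα : f α = 0) (hfβ : f β = 0)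
    (hf'α : 0 < deriv f α) (hf'β : 0 < deriv f β)
    (hint0 : (∫ s in α..β, f s * D s) = 0)
    (hG : ∀ s, G s = ∫ z in α..s, f z * D z)
    (hGpos : ∀ s ∈ I, s ≠ α → s ≠ β → 0 < G s)
    (lam γ₀ : ℝ)
    (hlam : lam = min (deriv f α / D α) (deriv f β / D β))
    (hγ₀ : γ₀ = ∫ s in α..β, Real.sqrt (2 * G s) * D s)
    (a b r : ℝ) (hab : a < b) (hr : 0 < r)
    (N : ℕ) (h : Fin N → ℝ) (hmono : StrictMono h)
    (hsep : ∀ i j : Fin N, i < j → h i + r < h j - r)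
    (hha : ∀ i, a ≤ h i - r) (hhb : ∀ i, h i + r ≤ b)
    (v : ℝ → ℝ)
    (hvval : ∀ x ∈ Set.Icc a b, v x = α ∨ v x = β)
    (hvconst : ∀ x ∈ Set.Icc a b, ∀ y ∈ Set.Icc a b, x ≤ y →
      (∀ i, ¬(x ≤ h i ∧ h i ≤ y)) → v x = v y)
    (hvjump : ∀ i, v (h i - r) ≠ v (h i + r))
    (A : ℝ) (hA : 0 < A) (hAr : A < r * Real.sqrt (2 * lam))
    (M₁ M₂ : ℝ) (hM : M₁ ≤ M₂) (hMsub : Set.Icc M₁ M₂ ⊆ I)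
    -- the family of solutions `u ε t x` with derivatives `ut`, `ux` and `w = (D(u)u_x)_x`
    (u ut ux w : ℝ → ℝ → ℝ → ℝ)
    (hux : ∀ ε > (0:ℝ), ∀ t ≥ (0:ℝ), ∀ x ∈ Set.Icc a b,
      HasDerivAt (fun y => u ε t y) (ux ε t x) x)
    (hut : ∀ ε > (0:ℝ), ∀ t ≥ (0:ℝ), ∀ x ∈ Set.Icc a b,
      HasDerivAt (fun s => u ε s x) (ut ε t x) t)
    (hw : ∀ ε > (0:ℝ), ∀ t ≥ (0:ℝ), ∀ x ∈ Set.Icc a b,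
      HasDerivAt (fun y => D (u ε t y) * ux ε t y) (w ε t x) x)
    (hpde : ∀ ε > (0:ℝ), ∀ t > (0:ℝ), ∀ x ∈ Set.Icc a b,
      ut ε t x = ε ^ 2 * w ε t x - f (u ε t x))
    (hneu : ∀ ε > (0:ℝ), ∀ t ≥ (0:ℝ), ux ε t a = 0 ∧ ux ε t b = 0)
    (hreg : ∀ ε > (0:ℝ), Continuous fun p : ℝ × ℝ => u ε p.1 p.2)
    (hregt : ∀ ε > (0:ℝ), Continuous fun p : ℝ × ℝ => ut ε p.1 p.2)
    (hregx : ∀ ε > (0:ℝ), Continuous fun p : ℝ × ℝ => ux ε p.1 p.2)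
    -- the initial datum takes values in `[M₁,M₂] ⊂ I`
    (hval0 : ∀ ε > (0:ℝ), ∀ x ∈ Set.Icc a b, u ε 0 x ∈ Set.Icc M₁ M₂)
    -- `N`-transition layer structure of the initial datum
    (hL1 : Tendsto (fun ε => ∫ x in a..b, |u ε 0 x - v x|)
      (nhdsWithin 0 (Set.Ioi 0)) (nhds 0))
    (C₀ εa : ℝ) (hC₀ : 0 < C₀) (hεa : 0 < εa)
    (hE0 : ∀ ε ∈ Set.Ioo (0:ℝ) εa,
      (∫ x in a..b, (ε / 2 * (D (u ε 0 x) * ux ε 0 x) ^ 2 + G (u ε 0 x) / ε)) ≤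
        (N : ℝ) * γ₀ + C₀ * Real.exp (-A / ε)) :
    ∃ ε₀ > (0:ℝ), ∃ C₁ > (0:ℝ), ∃ C₂ > (0:ℝ), ∀ ε ∈ Set.Ioo (0:ℝ) ε₀,
      (∫ t in (0:ℝ)..(C₁ * ε⁻¹ * Real.exp (A / ε)), ∫ x in a..b, (ut ε t x) ^ 2) ≤
        C₂ * ε * Real.exp (-A / ε) := by
  have hαI : α ∈ I := hsub ⟨le_rfl, hαβ.le⟩
  have hβI : β ∈ I := hsub ⟨hαβ.le, le_rfl⟩
  have hDc : ContinuousOn D I := hD.continuousOn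
  have hfc : ContinuousOn f I := hf.continuousOn
  have hDpos : ∀ s ∈ I, 0 < D s := fun s hs => hd.trans_le (hDd s hs)
  have hGd : ∀ s ∈ I, HasDerivAt G (f s * D s) s := fun s hs => by
    rw [funext hG]
    exact hasDerivAt_primitive hIopen hIconn (hfc.mul hDc) hαI hs
  have hGc : ContinuousOn G I := fun s hs => (hGd s hs).continuousAt.continuousWithinAt
  have hlam0 : 0 < lam := by
    rw [hlam]
    exact lt_min (div_pos hf'α (hDpos α hαI)) (div_pos hf'β (hDpos β hβI))
  have hlamα : lam * D α ≤ deriv f α :=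
    (le_div_iff₀ (hDpos α hαI)).1 (hlam ▸ min_le_left _ _)
  have hlamβ : lam * D β ≤ deriv f β :=
    (le_div_iff₀ (hDpos β hβI)).1 (hlam ▸ min_le_right _ _)
  set ℓ : ℝ := Real.sqrt (2 * lam) with hℓ_def
  have hℓ : 0 < ℓ := Real.sqrt_pos.2 (by linarith)
  have hκsq : 2 * (ℓ / 2) ^ 2 = lam := by
    have h1 : ℓ ^ 2 = 2 * lam := Real.sq_sqrt (by linarith)
    linarith
  obtain ⟨η, ξ, k₁, k₂, P, Q, p, q, hW⟩ := exists_isWellPotential (κ := ℓ / 2) hIopen hIconn hαβ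
    hsub hDc hDpos (hf.differentiableOn (by norm_num))
    (hf.continuousOn_deriv_of_isOpen hIopen (by norm_num)) hfα hfβ hf'α hf'β hGd
    (by rw [hG, intervalIntegral.integral_same]) (by rw [hG, hint0]) hGpos (by positivity)
    (by rwa [hκsq]) (by rwa [hκsq])
  rw [← hγ₀] at hW
  have hAℓ : A / ℓ < r := (div_lt_iff₀ hℓ).2 hAr
  obtain ⟨δ, hδ, C, hC, ε₁, hε₁, hlower⟩ := exists_energy_lower_bound hW (by positivity) hDc
    (fun s hs => (hDpos s hs).le) hGc hαI hβI hab (ρ := r - A / ℓ) (by linarith)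
    (by linarith [div_pos hA hℓ]) hsep hha hhb hvval hvconst hvjump hA
    (by field_simp; ring) (C₀ := C₀)
  have hvi := intervalIntegrable_of_step hab.le hvval hvconst
  obtain ⟨ε₂, hε₂, hδ0⟩ := mem_nhdsGT_iff_exists_Ioo_subset.1
    (hL1.eventually_le_const (half_pos hδ))
  have hba : 0 < b - a := sub_pos.2 hab
  set C₂ : ℝ := (C₀ + C) / d with hC₂_def
  have hC₂ : 0 < C₂ := by positivity
  set c : ℝ := 4 * C₂ / δ with hc_def
  have hc : 0 < c := by positivity
  refine ⟨min εa (min ε₁ ε₂), lt_min hεa (lt_min hε₁ hε₂), δ / (4 * c * (b - a)), by positivity,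
    C₂, hC₂, fun ε hε => ?_⟩
  have hε0 : 0 < ε := hε.1
  have hεεa : ε < εa := hε.2.trans_le (min_le_left _ _)
  have hεε₁ : ε < ε₁ := hε.2.trans_le ((min_le_right _ _).trans (min_le_left _ _))
  have hεε₂ : ε < ε₂ := hε.2.trans_le ((min_le_right _ _).trans (min_le_right _ _))
  have hexp : 0 < Real.exp (-A / ε) := Real.exp_pos _
  have hexp_inv : Real.exp (A / ε) = (Real.exp (-A / ε))⁻¹ := by
    rw [← Real.exp_neg]
    congr 1
    ring
  rw [hexp_inv]
  set T : ℝ := δ / (4 * c * (b - a)) * ε⁻¹ * (Real.exp (-A / ε))⁻¹ with hT_def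
  have hT : 0 < T := by positivity
  have hslice : ∀ {g : ℝ → ℝ → ℝ}, (Continuous fun p : ℝ × ℝ => g p.1 p.2) →
      ∀ t, Continuous (g t) := fun hg t =>
    hg.comp (by fun_prop : Continuous fun x : ℝ => (t, x))
  have hstep : ∀ t ∈ Icc 0 T, (∀ s ∈ Icc 0 t, ∀ x ∈ Icc a b, u ε s x ∈ I) →
      (∫ x in a..b, |u ε t x - v x|) ≤ δ →
      (∀ x ∈ Icc a b, u ε t x ∈ Icc k₁ k₂) ∧ (∫ x in a..b, |u ε t x - v x|) < δ ∧
        (∫ s in (0 : ℝ)..t, ∫ x in a..b, ut ε s x ^ 2) ≤ C₂ * ε * Real.exp (-A / ε) := by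
    intro t ht hmem hLt
    have hdiss := energy_dissipation hIopen hIconn hDc hDd hfc hGd hε0 hab.le ht.1 (hux ε hε0)
      (hut ε hε0) (hw ε hε0) (hpde ε hε0) (hneu ε hε0) (hreg ε hε0) (hregt ε hε0) (hregx ε hε0) hmem
    have hE := hE0 ε ⟨hε0, hεεa⟩
    set J : ℝ := ∫ s in (0 : ℝ)..t, ∫ x in a..b, ut ε s x ^ 2 with hJ_def
    have hJ : 0 ≤ J := intervalIntegral.integral_nonneg ht.1 fun s _ =>
      intervalIntegral.integral_nonneg hab.le fun x _ => sq_nonneg _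
    have hdJ : 0 ≤ d / ε * J := by positivity
    obtain ⟨hEt, hk⟩ := hlower ε ⟨hε0, hεε₁⟩ (u ε t) (ux ε t) (hux ε hε0 t ht.1)
      (hslice (hregx ε hε0) t).continuousOn (hmem t ⟨ht.1, le_rfl⟩) hLt (by linarith)
    have hJle : J ≤ C₂ * ε * Real.exp (-A / ε) := by
      have h1 : d / ε * J ≤ (C₀ + C) * Real.exp (-A / ε) := by linarith
      have h2 : d / ε * (C₂ * ε * Real.exp (-A / ε)) = (C₀ + C) * Real.exp (-A / ε) := by
        rw [hC₂_def]
        field_simp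
      exact le_of_mul_le_mul_left (h1.trans h2.ge) (div_pos hd hε0)
    refine ⟨hk, ?_, hJle⟩
    have hμ : 0 < c * ε * Real.exp (-A / ε) := by positivity
    have hdrift := integral_abs_sub_le_dissipation hab.le ht.1 hμ (hut ε hε0) (hreg ε hε0)
      (hregt ε hε0)
    have h1 : c * ε * Real.exp (-A / ε) / 2 * (t * (b - a)) ≤ δ / 8 := by
      have h2 : c * ε * Real.exp (-A / ε) / 2 * (T * (b - a)) = δ / 8 := by
        rw [hT_def]
        field_simp
        norm_num
      rw [← h2]
      have := ht.2
      gcongr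
    have h2 : 1 / (2 * (c * ε * Real.exp (-A / ε))) * J ≤ δ / 8 := by
      have h3 : 1 / (2 * (c * ε * Real.exp (-A / ε))) * (C₂ * ε * Real.exp (-A / ε)) = δ / 8 := by
        rw [hc_def]
        field_simp
        norm_num
      rw [← h3]
      gcongr
    have h3 := integral_abs_sub_le_add hab.le (hslice (hreg ε hε0) t) (hslice (hreg ε hε0) 0) hvi
    have h4 : (∫ x in a..b, |u ε 0 x - v x|) ≤ δ / 2 := hδ0 ⟨hε0, hεε₂⟩
    linarith
  have hconf := confinement hIopen hab.le hT.le hW.Icc_subset (hreg ε hε0) hvi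
    (fun t ht hmem hLt => ⟨(hstep t ht hmem hLt).1, (hstep t ht hmem hLt).2.1⟩)
    (fun x hx => hMsub (hval0 ε hε0 x hx))
    ((hδ0 ⟨hε0, hεε₂⟩ : (∫ x in a..b, |u ε 0 x - v x|) ≤ δ / 2).trans (by linarith))
  exact (hstep T ⟨hT.le, le_rfl⟩ (fun s hs x hx => hW.Icc_subset ((hconf s hs).1 x hx))
    (hconf T ⟨hT.le, le_rfl⟩).2).2.2
end
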